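/- arXiv:2603.09048 — 2 statements merged into one kernel-verified Lean document; each statement's English description precedes it below -/
import Mathlib

section
/- For every ε > 0, there exists a finite point set P ⊂ ℝ² in general position and points s, t ∈ P such that every directed path from s to t in the directed Theta-6 graph of P has Euclidean length at least (5 − ε)·‖st‖₂. -/
open Real

/-- Hexagonal norm: unit disk is the regular hexagon with east/west vertices (±1,0). -/
noncomputable def hexNorm (p : ℝ × ℝ) : ℝ :=
  max (2 * |p.2| / Real.sqrt 3) (max |p.1 + p.2 / Real.sqrt 3| |p.1 - p.2 / Real.sqrt 3|)

/-- Tipped hexagonal norm: unit disk is the regular hexagon with north/south vertices (0, ±2/√3). -/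
noncomputable def thexNorm (p : ℝ × ℝ) : ℝ :=
  max |p.1| (max (|p.1 + Real.sqrt 3 * p.2| / 2) (|p.1 - Real.sqrt 3 * p.2| / 2))

/-- Euclidean norm of a planar vector. -/
noncomputable def eucNorm (p : ℝ × ℝ) : ℝ := Real.sqrt (p.1 ^ 2 + p.2 ^ 2)

/-- Rotation of a planar vector by angle θ (counterclockwise). -/
noncomputable def rot (θ : ℝ) (p : ℝ × ℝ) : ℝ × ℝ :=
  (Real.cos θ * p.1 - Real.sin θ * p.2, Real.sin θ * p.1 + Real.cos θ * p.2)

/-- The cone of directions pointing straight down (spanning 60°), bounded by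
lines of slopes √3 and -√3 through the origin. -/
def cone0 : Set (ℝ × ℝ) := {v | v.2 ≤ 0 ∧ Real.sqrt 3 * |v.1| ≤ -v.2}

/-- Coordinates of q in the frame of the i-th cone of p (cone rotated back to cone0). -/
noncomputable def localCoord (p : ℝ × ℝ) (i : ZMod 6) (q : ℝ × ℝ) : ℝ × ℝ :=
  rot (-((i.val : ℝ) * (Real.pi / 3))) (q - p)

/-- The closed cone `C_p^i`: the six cones about p determined by the lines of
slopes -√3, 0, √3 through p, labeled counterclockwise with `C_p^0` directly below p. -/
def cone (p : ℝ × ℝ) (i : ZMod 6) : Set (ℝ × ℝ) :=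
  {q | localCoord p i q ∈ cone0}

/-- The triangle `∇_u^v`: points of the cone of u containing v whose hex-distance
to u is at most that of v. -/
def nabla (u v : ℝ × ℝ) : Set (ℝ × ℝ) :=
  {r | hexNorm (r - u) ≤ hexNorm (v - u) ∧ ∀ i : ZMod 6, v ∈ cone u i → r ∈ cone u i}

/-- Side length of an equilateral triangle with sides of slopes -√3, 0, √3,
realized as its diameter in the hexagonal norm. -/
noncomputable def sideLen (T : Set (ℝ × ℝ)) : ℝ :=
  sSup ((fun pq : (ℝ × ℝ) × (ℝ × ℝ) => hexNorm (pq.1 - pq.2)) '' (T ×ˢ T))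

/-- General position: no two points lie on a common line of slope -√3, 0 or √3. -/
def genPos (P : Finset (ℝ × ℝ)) : Prop :=
  ∀ p ∈ P, ∀ q ∈ P, p ≠ q →
    p.2 ≠ q.2 ∧ p.2 - q.2 ≠ Real.sqrt 3 * (p.1 - q.1) ∧
      p.2 - q.2 ≠ -(Real.sqrt 3) * (p.1 - q.1)

/-- Edge of the directed Theta-6 graph of P: from u to v exactly when the interior
of `∇_u^v` contains no point of P. -/
def isEdge (P : Finset (ℝ × ℝ)) (u v : ℝ × ℝ) : Prop :=
  u ∈ P ∧ v ∈ P ∧ u ≠ v ∧ ∀ p ∈ P, p ∉ interior (nabla u v)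

/-- A directed path in the Theta-6 graph of P from s to t, given as its list of vertices. -/
def isPath (P : Finset (ℝ × ℝ)) (ℓ : List (ℝ × ℝ)) (s t : ℝ × ℝ) : Prop :=
  ℓ ≠ [] ∧ ℓ.head? = some s ∧ ℓ.getLast? = some t ∧ ℓ.Chain' (isEdge P)

/-- Euclidean length of a path. -/
noncomputable def pathLen (ℓ : List (ℝ × ℝ)) : ℝ :=
  ((ℓ.zip ℓ.tail).map (fun pq => eucNorm (pq.2 - pq.1))).sum

/-! ### Coordinates adapted to the three directions of the cones -/

/-- Vertical coordinate, constant on horizontal lines. -/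
noncomputable def coordA (q : ℝ × ℝ) : ℝ := 2 * q.2 / √3

/-- Coordinate constant on lines of slope `-√3`. -/
noncomputable def coordB (q : ℝ × ℝ) : ℝ := q.1 + q.2 / √3

/-- Coordinate constant on lines of slope `√3`. -/
noncomputable def coordC (q : ℝ × ℝ) : ℝ := q.1 - q.2 / √3

/-- The point with `coordB = b` and `coordC = c`. -/
noncomputable def ofCoord (b c : ℝ) : ℝ × ℝ := ((b + c) / 2, √3 * (b - c) / 2)

lemma hexNorm_eq_max_coord (q : ℝ × ℝ) :
    hexNorm q = max |coordA q| (max |coordB q| |coordC q|) := by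
  have h3 : (0 : ℝ) < √3 := by positivity
  simp [hexNorm, coordA, coordB, coordC, abs_div, abs_mul, abs_of_pos h3]

lemma coordA_eq_sub (q : ℝ × ℝ) : coordA q = coordB q - coordC q := by
  simp only [coordA, coordB, coordC]; ring

lemma coordB_ofCoord_sub (b c b' c' : ℝ) :
    coordB (ofCoord b c - ofCoord b' c') = b - b' := by
  have h3 : (0 : ℝ) < √3 := by positivity
  simp only [coordB, ofCoord, Prod.fst_sub, Prod.snd_sub]; field_simp; ring

lemma coordC_ofCoord_sub (b c b' c' : ℝ) :
    coordC (ofCoord b c - ofCoord b' c') = c - c' := by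
  have h3 : (0 : ℝ) < √3 := by positivity
  simp only [coordC, ofCoord, Prod.fst_sub, Prod.snd_sub]; field_simp; ring

lemma eucNorm_ofCoord_sub (b c b' c' : ℝ) :
    eucNorm (ofCoord b c - ofCoord b' c') =
      √((b - b') ^ 2 + (c - c') ^ 2 - (b - b') * (c - c')) := by
  have h3 : √3 ^ 2 = (3 : ℝ) := Real.sq_sqrt (by norm_num)
  simp only [eucNorm, ofCoord, Prod.fst_sub, Prod.snd_sub]
  congr 1
  linear_combination (b - c - b' + c') ^ 2 / 4 * h3

lemma eucNorm_nonneg (q : ℝ × ℝ) : 0 ≤ eucNorm q := Real.sqrt_nonneg _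

lemma mem_cone0_iff (q : ℝ × ℝ) : q ∈ cone0 ↔ coordB q ≤ 0 ∧ 0 ≤ coordC q := by
  have hp : (0 : ℝ) < √3 := by positivity
  obtain ⟨x, y⟩ := q
  have hb : coordB (x, y) ≤ 0 ↔ √3 * x + y ≤ 0 := by
    have : √3 * x + y = √3 * coordB (x, y) := by simp only [coordB]; field_simp
    rw [this, ← neg_nonneg, ← neg_nonneg (a := √3 * _), ← mul_neg, mul_nonneg_iff_of_pos_left hp]
  have hc : 0 ≤ coordC (x, y) ↔ 0 ≤ √3 * x - y := by
    have : √3 * x - y = √3 * coordC (x, y) := by simp only [coordC]; field_simp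
    rw [this, mul_nonneg_iff_of_pos_left hp]
  rw [hb, hc]
  simp only [cone0, Set.mem_ofPred_eq]
  constructor
  · rintro ⟨-, h⟩
    have h1 := mul_le_mul_of_nonneg_left (le_abs_self x) hp.le
    have h2 := mul_le_mul_of_nonneg_left (neg_abs_le x) hp.le
    constructor <;> linarith
  · rintro ⟨h1, h2⟩
    refine ⟨by linarith, ?_⟩
    rcases abs_cases x with ⟨h, -⟩ | ⟨h, -⟩ <;> rw [h] <;> linarith

/-- A clockwise rotation by `π / 3` permutes the coordinates up to sign. -/
lemma coord_rot (q : ℝ × ℝ) :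
    coordB (rot (-(π / 3)) q) = coordA q ∧ coordC (rot (-(π / 3)) q) = coordB q := by
  have h3 : √3 ^ 2 = (3 : ℝ) := Real.sq_sqrt (by norm_num)
  have hp : (0 : ℝ) < √3 := by positivity
  simp only [rot, coordA, coordB, coordC, cos_neg, sin_neg, cos_pi_div_three, sin_pi_div_three]
  constructor <;> field_simp <;> linear_combination q.2 * h3

lemma rot_rot (θ φ : ℝ) (q : ℝ × ℝ) : rot θ (rot φ q) = rot (θ + φ) q := by
  ext <;> simp only [rot, cos_add, sin_add] <;> ring

lemma rot_neg_succ_mul (k : ℕ) (q : ℝ × ℝ) :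
    rot (-(((k + 1 : ℕ) : ℝ) * (π / 3))) q = rot (-(π / 3)) (rot (-((k : ℝ) * (π / 3))) q) := by
  rw [rot_rot]; congr 1; push_cast; ring

/-- Membership in a cone depends on the signs of two of the three coordinates. -/
lemma mem_cone_iff (u v : ℝ × ℝ) (i : ZMod 6) :
    v ∈ cone u i ↔
      match i with
      | 0 => coordB (v - u) ≤ 0 ∧ 0 ≤ coordC (v - u)
      | 1 => 0 ≤ coordB (v - u) ∧ coordA (v - u) ≤ 0
      | 2 => 0 ≤ coordA (v - u) ∧ 0 ≤ coordC (v - u)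
      | 3 => 0 ≤ coordB (v - u) ∧ coordC (v - u) ≤ 0
      | 4 => coordB (v - u) ≤ 0 ∧ 0 ≤ coordA (v - u)
      | 5 => coordA (v - u) ≤ 0 ∧ coordC (v - u) ≤ 0 := by
  have h0 : rot (-(((0 : ℕ) : ℝ) * (π / 3))) (v - u) = v - u := by
    ext <;> simp [rot]
  have hB := fun q => (coord_rot q).1
  have hC := fun q => (coord_rot q).2
  have hv : v ∈ cone u i ↔ rot (-((i.val : ℝ) * (π / 3))) (v - u) ∈ cone0 := Iff.rfl
  rw [hv, mem_cone0_iff]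
  fin_cases i
  · change coordB (rot (-(((0 : ℕ) : ℝ) * (π / 3))) (v - u)) ≤ 0 ∧
      0 ≤ coordC (rot (-(((0 : ℕ) : ℝ) * (π / 3))) (v - u)) ↔ _
    rw [h0]
  · change coordB (rot (-(((0 + 1 : ℕ) : ℝ) * (π / 3))) (v - u)) ≤ 0 ∧
      0 ≤ coordC (rot (-(((0 + 1 : ℕ) : ℝ) * (π / 3))) (v - u)) ↔ _
    simp only [rot_neg_succ_mul, h0, hB, hC]
    exact and_comm
  · change coordB (rot (-(((0 + 1 + 1 : ℕ) : ℝ) * (π / 3))) (v - u)) ≤ 0 ∧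
      0 ≤ coordC (rot (-(((0 + 1 + 1 : ℕ) : ℝ) * (π / 3))) (v - u)) ↔ _
    simp only [rot_neg_succ_mul, h0, hB, hC, coordA_eq_sub]
    constructor <;> rintro ⟨h1, h2⟩ <;> constructor <;> linarith
  · change coordB (rot (-(((0 + 1 + 1 + 1 : ℕ) : ℝ) * (π / 3))) (v - u)) ≤ 0 ∧
      0 ≤ coordC (rot (-(((0 + 1 + 1 + 1 : ℕ) : ℝ) * (π / 3))) (v - u)) ↔ _
    simp only [rot_neg_succ_mul, h0, hB, hC, coordA_eq_sub]
    constructor <;> rintro ⟨h1, h2⟩ <;> constructor <;> linarith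
  · change coordB (rot (-(((0 + 1 + 1 + 1 + 1 : ℕ) : ℝ) * (π / 3))) (v - u)) ≤ 0 ∧
      0 ≤ coordC (rot (-(((0 + 1 + 1 + 1 + 1 : ℕ) : ℝ) * (π / 3))) (v - u)) ↔ _
    simp only [rot_neg_succ_mul, h0, hB, hC, coordA_eq_sub]
    constructor <;> rintro ⟨h1, h2⟩ <;> constructor <;> linarith
  · change coordB (rot (-(((0 + 1 + 1 + 1 + 1 + 1 : ℕ) : ℝ) * (π / 3))) (v - u)) ≤ 0 ∧
      0 ≤ coordC (rot (-(((0 + 1 + 1 + 1 + 1 + 1 : ℕ) : ℝ) * (π / 3))) (v - u)) ↔ _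
    simp only [rot_neg_succ_mul, h0, hB, hC, coordA_eq_sub]
    constructor <;> rintro ⟨h1, h2⟩ <;> constructor <;> linarith

/-- A point in the same open cone of `u` as `v`, strictly closer to `u` in the hexagonal norm, is
interior to the triangle of `v`. -/
lemma mem_interior_nabla {u v r : ℝ × ℝ} (hA : 0 < coordA (r - u) * coordA (v - u))
    (hB : 0 < coordB (r - u) * coordB (v - u)) (hC : 0 < coordC (r - u) * coordC (v - u))
    (h : hexNorm (r - u) < hexNorm (v - u)) : r ∈ interior (nabla u v) := by
  refine mem_interior.2 ⟨{q | hexNorm (q - u) < hexNorm (v - u) ∧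
    0 < coordA (q - u) * coordA (v - u) ∧ 0 < coordB (q - u) * coordB (v - u) ∧
    0 < coordC (q - u) * coordC (v - u)}, ?_, ?_, h, hA, hB, hC⟩
  · rintro q ⟨hq, qA, qB, qC⟩
    refine ⟨hq.le, fun i hi => ?_⟩
    have hle : ∀ {x y : ℝ}, 0 < x * y → y ≤ 0 → x ≤ 0 := fun hxy hy => by
      by_contra! hx; nlinarith
    have hge : ∀ {x y : ℝ}, 0 < x * y → 0 ≤ y → 0 ≤ x := fun hxy hy => by
      by_contra! hx; nlinarith
    rw [mem_cone_iff] at hi ⊢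
    fin_cases i
    · exact ⟨hle qB hi.1, hge qC hi.2⟩
    · exact ⟨hge qB hi.1, hle qA hi.2⟩
    · exact ⟨hge qA hi.1, hge qC hi.2⟩
    · exact ⟨hge qB hi.1, hle qC hi.2⟩
    · exact ⟨hle qB hi.1, hge qA hi.2⟩
    · exact ⟨hle qA hi.1, hle qC hi.2⟩
  · simp only [Set.ofPred_and, hexNorm, coordA, coordB, coordC, Prod.fst_sub, Prod.snd_sub]
    refine (isOpen_lt ?_ ?_).inter ((isOpen_lt ?_ ?_).inter
      ((isOpen_lt ?_ ?_).inter (isOpen_lt ?_ ?_))) <;> fun_prop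

lemma mem_interior_nabla_ofCoord {b c b₁ c₁ b₂ c₂ : ℝ}
    (hA : 0 < (b₁ - b - (c₁ - c)) * (b₂ - b - (c₂ - c)))
    (hB : 0 < (b₁ - b) * (b₂ - b)) (hC : 0 < (c₁ - c) * (c₂ - c))
    (h : max |b₁ - b - (c₁ - c)| (max |b₁ - b| |c₁ - c|) <
      max |b₂ - b - (c₂ - c)| (max |b₂ - b| |c₂ - c|)) :
    ofCoord b₁ c₁ ∈ interior (nabla (ofCoord b c) (ofCoord b₂ c₂)) := by
  apply mem_interior_nabla <;>
    simpa only [hexNorm_eq_max_coord, coordA_eq_sub, coordB_ofCoord_sub, coordC_ofCoord_sub]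

/-! ### Paths that cannot skip vertices -/

lemma sum_le_pathLen {P : Finset (ℝ × ℝ)} {p : ℕ → ℝ × ℝ} {N : ℕ}
    (hP : ∀ q ∈ P, ∃ i ≤ N, q = p i) (hinj : ∀ i < N, p i ≠ p N)
    (hedge : ∀ i ≤ N, ∀ j ≤ N, isEdge P (p i) (p j) → j ≤ i + 1) :
    ∀ (ℓ : List (ℝ × ℝ)) (i : ℕ), i ≤ N → isPath P ℓ (p i) (p N) →
      ∑ k ∈ Finset.Ico i N, eucNorm (p (k + 1) - p k) ≤ pathLen ℓ
  | [], _, _, h => absurd rfl h.1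
  | [x], i, hi, h => by
    have h1 : x = p i := by simpa using h.2.1
    have h2 : x = p N := by simpa using h.2.2.1
    obtain rfl | hlt := hi.eq_or_lt
    · simp [pathLen]
    · exact absurd (h1.symm.trans h2) (hinj i hlt)
  | x :: y :: l, i, hi, h => by
    obtain ⟨-, h1, h2, h3⟩ := h
    obtain rfl : x = p i := by simpa using h1
    obtain ⟨hxy, hl⟩ := List.isChain_cons_cons.1 h3
    obtain ⟨j, hj, rfl⟩ := hP y hxy.2.1
    have ih := sum_le_pathLen hP hinj hedge (p j :: l) j hj
      ⟨by simp, by simp, by simpa using h2, hl⟩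
    have hlen : pathLen (p i :: p j :: l) = eucNorm (p j - p i) + pathLen (p j :: l) := by
      simp [pathLen]
    rw [hlen]
    have hji := hedge i hi j hj hxy
    obtain rfl | hlt := hji.eq_or_lt
    · rw [Finset.sum_eq_sum_Ico_succ_bot (by omega)]
      linarith
    · have : ∑ k ∈ Finset.Ico i N, eucNorm (p (k + 1) - p k) ≤
          ∑ k ∈ Finset.Ico j N, eucNorm (p (k + 1) - p k) :=
        Finset.sum_le_sum_of_subset_of_nonneg
          (Finset.Ico_subset_Ico_left (by omega)) fun _ _ _ => eucNorm_nonneg _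
      have := eucNorm_nonneg (p j - p i)
      linarith

/-! ### The point set: three sides of a hexagon followed by a tapering zigzag -/

/-- Horizontal offset of the `k`-th vertex of the zigzag from its axis. -/
def zigzag (δ : ℝ) (k : ℕ) : ℝ := (-1) ^ k * (1 - k * δ)

/-- `coordB` of the `i`-th vertex. -/
noncomputable def vertexB (m : ℕ) (δ : ℝ) : ℕ → ℝ
  | 0 => 2 * m + 5
  | 1 => 2 * m + 4
  | 2 => m + 1
  | k + 3 => k + zigzag δ k / 2

/-- `coordC` of the `i`-th vertex. -/
def vertexC (m : ℕ) (δ : ℝ) : ℕ → ℝ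
  | 0 => -2
  | 1 => m + 3
  | 2 => m + 2
  | k + 3 => zigzag δ k

/-- The `i`-th vertex. -/
noncomputable def vertex (m : ℕ) (δ : ℝ) (i : ℕ) : ℝ × ℝ :=
  ofCoord (vertexB m δ i) (vertexC m δ i)

section Zigzag

variable {m : ℕ} {δ : ℝ}

lemma zigzag_of_even {k : ℕ} (hk : Even k) : zigzag δ k = 1 - k * δ := by
  simp [zigzag, hk.neg_one_pow]

lemma zigzag_of_odd {k : ℕ} (hk : Odd k) : zigzag δ k = -(1 - k * δ) := by
  simp [zigzag, hk.neg_one_pow]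

lemma abs_zigzag (hmδ : m * δ < 1) (hδ : 0 < δ) {k : ℕ} (hk : k ≤ m) :
    |zigzag δ k| = 1 - k * δ := by
  have : (k : ℝ) * δ ≤ m * δ := by gcongr
  rw [zigzag, abs_mul, abs_pow, abs_neg, abs_one, one_pow, one_mul, abs_of_pos (by linarith)]

lemma zigzag_bounds (hmδ : m * δ < 1) (hδ : 0 < δ) {k : ℕ} (hk : k ≤ m) :
    -1 ≤ zigzag δ k ∧ zigzag δ k ≤ 1 := by
  have h1 := abs_zigzag hmδ hδ hk
  have h2 : 0 ≤ (k : ℝ) * δ := by positivity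
  exact abs_le.1 (by linarith)

lemma abs_zigzag_lt (hmδ : m * δ < 1) (hδ : 0 < δ) {k l : ℕ} (hkl : k < l) (hl : l ≤ m) :
    |zigzag δ l| < |zigzag δ k| := by
  rw [abs_zigzag hmδ hδ hl, abs_zigzag hmδ hδ (hkl.le.trans hl)]
  have : (k : ℝ) * δ < l * δ := by gcongr
  linarith

lemma abs_zigzag_sub_lt (hmδ : m * δ < 1) (hδ : 0 < δ) {k l : ℕ} (hkl : k < l) (hl : l ≤ m) :
    |zigzag δ l - zigzag δ k| < 2 * (l - k : ℝ) := by
  have h1 := abs_zigzag_lt hmδ hδ hkl hl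
  have h2 : |zigzag δ k| ≤ 1 := abs_le.2 (zigzag_bounds hmδ hδ (hkl.le.trans hl))
  have h3 : (k : ℝ) + 1 ≤ l := by exact_mod_cast hkl
  have h4 := abs_sub (zigzag δ l) (zigzag δ k)
  linarith

lemma zigzag_lt_of_even (hmδ : m * δ < 1) (hδ : 0 < δ) {k l : ℕ} (hk : Even k) (hkl : k < l)
    (hl : l ≤ m) : zigzag δ l < zigzag δ k := by
  have h1 := abs_zigzag_lt hmδ hδ hkl hl
  rw [abs_zigzag hmδ hδ (hkl.le.trans hl), ← zigzag_of_even hk] at h1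
  exact (le_abs_self _).trans_lt h1

lemma lt_zigzag_of_odd (hmδ : m * δ < 1) (hδ : 0 < δ) {k l : ℕ} (hk : Odd k) (hkl : k < l)
    (hl : l ≤ m) : zigzag δ k < zigzag δ l := by
  have h1 := abs_zigzag_lt hmδ hδ hkl hl
  have h2 := zigzag_of_odd (δ := δ) hk
  rw [abs_zigzag hmδ hδ (hkl.le.trans hl)] at h1
  linarith [neg_abs_le (zigzag δ l)]

lemma vertex_separated (hmδ : m * δ < 1) (hδ : 0 < δ) {i j : ℕ} (hij : i < j) (hj : j ≤ m + 3) :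
    vertexB m δ i ≠ vertexB m δ j ∧ vertexC m δ i ≠ vertexC m δ j ∧
      vertexB m δ i - vertexC m δ i ≠ vertexB m δ j - vertexC m δ j := by
  have hm : (0 : ℝ) ≤ m := by positivity
  rcases i with _ | _ | _ | k <;> rcases j with _ | _ | _ | l <;> try omega
  case succ.succ.succ.succ.succ.succ =>
    have hkl : k < l := by omega
    have hl : l ≤ m := by omega
    obtain ⟨h1, h2⟩ := abs_lt.1 (abs_zigzag_sub_lt hmδ hδ hkl hl)
    simp only [vertexB, vertexC]
    refine ⟨fun h => by linarith, fun h => ?_, fun h => by linarith⟩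
    exact (abs_zigzag_lt hmδ hδ hkl hl).ne (by rw [h])
  case zero.succ.succ.succ | succ.zero.succ.succ.succ | succ.succ.zero.succ.succ.succ =>
    have hl : l ≤ m := by omega
    have hl' : (l : ℝ) ≤ m := by exact_mod_cast hl
    have h0 : (0 : ℝ) ≤ l := by positivity
    obtain ⟨h1, h2⟩ := zigzag_bounds hmδ hδ hl
    simp only [vertexB, vertexC]
    refine ⟨fun h => ?_, fun h => ?_, fun h => ?_⟩ <;> linarith
  all_goals
    simp only [vertexB, vertexC]
    refine ⟨fun h => ?_, fun h => ?_, fun h => ?_⟩ <;> linarith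

/-- All vertices after the `i`-th lie in a single cone of it, in which the next one is nearest. -/
lemma succ_mem_interior_nabla (hmδ : m * δ < 1) (hδ : 0 < δ) {i j : ℕ} (hij : i + 2 ≤ j)
    (hj : j ≤ m + 3) :
    vertex m δ (i + 1) ∈ interior (nabla (vertex m δ i) (vertex m δ j)) := by
  have hm : (0 : ℝ) ≤ m := by positivity
  have hlt : ∀ {x y : ℝ}, (-y < x ∧ x < y) → |x| < y := abs_lt.2
  have hstrip : ∀ l ≤ m, (0 : ℝ) ≤ l ∧ (l : ℝ) ≤ m ∧ -1 ≤ zigzag δ l ∧ zigzag δ l ≤ 1 :=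
    fun l hl => ⟨by positivity, by exact_mod_cast hl, zigzag_bounds hmδ hδ hl⟩
  rcases i with _ | _ | _ | k
  · have hb : vertexB m δ j ≤ m + 1 := by
      rcases j with _ | _ | _ | l <;> try omega
      · simp [vertexB]
      · obtain ⟨h0, h1, h2, h3⟩ := hstrip l (by omega)
        simp only [vertexB]; linarith
    have hc : -1 ≤ vertexC m δ j := by
      rcases j with _ | _ | _ | l <;> try omega
      · simp only [vertexC]; linarith
      · exact (hstrip l (by omega)).2.2.1
    have ha : vertexB m δ j - vertexC m δ j < m + 1 := by
      rcases j with _ | _ | _ | l <;> try omega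
      · simp only [vertexB, vertexC]; linarith
      · obtain ⟨h0, h1, h2, h3⟩ := hstrip l (by omega)
        simp only [vertexB, vertexC]; linarith
    simp only [vertex]
    generalize vertexB m δ j = b at hb ha ⊢
    generalize vertexC m δ j = c at hc ha ⊢
    apply mem_interior_nabla_ofCoord
    · apply mul_pos_of_neg_of_neg <;> simp only [vertexB, vertexC] <;> linarith
    · apply mul_pos_of_neg_of_neg <;> simp only [vertexB] <;> linarith
    · apply mul_pos <;> simp only [vertexC] <;> linarith
    · refine lt_of_lt_of_le ?_ ((neg_le_abs _).trans (le_max_left _ _))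
      refine max_lt (hlt ?_) (max_lt (hlt ?_) (hlt ?_)) <;> simp only [vertexB, vertexC] <;>
        constructor <;> linarith
  · obtain ⟨l, rfl⟩ : ∃ l, j = l + 3 := ⟨j - 3, by omega⟩
    obtain ⟨h0, h1, h2, h3⟩ := hstrip l (by omega)
    apply mem_interior_nabla_ofCoord
    · apply mul_pos_of_neg_of_neg <;> simp only [vertexB, vertexC] <;> linarith
    · apply mul_pos_of_neg_of_neg <;> simp only [vertexB] <;> linarith
    · apply mul_pos_of_neg_of_neg <;> simp only [vertexC] <;> linarith
    · refine lt_of_lt_of_le ?_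
        ((neg_le_abs _).trans ((le_max_left _ _).trans (le_max_right _ _)))
      refine max_lt (hlt ?_) (max_lt (hlt ?_) (hlt ?_)) <;> simp only [vertexB, vertexC] <;>
        constructor <;> linarith
  · obtain ⟨l, rfl⟩ : ∃ l, j = l + 3 := ⟨j - 3, by omega⟩
    obtain ⟨h0, h1, h2, h3⟩ := hstrip l (by omega)
    have hl : zigzag δ l < 1 := by
      simpa [zigzag] using zigzag_lt_of_even hmδ hδ Even.zero (show 0 < l by omega) (by omega)
    have hz : zigzag δ 0 = 1 := by simp [zigzag]
    apply mem_interior_nabla_ofCoord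
    · apply mul_pos <;> simp only [vertexB, vertexC, hz, Nat.cast_zero] <;> linarith
    · apply mul_pos_of_neg_of_neg <;> simp only [vertexB, hz, Nat.cast_zero] <;> linarith
    · apply mul_pos_of_neg_of_neg <;> simp only [vertexC, hz] <;> linarith
    · refine lt_of_lt_of_le ?_
        ((neg_le_abs _).trans ((le_max_right _ _).trans (le_max_right _ _)))
      refine max_lt (hlt ?_) (max_lt (hlt ?_) (hlt ?_)) <;>
        simp only [vertexB, vertexC, hz, Nat.cast_zero] <;> constructor <;> linarith
  · obtain ⟨l, rfl⟩ : ∃ l, j = l + 3 := ⟨j - 3, by omega⟩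
    have hl : l ≤ m := by omega
    obtain ⟨h1, h2⟩ := abs_lt.1 (abs_zigzag_sub_lt hmδ hδ (show k < k + 1 by omega) (by omega))
    obtain ⟨h3, h4⟩ := abs_lt.1 (abs_zigzag_sub_lt hmδ hδ (show k + 1 < l by omega) hl)
    push_cast at h1 h2 h3 h4
    rcases k.even_or_odd with hk | hk
    · have h5 := zigzag_lt_of_even hmδ hδ hk (show k < k + 1 by omega) (by omega)
      have h6 := zigzag_lt_of_even hmδ hδ hk (show k < l by omega) hl
      apply mem_interior_nabla_ofCoord
      · apply mul_pos <;> simp only [vertexB, vertexC] <;> push_cast <;> linarith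
      · apply mul_pos <;> simp only [vertexB] <;> push_cast <;> linarith
      · apply mul_pos_of_neg_of_neg <;> simp only [vertexC] <;> linarith
      · refine lt_of_lt_of_le ?_ ((le_abs_self _).trans (le_max_left _ _))
        refine max_lt (hlt ?_) (max_lt (hlt ?_) (hlt ?_)) <;> simp only [vertexB, vertexC] <;>
          push_cast <;> constructor <;> linarith
    · have h5 := lt_zigzag_of_odd hmδ hδ hk (show k < k + 1 by omega) (by omega)
      have h6 := lt_zigzag_of_odd hmδ hδ hk (show k < l by omega) hl
      apply mem_interior_nabla_ofCoord
      · apply mul_pos <;> simp only [vertexB, vertexC] <;> push_cast <;> linarith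
      · apply mul_pos <;> simp only [vertexB] <;> push_cast <;> linarith
      · apply mul_pos <;> simp only [vertexC] <;> linarith
      · refine lt_of_lt_of_le ?_
          ((le_abs_self _).trans ((le_max_left _ _).trans (le_max_right _ _)))
        refine max_lt (hlt ?_) (max_lt (hlt ?_) (hlt ?_)) <;> simp only [vertexB, vertexC] <;>
          push_cast <;> constructor <;> linarith

lemma le_eucNorm_zigzag_step (hmδ : m * δ < 1) (hδ : 0 < δ) {k : ℕ} (hk : k < m) :
    2 - 2 * (m * δ) ≤ eucNorm (vertex m δ (k + 1 + 3) - vertex m δ (k + 3)) := by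
  have hle : (k : ℝ) + 1 ≤ m := by exact_mod_cast hk
  have hkδ : ((k : ℝ) + 1) * δ ≤ m * δ := by gcongr
  have hk0 : 0 ≤ (k : ℝ) * δ := by positivity
  have hsq : (zigzag δ (k + 1) - zigzag δ k) ^ 2 = (2 - (2 * k + 1) * δ) ^ 2 := by
    rcases k.even_or_odd with h | h
    · rw [zigzag_of_even h, zigzag_of_odd h.add_one]; push_cast; ring
    · rw [zigzag_of_odd h, zigzag_of_even h.add_one]; push_cast; ring
  rw [vertex, vertex, eucNorm_ofCoord_sub]
  simp only [vertexB, vertexC]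
  apply Real.le_sqrt_of_sq_le
  push_cast
  have h1 : (2 - 2 * (m * δ)) ^ 2 ≤ (2 - (2 * k + 1) * δ) ^ 2 := by
    apply pow_le_pow_left₀ <;> linarith
  have h2 : (2 - (2 * k + 1) * δ) ^ 2 ≤ 2 ^ 2 := by
    apply pow_le_pow_left₀ <;> linarith
  linarith

lemma le_sum_eucNorm_vertex (hmδ : m * δ < 1) (hδ : 0 < δ) :
    3 * m + m * (2 - 2 * (m * δ)) ≤
      ∑ k ∈ Finset.Ico 0 (m + 3), eucNorm (vertex m δ (k + 1) - vertex m δ k) := by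
  have hm : (0 : ℝ) ≤ m := by positivity
  rw [← Finset.range_eq_Ico, Finset.sum_range_succ', Finset.sum_range_succ',
    Finset.sum_range_succ']
  have h : (m : ℝ) * (2 - 2 * (m * δ)) ≤ ∑ k ∈ Finset.range m,
      eucNorm (vertex m δ (k + 1 + 3) - vertex m δ (k + 3)) := by
    simpa using Finset.card_nsmul_le_sum (Finset.range m) _ _
      fun k hk => le_eucNorm_zigzag_step hmδ hδ (Finset.mem_range.1 hk)
  have h0 : (m : ℝ) ≤ eucNorm (vertex m δ 1 - vertex m δ 0) := by
    rw [vertex, vertex, eucNorm_ofCoord_sub]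
    simp only [vertexB, vertexC]
    apply Real.le_sqrt_of_sq_le; nlinarith
  have h1 : (m : ℝ) ≤ eucNorm (vertex m δ 2 - vertex m δ 1) := by
    rw [vertex, vertex, eucNorm_ofCoord_sub]
    simp only [vertexB, vertexC]
    apply Real.le_sqrt_of_sq_le; nlinarith
  have h2 : (m : ℝ) ≤ eucNorm (vertex m δ 3 - vertex m δ 2) := by
    have hz : zigzag δ 0 = 1 := by simp [zigzag]
    rw [vertex, vertex, eucNorm_ofCoord_sub]
    simp only [vertexB, vertexC, hz, Nat.cast_zero]
    apply Real.le_sqrt_of_sq_le; nlinarith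
  simp only [add_assoc, zero_add] at h ⊢
  norm_num at h ⊢
  linarith

lemma eucNorm_vertex_last_sub_le (hmδ : m * δ < 1) (hδ : 0 < δ) :
    eucNorm (vertex m δ (m + 3) - vertex m δ 0) ≤ m + 9 := by
  have hm : (0 : ℝ) ≤ m := by positivity
  obtain ⟨h1, h2⟩ := zigzag_bounds hmδ hδ le_rfl
  rw [vertex, vertex, eucNorm_ofCoord_sub]
  simp only [vertexB, vertexC]
  apply Real.sqrt_le_iff.2 ⟨by linarith, ?_⟩
  nlinarith

end Zigzag

theorem stmt12 : ∀ ε : ℝ, 0 < ε →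
    ∃ (P : Finset (ℝ × ℝ)) (s t : ℝ × ℝ), genPos P ∧ s ∈ P ∧ t ∈ P ∧ s ≠ t ∧
      ∀ ℓ : List (ℝ × ℝ), isPath P ℓ s t → (5 - ε) * eucNorm (t - s) ≤ pathLen ℓ := by
  intro ε hε
  obtain ⟨m, hm⟩ := exists_nat_ge (47 / ε)
  rw [div_le_iff₀ hε] at hm
  have hm0 : (0 : ℝ) ≤ m := by positivity
  set δ : ℝ := 1 / (m + 1) ^ 2 with hδ_def
  have hδ : 0 < δ := by positivity
  have hmδ : m * δ < 1 := by
    rw [hδ_def, mul_one_div, div_lt_one (by positivity)]; nlinarith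
  have hmmδ : m * (m * δ) ≤ 1 := by
    rw [hδ_def, mul_one_div, mul_div_assoc', div_le_one (by positivity)]; nlinarith
  have hsep : ∀ i ≤ m + 3, ∀ j ≤ m + 3, i ≠ j → vertexB m δ i ≠ vertexB m δ j ∧
      vertexC m δ i ≠ vertexC m δ j ∧
      vertexB m δ i - vertexC m δ i ≠ vertexB m δ j - vertexC m δ j := by
    intro i hi j hj hij
    rcases hij.lt_or_gt with h | h
    · exact vertex_separated hmδ hδ h hj
    · obtain ⟨h1, h2, h3⟩ := vertex_separated hmδ hδ h hi
      exact ⟨h1.symm, h2.symm, h3.symm⟩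
  have hinj : ∀ i ≤ m + 3, ∀ j ≤ m + 3, i ≠ j → vertex m δ i ≠ vertex m δ j := by
    intro i hi j hj hij h
    apply (hsep i hi j hj hij).1
    have := coordB_ofCoord_sub (vertexB m δ i) (vertexC m δ i) (vertexB m δ j) (vertexC m δ j)
    rw [← vertex, ← vertex, h, sub_self] at this
    simp only [coordB, Prod.fst_zero, Prod.snd_zero, zero_div, add_zero] at this
    linarith
  have hmem : ∀ i ≤ m + 3, vertex m δ i ∈ (Finset.range (m + 4)).image (vertex m δ) :=
    fun i hi => Finset.mem_image_of_mem _ (Finset.mem_range.2 (by omega))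
  have hP : ∀ q ∈ (Finset.range (m + 4)).image (vertex m δ), ∃ i ≤ m + 3, q = vertex m δ i := by
    intro q hq
    obtain ⟨i, hi, rfl⟩ := Finset.mem_image.1 hq
    exact ⟨i, by have := Finset.mem_range.1 hi; omega, rfl⟩
  refine ⟨(Finset.range (m + 4)).image (vertex m δ), vertex m δ 0, vertex m δ (m + 3), ?_,
    hmem 0 (by omega), hmem _ le_rfl, hinj _ (by omega) _ le_rfl (by omega), fun ℓ hℓ => ?_⟩
  · intro p hp q hq hpq
    obtain ⟨i, hi, rfl⟩ := hP p hp
    obtain ⟨j, hj, rfl⟩ := hP q hq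
    obtain ⟨h1, h2, h3⟩ := hsep i hi j hj fun h => hpq (by rw [h])
    have hp : √3 ≠ 0 := by positivity
    simp only [vertex, ofCoord]
    refine ⟨fun h => h3 ?_, fun h => h2 ?_, fun h => h1 ?_⟩ <;> apply mul_left_cancel₀ hp <;>
      linarith
  · have hlen := sum_le_pathLen hP (fun i hi => hinj i hi.le _ le_rfl hi.ne)
      (fun i hi j hj h => by
        by_contra! hij
        exact h.2.2.2 _ (hmem (i + 1) (by omega)) (succ_mem_interior_nabla hmδ hδ hij hj))
      ℓ 0 (by omega) hℓ
    have h1 := le_sum_eucNorm_vertex hmδ hδ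
    have h2 := eucNorm_vertex_last_sub_le hmδ hδ
    have h3 := eucNorm_nonneg (vertex m δ (m + 3) - vertex m δ 0)
    rcases le_total 5 ε with h | h
    · have := mul_nonpos_of_nonpos_of_nonneg (sub_nonpos.2 h) h3
      nlinarith
    · have := mul_le_mul_of_nonneg_left h2 (sub_nonneg.2 h)
      nlinarith
end

section
/- For any finite point set P ⊂ ℝ² in general position and any s, t ∈ P, the shortest directed path from s to t in the directed Theta-6 graph of P has Euclidean length at most 5·‖st‖_thex, and hence at most 5·‖st‖₂. -/
open Real

/-- Hexagonal norm in the oblique coordinates whose axes make an angle of 60°. -/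
noncomputable def hx (x y : ℝ) : ℝ := max |x| (max |y| |x + y|)

/-- Tipped hexagonal norm in oblique coordinates. -/
noncomputable def tx (x y : ℝ) : ℝ := max |x + y / 2| (max |x / 2 + y| |(x - y) / 2|)

theorem hx_lt {x y B : ℝ} (h1 : x < B) (h2 : -x < B) (h3 : y < B) (h4 : -y < B)
    (h5 : x + y < B) (h6 : -(x + y) < B) : hx x y < B :=
  max_lt (abs_lt.2 ⟨by linarith, h1⟩)
    (max_lt (abs_lt.2 ⟨by linarith, h3⟩) (abs_lt.2 ⟨by linarith, h5⟩))

theorem x_le_hx (x y : ℝ) : x ≤ hx x y := (le_abs_self x).trans (le_max_left _ _)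

theorem neg_x_le_hx (x y : ℝ) : -x ≤ hx x y := (neg_le_abs x).trans (le_max_left _ _)

theorem y_le_hx (x y : ℝ) : y ≤ hx x y :=
  (le_abs_self y).trans ((le_max_left _ _).trans (le_max_right _ _))

theorem neg_y_le_hx (x y : ℝ) : -y ≤ hx x y :=
  (neg_le_abs y).trans ((le_max_left _ _).trans (le_max_right _ _))

theorem sum_le_hx (x y : ℝ) : x + y ≤ hx x y :=
  (le_abs_self _).trans ((le_max_right _ _).trans (le_max_right _ _))

theorem neg_sum_le_hx (x y : ℝ) : -(x + y) ≤ hx x y :=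
  (neg_le_abs _).trans ((le_max_right _ _).trans (le_max_right _ _))

theorem tx_le {x y B : ℝ} (h1 : x + y / 2 ≤ B) (h2 : -(x + y / 2) ≤ B) (h3 : x / 2 + y ≤ B)
    (h4 : -(x / 2 + y) ≤ B) (h5 : (x - y) / 2 ≤ B) (h6 : -((x - y) / 2) ≤ B) : tx x y ≤ B :=
  max_le (abs_le.2 ⟨by linarith, h1⟩)
    (max_le (abs_le.2 ⟨by linarith, h3⟩) (abs_le.2 ⟨by linarith, h5⟩))

/-- `(z, w)` is the nearest point of `Q` in the cone `[0°, 60°]` of `(x, y)`. -/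
def Hop0 (Q : ℝ → ℝ → Prop) (x y z w : ℝ) : Prop :=
  Q z w ∧ x < z ∧ y < w ∧
    ∀ u v, Q u v → x ≤ u → y ≤ v → u + v ≤ x + y ∨ z + w ≤ u + v

/-- Nearest point in the cone `[60°, 120°]`. -/
def Hop1 (Q : ℝ → ℝ → Prop) (x y z w : ℝ) : Prop :=
  Q z w ∧ z < x ∧ x + y < z + w ∧
    ∀ u v, Q u v → u ≤ x → x + y ≤ u + v → v ≤ y ∨ w ≤ v

/-- Nearest point in the cone `[120°, 180°]`. -/
def Hop2 (Q : ℝ → ℝ → Prop) (x y z w : ℝ) : Prop :=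
  Q z w ∧ y < w ∧ z + w < x + y ∧
    ∀ u v, Q u v → y ≤ v → u + v ≤ x + y → x ≤ u ∨ u ≤ z

/-- Nearest point in the cone `[180°, 240°]`. -/
def Hop3 (Q : ℝ → ℝ → Prop) (x y z w : ℝ) : Prop :=
  Q z w ∧ z < x ∧ w < y ∧
    ∀ u v, Q u v → u ≤ x → v ≤ y → x + y ≤ u + v ∨ u + v ≤ z + w

/-- Nearest point in the cone `[240°, 300°]`. -/
def Hop4 (Q : ℝ → ℝ → Prop) (x y z w : ℝ) : Prop :=
  Q z w ∧ x < z ∧ z + w < x + y ∧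
    ∀ u v, Q u v → x ≤ u → u + v ≤ x + y → y ≤ v ∨ v ≤ w

/-- Nearest point in the cone `[300°, 360°]`. -/
def Hop5 (Q : ℝ → ℝ → Prop) (x y z w : ℝ) : Prop :=
  Q z w ∧ w < y ∧ x + y < z + w ∧
    ∀ u v, Q u v → v ≤ y → x + y ≤ u + v → u ≤ x ∨ z ≤ u

/-- A finite point set `Q` in oblique coordinates centred at the target, together with a
predicate `D x y c` behaving like: the target can be reached from `(x, y)` at cost `c`. -/
structure Sys (Q : ℝ → ℝ → Prop) (D : ℝ → ℝ → ℝ → Prop) : Prop where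
  fin : {p : ℝ × ℝ | Q p.1 p.2}.Finite
  mono : ∀ {x y c c'}, D x y c → c ≤ c' → D x y c'
  zero : D 0 0 0
  origin : Q 0 0
  gp : ∀ {x y u v}, Q x y → Q u v → x = u ∨ y = v ∨ x + y = u + v → x = u ∧ y = v
  step0 : ∀ {x y u v}, Q x y → Q u v → x ≤ u → y ≤ v → ¬(u = x ∧ v = y) →
    ∃ x' y', Hop0 Q x y x' y' ∧ x' + y' ≤ u + v ∧
      ∀ c, D x' y' c → D x y (c + (x' + y' - (x + y)))
  step1 : ∀ {x y u v}, Q x y → Q u v → u ≤ x → x + y ≤ u + v → ¬(u = x ∧ v = y) →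
    ∃ x' y', Hop1 Q x y x' y' ∧ y' ≤ v ∧ ∀ c, D x' y' c → D x y (c + (y' - y))
  step2 : ∀ {x y u v}, Q x y → Q u v → y ≤ v → u + v ≤ x + y → ¬(u = x ∧ v = y) →
    ∃ x' y', Hop2 Q x y x' y' ∧ u ≤ x' ∧ ∀ c, D x' y' c → D x y (c + (x - x'))
  step3 : ∀ {x y u v}, Q x y → Q u v → u ≤ x → v ≤ y → ¬(u = x ∧ v = y) →
    ∃ x' y', Hop3 Q x y x' y' ∧ u + v ≤ x' + y' ∧
      ∀ c, D x' y' c → D x y (c + (x + y - (x' + y')))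
  step4 : ∀ {x y u v}, Q x y → Q u v → x ≤ u → u + v ≤ x + y → ¬(u = x ∧ v = y) →
    ∃ x' y', Hop4 Q x y x' y' ∧ v ≤ y' ∧ ∀ c, D x' y' c → D x y (c + (y - y'))
  step5 : ∀ {x y u v}, Q x y → Q u v → v ≤ y → x + y ≤ u + v → ¬(u = x ∧ v = y) →
    ∃ x' y', Hop5 Q x y x' y' ∧ x' ≤ u ∧ ∀ c, D x' y' c → D x y (c + (x' - x))

theorem Sys.induct {Q : ℝ → ℝ → Prop} {D : ℝ → ℝ → ℝ → Prop} (S : Sys Q D) (f : ℝ → ℝ → ℝ)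
    {R : ℝ → ℝ → Prop}
    (h : ∀ x y, Q x y → (∀ u v, Q u v → f u v < f x y → R u v) → R x y) :
    ∀ x y, Q x y → R x y := by
  have key : ∀ n : ℕ, ∀ x y, Q x y →
      (S.fin.toFinset.filter fun p => f p.1 p.2 < f x y).card = n → R x y := by
    intro n
    induction n using Nat.strong_induction_on with
    | _ n ih =>
      intro x y hxy hn
      refine h x y hxy fun u v huv hlt => ih _ ?_ u v huv rfl
      rw [← hn]
      refine Finset.card_lt_card (Finset.ssubset_iff_of_subset ?_ |>.2 ⟨(u, v), ?_, ?_⟩)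
      · intro p hp
        simp only [Finset.mem_filter] at hp ⊢
        exact ⟨hp.1, hp.2.trans hlt⟩
      · simp [huv, hlt]
      · simp
  intro x y hxy
  exact key _ x y hxy rfl

section

variable {Q : ℝ → ℝ → Prop} {D : ℝ → ℝ → ℝ → Prop}

/-- Steps that cross the ray at `300°` upwards from an abscissa at most `X` end at coordinate sum
at most `n`. -/
def RiseLE (Q : ℝ → ℝ → Prop) (n X : ℝ) : Prop :=
  ∀ x y z w, Q x y → Hop1 Q x y z w → 0 ≤ x → x ≤ X → x + y ≤ 0 → w ≤ 0 → 0 ≤ z + w →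
    z + w ≤ n

/-- Points of the upper half plane with coordinate sum at most `Z` have abscissa at most `ν`. -/
def AbscissaLE (Q : ℝ → ℝ → Prop) (ν Z : ℝ) : Prop :=
  ∀ u v, Q u v → 0 ≤ v → u + v ≤ Z → u ≤ ν

/-- Points right of the `y`-axis with coordinate sum at most `n` have ordinate at most `H`. -/
def HeightLE (Q : ℝ → ℝ → Prop) (H n : ℝ) : Prop :=
  ∀ u v, Q u v → 0 ≤ u → u + v ≤ n → v ≤ H

/-- Steps that cross the positive `x`-axis downwards from an abscissa at most `X` end at ordinate
at least `-d`. -/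
def DropLE (Q : ℝ → ℝ → Prop) (d X : ℝ) : Prop :=
  ∀ x y z w, Q x y → Hop3 Q x y z w → 0 ≤ x → 0 ≤ y → x ≤ X → w ≤ 0 → 0 ≤ z + w → -d ≤ w

/-- Points of the sextant `[60°, 120°]` with coordinate sum at most `Z` and ordinate at most `H`
have abscissa at least `-M`. -/
def LeftLE (Q : ℝ → ℝ → Prop) (M Z H : ℝ) : Prop :=
  ∀ u v, Q u v → u ≤ 0 → 0 ≤ u + v → u + v ≤ Z → v ≤ H → -M ≤ u

/-- Points of the sextant `[240°, 300°]` with ordinate at least `y` have abscissa at most `X`. -/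
def RightLE (Q : ℝ → ℝ → Prop) (X y : ℝ) : Prop :=
  ∀ u v, Q u v → 0 ≤ u → u + v ≤ 0 → y ≤ v → u ≤ X

/-- Points of the sextant `[60°, 120°]` with ordinate at most `y` have coordinate sum at most
`Z`. -/
def SumLE (Q : ℝ → ℝ → Prop) (Z y : ℝ) : Prop :=
  ∀ u v, Q u v → u ≤ 0 → 0 ≤ u + v → v ≤ y → u + v ≤ Z

/-- Bound, with extra charge `T`, for the landings of steps that cross the ray at `300°`
leftwards. -/
def LandingLE (Q : ℝ → ℝ → Prop) (D : ℝ → ℝ → ℝ → Prop) (L' d N T X : ℝ) : Prop :=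
  ∀ x y x' y', Q x y → Hop2 Q x y x' y' → y ≤ 0 → 0 ≤ x + y → x ≤ X → -d ≤ y → 0 ≤ x' →
    x' + y' ≤ 0 → ∀ n H M, 0 ≤ n → n ≤ N → 0 ≤ H → 0 ≤ M → M ≤ L' → RiseLE Q n x' → HeightLE Q H n →
    LeftLE Q M n H → D x' y' (x' + n + H + M + T)

theorem RiseLE.mono {n X X'} (h : RiseLE Q n X) (hX : X' ≤ X) : RiseLE Q n X' :=
  fun _ _ _ _ a b c d => h _ _ _ _ a b c (d.trans hX)

theorem AbscissaLE.mono {n X X'} (h : AbscissaLE Q n X) (hX : X' ≤ X) : AbscissaLE Q n X' :=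
  fun _ _ a b d => h _ _ a b (d.trans hX)

theorem HeightLE.mono {n X X'} (h : HeightLE Q n X) (hX : X' ≤ X) : HeightLE Q n X' :=
  fun _ _ a b d => h _ _ a b (d.trans hX)

theorem DropLE.mono {n X X'} (h : DropLE Q n X) (hX : X' ≤ X) : DropLE Q n X' :=
  fun _ _ _ _ a b c c' d => h _ _ _ _ a b c c' (d.trans hX)

theorem LandingLE.mono {L' d N T X X'} (h : LandingLE Q D L' d N T X) (hX : X' ≤ X)  :
    LandingLE Q D L' d N T X' :=
  fun _ _ _ _ a b c c' d => h _ _ _ _ a b c c' (d.trans hX)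

theorem LeftLE.mono {M Z H Z' H'} (h : LeftLE Q M Z H) (hZ : Z' ≤ Z) (hH : H' ≤ H)  :
    LeftLE Q M Z' H' :=
  fun _ _ a b c d e => h _ _ a b c (d.trans hZ) (e.trans hH)

theorem RightLE.mono {X y y'} (h : RightLE Q X y) (hy : y ≤ y') : RightLE Q X y' :=
  fun _ _ a b c d => h _ _ a b c (hy.trans d)

theorem SumLE.mono {Z y y'} (h : SumLE Q Z y) (hy : y' ≤ y) : SumLE Q Z y' :=
  fun _ _ a b c d => h _ _ a b c (d.trans hy)

/-- Admissible extra charge `φ` for steps that cross the negative `x`-axis downwards. -/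
def ChargeFE (Q : ℝ → ℝ → Prop) (D : ℝ → ℝ → ℝ → Prop) (φ L' : ℝ) : Prop :=
  ∀ x y x' y', Q x y → x ≤ 0 → 0 ≤ y → x + y ≤ 0 → -L' ≤ x → Hop5 Q x y x' y' → y' ≤ 0 →
    x' ≤ 0 → (∀ c, D x' y' c → D x y (c + (x' - x))) → D x y (-(x + y) + 2 * y + φ)

/-- Admissible extra charge `φ` for steps that cross the negative `x`-axis upwards. -/
def ChargeEF (Q : ℝ → ℝ → Prop) (D : ℝ → ℝ → ℝ → Prop) (φ L : ℝ) : Prop :=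
  ∀ x y x' y', Q x y → x ≤ 0 → y ≤ 0 → -L ≤ x + y → Hop0 Q x y x' y' → 0 ≤ y' →
    x' + y' ≤ 0 → (∀ c, D x' y' c → D x y (c + (x' + y' - (x + y)))) → D x y (-x - 2 * y + φ)

/-- Path-length bounds in the four sextants around the target other than those below it
(`C`, `B`, `A`, `F` in counterclockwise order, starting at `300°`), given that every landing below
is charged `T`. -/
structure Turn (Q : ℝ → ℝ → Prop) (D : ℝ → ℝ → ℝ → Prop) (L' d N T x y : ℝ) : Prop where
  zC : ∀ n H M, 0 ≤ H → 0 ≤ M → 0 ≤ x → y ≤ 0 → 0 ≤ x + y → x + y ≤ n → n ≤ N →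
    RiseLE Q n x → HeightLE Q H n → DropLE Q d (min x n) → -d ≤ y → LandingLE Q D L' d N T x →
    LeftLE Q M n H → M ≤ L' →
    D x y (x + n + H + M + T)
  zB : ∀ ν H M, 0 ≤ M → 0 ≤ x → 0 ≤ y → x ≤ ν → y ≤ H → x + y ≤ N →
    AbscissaLE Q ν (x + y) → HeightLE Q H (x + y) → DropLE Q d ν → LandingLE Q D L' d N T ν →
    LeftLE Q M (x + y) H →
    M ≤ L' → D x y (x + y + ν + H + M + T)
  zA : ∀ Z ν M, 0 ≤ ν → x ≤ 0 → 0 ≤ x + y → x + y ≤ Z → Z ≤ N → -M ≤ x →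
    AbscissaLE Q ν Z → SumLE Q Z y → LeftLE Q M Z y → DropLE Q d ν → LandingLE Q D L' d N T ν →
    M ≤ L' →
    D x y (y + Z + ν + M + T)
  zF : ∀ Z ν, 0 ≤ Z → Z ≤ N → 0 ≤ ν → x ≤ 0 → 0 ≤ y → x + y ≤ 0 → -L' ≤ x →
    SumLE Q Z y → AbscissaLE Q ν Z → DropLE Q d ν → LandingLE Q D L' d N T ν →
    D x y (-(x + y) + 2 * y + Z + ν + T)

/-- Path-length bounds in the sextants `D` (`[240°, 300°]`) and `E` (`[180°, 240°]`) below the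
target. -/
structure Base (Q : ℝ → ℝ → Prop) (D : ℝ → ℝ → ℝ → Prop) (φ L L' x y : ℝ) : Prop where
  zD : ∀ X n H Δ M yE, 0 ≤ n → 0 ≤ H → 0 ≤ Δ → 0 ≤ M → 0 ≤ x → x ≤ X → x + y ≤ 0 →
    RiseLE Q n X → HeightLE Q H n → LeftLE Q M n H →
    (∀ u v, Q u v → u ≤ 0 → v ≤ 0 → x + y ≤ u + v → y ≤ v → -Δ ≤ u + v ∧ -yE ≤ v) →
    RightLE Q X (-yE) →
    (∀ u v, Q u v → 0 ≤ u → u + v ≤ 0 → y ≤ v → -X ≤ v → ∀ e f, Q e f → e ≤ 0 → f ≤ 0 →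
      u + v ≤ e + f → v ≤ f → -Δ ≤ e + f) →
    Δ ≤ L → M ≤ L' → D x y (-y + X + n + H + Δ + M + φ)
  zE : ∀ X n H M, 0 ≤ X → 0 ≤ n → 0 ≤ H → 0 ≤ M → x ≤ 0 → y ≤ 0 → -L ≤ x + y → RightLE Q X y →
    RiseLE Q n X → HeightLE Q H n → LeftLE Q M n H → M ≤ L' → D x y (-x - 2 * y + X + n + H + M + φ)

/-- `R` holds at all points that are closer to the target than `(x, y)`. -/
def Below (Q : ℝ → ℝ → Prop) (x y : ℝ) (R : ℝ → ℝ → Prop) : Prop :=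
  ∀ u v, Q u v → hx u v < hx x y → R u v

theorem Turn.of_C (S : Sys Q D) {L' d N T : ℝ} (hT0 : 0 ≤ T) {x y : ℝ} (hq : Q x y)
    (ih : Below Q x y (Turn Q D L' d N T)) :
    ∀ n H M, 0 ≤ H → 0 ≤ M → 0 ≤ x → y ≤ 0 → 0 ≤ x + y → x + y ≤ n → n ≤ N →
    RiseLE Q n x → HeightLE Q H n → DropLE Q d (min x n) → -d ≤ y → LandingLE Q D L' d N T x →
    LeftLE Q M n H → M ≤ L' →
    D x y (x + n + H + M + T) := by
  intro n H M hH hM hx0 hy0 hs hn hN i1 iH iId hd iD iA hL'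
  by_cases h0 : (0 : ℝ) = x ∧ (0 : ℝ) = y
  · obtain ⟨rfl, rfl⟩ := h0
    exact S.mono S.zero (by linarith)
  obtain ⟨x', y', hop, hw, st⟩ := S.step2 hq S.origin (by linarith) (by linarith) h0
  have ⟨hq', hy', hs', hT⟩ := hop
  have hlt : hx x' y' < hx x y := by
    have := x_le_hx x y
    apply hx_lt <;> linarith
  have m := ih x' y' hq' hlt
  rcases le_total (x' + y') 0 with h1 | h1
  · exact S.mono (st _ (iD x y x' y' hq hop hy0 hs le_rfl hd hw h1 n H M (by linarith) hN hH hM hL'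
      (i1.mono (by linarith)) iH iA)) (by linarith)
  · have hmin : ∀ r, r ≤ x' → r ≤ n → r ≤ min x n := fun r h h' => le_min (by linarith) h'
    rcases le_total y' 0 with h2 | h2
    · exact S.mono (st _ (m.zC n H M hH hM hw h2 h1 (by linarith) hN (i1.mono (by linarith))
        iH (iId.mono (hmin _ (min_le_left _ _) (min_le_right _ _))) (by linarith)
        (iD.mono (by linarith)) iA hL')) (by linarith)
    · refine S.mono (st _ (m.zB x' H M hM hw h2 le_rfl (iH x' y' hq' hw (by linarith))
        (by linarith) ?_ (iH.mono (by linarith)) (iId.mono (hmin _ le_rfl (by linarith)))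
        (iD.mono (by linarith)) (iA.mono (by linarith) le_rfl) hL')) (by linarith)
      intro u v huv a b
      rcases hT u v huv (by linarith) (by linarith) with h | h <;> linarith

theorem Turn.of_B (S : Sys Q D) {L' d N T : ℝ} (hT0 : 0 ≤ T) {x y : ℝ} (hq : Q x y)
    (ih : Below Q x y (Turn Q D L' d N T)) :
    ∀ ν H M, 0 ≤ M → 0 ≤ x → 0 ≤ y → x ≤ ν → y ≤ H → x + y ≤ N →
    AbscissaLE Q ν (x + y) → HeightLE Q H (x + y) → DropLE Q d ν → LandingLE Q D L' d N T ν →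
    LeftLE Q M (x + y) H →
    M ≤ L' → D x y (x + y + ν + H + M + T) := by
  intro ν H M hM hx0 hy0 hν hyH hN i2 iH iId iD iA hL'
  by_cases h0 : (0 : ℝ) = x ∧ (0 : ℝ) = y
  · obtain ⟨rfl, rfl⟩ := h0
    exact S.mono S.zero (by linarith)
  obtain ⟨x', y', hop, hw, st⟩ := S.step3 hq S.origin (by linarith) (by linarith) h0
  have ⟨hq', hx', hy', hT⟩ := hop
  have hlt : hx x' y' < hx x y := by
    have := sum_le_hx x y
    apply hx_lt <;> linarith
  have m := ih x' y' hq' hlt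
  rcases le_total y' 0 with h1 | h1
  · refine S.mono (st _ (m.zC (x' + y') H M (by linarith) hM (by linarith) h1 (by linarith)
      le_rfl (by linarith) ?_ (iH.mono (by linarith))
      (iId.mono ((min_le_left _ _).trans (by linarith)))
      (iId x y x' y' hq hop hx0 hy0 hν h1 (by linarith)) (iD.mono (by linarith))
      (iA.mono (by linarith) le_rfl) hL')) (by linarith)
    intro u v u' v' huv hop' a b c e f
    have ⟨g1, g2, g3, g4⟩ := hop'
    rcases hT u' v' g1 (by linarith) (by linarith) with h | h <;> linarith
  · rcases le_total x' 0 with h2 | h2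
    · have := iA x' y' hq' h2 (by linarith) (by linarith) (by linarith)
      refine S.mono (st _ (m.zA (x' + y') ν M (by linarith) h2 (by linarith) le_rfl
        (by linarith) this
        (i2.mono (by linarith)) ?_ (iA.mono (by linarith) (by linarith)) iId iD hL')) (by linarith)
      intro u v huv a b c
      rcases hT u v huv (by linarith) (by linarith) with h | h <;> linarith
    · exact S.mono (st _ (m.zB ν H M hM h2 h1 (by linarith) (by linarith) (by linarith)
        (i2.mono (by linarith)) (iH.mono (by linarith)) iId iD (iA.mono (by linarith) le_rfl) hL'))
        (by linarith)

theorem Turn.of_A (S : Sys Q D) {L' d N T : ℝ} (hT0 : 0 ≤ T) {x y : ℝ} (hq : Q x y)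
    (ih : Below Q x y (Turn Q D L' d N T)) :
    ∀ Z ν M, 0 ≤ ν → x ≤ 0 → 0 ≤ x + y → x + y ≤ Z → Z ≤ N → -M ≤ x →
    AbscissaLE Q ν Z → SumLE Q Z y → LeftLE Q M Z y → DropLE Q d ν → LandingLE Q D L' d N T ν →
    M ≤ L' →
    D x y (y + Z + ν + M + T) := by
  intro Z ν M hν hx0 hs hZ hN hM i2 iZ iA iId iD hL'
  by_cases h0 : (0 : ℝ) = x ∧ (0 : ℝ) = y
  · obtain ⟨rfl, rfl⟩ := h0
    exact S.mono S.zero (by linarith)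
  obtain ⟨x', y', hop, hw, st⟩ := S.step4 hq S.origin (by linarith) (by linarith) h0
  have ⟨hq', hx', hs', hT⟩ := hop
  have hlt : hx x' y' < hx x y := by
    have := y_le_hx x y
    apply hx_lt <;> linarith
  have m := ih x' y' hq' hlt
  rcases le_total (x' + y') 0 with h1 | h1
  · exact S.mono (st _ (m.zF Z ν (by linarith) hN hν (by linarith) hw h1 (by linarith)
      (iZ.mono (by linarith)) i2 iId iD)) (by linarith)
  · rcases le_total x' 0 with h2 | h2
    · exact S.mono (st _ (m.zA Z ν M hν h2 h1 (by linarith) hN (by linarith) i2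
        (iZ.mono (by linarith)) (iA.mono le_rfl (by linarith)) iId iD hL')) (by linarith)
    · refine S.mono (st _ (m.zB ν y' M (by linarith) h2 hw
        (i2 x' y' hq' hw (by linarith)) le_rfl (by linarith)
        (i2.mono (by linarith)) ?_ iId iD (iA.mono (by linarith) (by linarith)) hL')) (by linarith)
      intro u v huv a b
      rcases hT u v huv (by linarith) (by linarith) with h | h <;> linarith

theorem Turn.of_F (S : Sys Q D) {L' d N T φ : ℝ} (hT0 : 0 ≤ T) (hφT : φ ≤ T)
    (hFE : ChargeFE Q D φ L') {x y : ℝ} (hq : Q x y) (ih : Below Q x y (Turn Q D L' d N T)) :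
    ∀ Z ν, 0 ≤ Z → Z ≤ N → 0 ≤ ν → x ≤ 0 → 0 ≤ y → x + y ≤ 0 → -L' ≤ x →
    SumLE Q Z y → AbscissaLE Q ν Z → DropLE Q d ν → LandingLE Q D L' d N T ν →
    D x y (-(x + y) + 2 * y + Z + ν + T) := by
  intro Z ν hZ hN hν hx0 hy0 hs hxL iZ i2 iId iD
  by_cases h0 : (0 : ℝ) = x ∧ (0 : ℝ) = y
  · obtain ⟨rfl, rfl⟩ := h0
    exact S.mono S.zero (by linarith)
  obtain ⟨x', y', hop, hw, st⟩ := S.step5 hq S.origin (by linarith) (by linarith) h0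
  have ⟨hq', hy', hs', hT⟩ := hop
  have hlt : hx x' y' < hx x y := by
    have := neg_x_le_hx x y
    apply hx_lt <;> linarith
  have m := ih x' y' hq' hlt
  rcases le_total y' 0 with h1 | h1
  · exact S.mono (hFE x y x' y' hq hx0 hy0 hs hxL hop h1 hw st) (by linarith)
  · rcases le_total (x' + y') 0 with h2 | h2
    · exact S.mono (st _ (m.zF Z ν hZ hN hν hw h1 h2 (by linarith)
        (iZ.mono (by linarith)) i2 iId iD)) (by linarith)
    · refine S.mono (st _ (m.zA Z ν (-x') hν hw h2
        (iZ x' y' hq' hw h2 (by linarith)) hN (by linarith) i2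
        (iZ.mono (by linarith)) ?_ iId iD (by linarith))) (by linarith)
      intro u v huv a b c e
      rcases hT u v huv (by linarith) (by linarith) with h | h <;> linarith

theorem Sys.turn (S : Sys Q D) {φ L' : ℝ} (hFE : ChargeFE Q D φ L') {d N T : ℝ} (hT0 : 0 ≤ T)
    (hφT : φ ≤ T) : ∀ x y, Q x y → Turn Q D L' d N T x y :=
  S.induct hx fun _ _ hq ih =>
    ⟨Turn.of_C S hT0 hq ih, Turn.of_B S hT0 hq ih, Turn.of_A S hT0 hq ih,
      Turn.of_F S hT0 hφT hFE hq ih⟩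

theorem Hop1.dropLE {x y x' y' n : ℝ} (hop : Hop1 Q x y x' y') (_hx' : 0 ≤ x') (hs : x + y ≤ 0) :
    DropLE Q (-y') (min x' n) := by
  intro u v u' v' huv hop' a b c e f
  have ⟨_, hx'', _, hT⟩ := hop
  have ⟨g1, g2, g3, g4⟩ := hop'
  have := c.trans (min_le_left _ _)
  rcases hT u' v' g1 (by linarith) (by linarith) with h | h <;> linarith

theorem Hop2.rightLE {u v u' v' : ℝ} (hop : Hop2 Q u v u' v') (hs : 0 ≤ u + v) :
    RightLE Q u' v' := by
  intro e f hef a b c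
  have ⟨_, g2, g3, g4⟩ := hop
  rcases g4 e f hef (by linarith) (by linarith) with h | h <;> linarith

theorem Base.of_D (S : Sys Q D) {φ L L' : ℝ} (hφ : 0 ≤ φ) (hFE : ChargeFE Q D φ L')
    {x y : ℝ} (hq : Q x y) (ih : Below Q x y (Base Q D φ L L')) :
    ∀ X n H Δ M yE, 0 ≤ n → 0 ≤ H → 0 ≤ Δ → 0 ≤ M → 0 ≤ x → x ≤ X → x + y ≤ 0 →
    RiseLE Q n X → HeightLE Q H n → LeftLE Q M n H →
    (∀ u v, Q u v → u ≤ 0 → v ≤ 0 → x + y ≤ u + v → y ≤ v → -Δ ≤ u + v ∧ -yE ≤ v) →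
    RightLE Q X (-yE) →
    (∀ u v, Q u v → 0 ≤ u → u + v ≤ 0 → y ≤ v → -X ≤ v → ∀ e f, Q e f → e ≤ 0 → f ≤ 0 →
      u + v ≤ e + f → v ≤ f → -Δ ≤ e + f) →
    Δ ≤ L → M ≤ L' → D x y (-y + X + n + H + Δ + M + φ) := by
  intro X n H Δ M yE hn hH hΔ hM hx0 hxX hs i1 iH iA hDE iX iΔ hL hL'
  by_cases h0 : (0 : ℝ) = x ∧ (0 : ℝ) = y
  · obtain ⟨rfl, rfl⟩ := h0
    exact S.mono S.zero (by linarith)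
  obtain ⟨x', y', hop, hw, st⟩ := S.step1 hq S.origin (by linarith) (by linarith) h0
  have ⟨hq', hx', hs', hT⟩ := hop
  have hlt : hx x' y' < hx x y := by
    have := neg_y_le_hx x y
    apply hx_lt <;> linarith
  have m := ih x' y' hq' hlt
  rcases le_total x' 0 with h1 | h1
  · obtain ⟨e1, e2⟩ := hDE x' y' hq' h1 hw (by linarith) (by linarith)
    exact S.mono (st _ (m.zE X n H M (by linarith) hn hH hM h1 hw (by linarith)
      (iX.mono e2) i1 iH iA hL')) (by linarith)
  · rcases le_total (x' + y') 0 with h2 | h2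
    · refine S.mono (st _ (m.zD X n H Δ M yE hn hH hΔ hM h1 (by linarith) h2 i1 iH iA ?_ iX
        ?_ hL hL'))
        (by linarith)
      · intro u v huv a b c e
        exact hDE u v huv a b (by linarith) (by linarith)
      · intro u v huv a b c
        exact iΔ u v huv a b (by linarith)
    · have t := S.turn hFE (d := -y') (N := n) (T := Δ + φ - y') (by linarith) (by linarith) x' y'
        hq'
      refine S.mono (st _ (t.zC n H M hH hM h1 hw h2
        (i1 x y x' y' hq hop hx0 hxX hs hw h2) le_rfl (i1.mono (by linarith)) iH (hop.dropLE h1 hs)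
        (by linarith) ?_ iA hL')) (by linarith)
      intro u v u' v' huv hop' a b c e f g n₂ H₂ M₂ j1 j2 j3 j4 j5 j6 j7 j8
      have ⟨g1, g2, g3, g4⟩ := hop'
      have hlt' : hx u' v' < hx x y := by
        have := neg_y_le_hx x y
        apply hx_lt <;> linarith
      refine S.mono ((ih u' v' g1 hlt').zD u' n₂ H₂ Δ M₂ (-v') j1 j3 hΔ j4 f le_rfl g j6 j7 j8
        ?_ ?_ ?_ hL j5) (by linarith)
      · intro e1 f1 hef k1 k2 k3 k4
        exact ⟨iΔ u' v' g1 f g (by linarith) (by linarith) e1 f1 hef k1 k2 k3 k4, by linarith⟩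
      · rw [neg_neg]
        exact hop'.rightLE b
      · intro e1 f1 hef k1 k2 k3 k4
        exact iΔ e1 f1 hef k1 k2 (by linarith) (by linarith)

theorem Base.of_E (S : Sys Q D) {φ L L' : ℝ} (hφ : 0 ≤ φ) (hEF : ChargeEF Q D φ L)
    {x y : ℝ} (hq : Q x y) (ih : Below Q x y (Base Q D φ L L')) :
    ∀ X n H M, 0 ≤ X → 0 ≤ n → 0 ≤ H → 0 ≤ M → x ≤ 0 → y ≤ 0 → -L ≤ x + y → RightLE Q X y →
    RiseLE Q n X → HeightLE Q H n → LeftLE Q M n H → M ≤ L' →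
    D x y (-x - 2 * y + X + n + H + M + φ) := by
  intro X n H M hX hn hH hM hx0 hy0 hxL iX i1 iH iA hL'
  by_cases h0 : (0 : ℝ) = x ∧ (0 : ℝ) = y
  · obtain ⟨rfl, rfl⟩ := h0
    exact S.mono S.zero (by linarith)
  obtain ⟨x', y', hop, hw, st⟩ := S.step0 hq S.origin (by linarith) (by linarith) h0
  have ⟨hq', hx', hy', hT⟩ := hop
  have hlt : hx x' y' < hx x y := by
    have := neg_sum_le_hx x y
    apply hx_lt <;> linarith
  have m := ih x' y' hq' hlt
  rcases le_total y' 0 with h1 | h1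
  · rcases le_total x' 0 with h2 | h2
    · exact S.mono (st _ (m.zE X n H M hX hn hH hM h2 h1 (by linarith)
        (iX.mono (by linarith)) i1 iH iA hL'))
        (by linarith)
    · refine S.mono (st _ (m.zD X n H (-(x' + y')) M (-y') hn hH (by linarith) hM h2
        (iX x' y' hq' h2 (by linarith) (by linarith)) (by linarith) i1 iH iA ?_
        (iX.mono (by linarith)) ?_
        (by linarith) hL')) (by linarith)
      · intro u v huv a b c e
        constructor <;> linarith
      · intro u v huv a b c e k l hkl k1 k2 k3 k4
        rcases hT u v huv (by linarith) (by linarith) with h | h <;> linarith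
  · exact S.mono (hEF x y x' y' hq hx0 hy0 hxL hop h1 (by linarith) st) (by linarith)

theorem Sys.base (S : Sys Q D) {φ L L' : ℝ} (hφ : 0 ≤ φ) (hEF : ChargeEF Q D φ L)
    (hFE : ChargeFE Q D φ L') :
    ∀ x y, Q x y → Base Q D φ L L' x y :=
  S.induct hx fun _ _ hq ih => ⟨Base.of_D S hφ hFE hq ih, Base.of_E S hφ hEF hq ih⟩

/-- Points of the sextant `[60°, 120°]` with ordinate at most `y` have abscissa at least `-α`. -/
def WestLE (Q : ℝ → ℝ → Prop) (α y : ℝ) : Prop :=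
  ∀ u v, Q u v → u ≤ 0 → 0 ≤ u + v → v ≤ y → -α ≤ u

theorem WestLE.mono {α y y'} (h : WestLE Q α y) (hy : y' ≤ y) : WestLE Q α y' :=
  fun _ _ a b c d => h _ _ a b c (d.trans hy)

/-- A step into the cone `[180°, 240°]` that crosses the positive `x`-axis. -/
structure UpperHop (Q : ℝ → ℝ → Prop) (a0 xB yB x y Ψ z α : ℝ) : Prop where
  q : Q xB yB
  hop : Hop3 Q xB yB x y
  xB0 : 0 ≤ xB
  yB0 : 0 ≤ yB
  y0 : y ≤ 0
  s0 : 0 ≤ x + y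
  yΨ : yB ≤ Ψ
  xz : xB + Ψ ≤ z
  zα : z + α ≤ a0
  α0 : 0 ≤ α
  heightLE : HeightLE Q Ψ z
  westLE : WestLE Q α Ψ

/-- Path-length bounds above the `x`-axis when few points lie just below the target. -/
structure Upper (Q : ℝ → ℝ → Prop) (D : ℝ → ℝ → ℝ → Prop) (a0 β₁ c x y : ℝ) : Prop where
  zF : x ≤ 0 → 0 ≤ y → x + y ≤ 0 → y ≤ a0 → -(x + y) ≤ β₁ → D x y (3 * y - (x + y) + a0 + c)
  zA : ∀ α, x ≤ 0 → 0 ≤ x + y → -α ≤ x → WestLE Q α y → x + y + α ≤ a0 →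
    D x y (2 * y + x + 2 * α + a0 + c)
  zB : ∀ Ψ z α, 0 ≤ x → 0 ≤ y → y ≤ Ψ → x + Ψ ≤ z → z + α ≤ a0 → 0 ≤ α → HeightLE Q Ψ z →
    WestLE Q α Ψ → D x y (x + y + Ψ + 2 * α + a0 + c)

theorem Sys.upper (S : Sys Q D) {a b a0 β₁ c : ℝ}
    (ih : ∀ x y, Q x y → hx x y < a + b → D x y (5 * tx x y))
    (E1 : ∀ u v, Q u v → -a ≤ u → -b ≤ v → u + v ≤ -(a + b) ∨ -β₁ ≤ u + v)
    (hb : 0 < b) (hβ : 0 ≤ β₁) (hβa : β₁ ≤ a0) (ha : a0 ≤ a) (hc : 4 * β₁ ≤ c)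
    (hC : ∀ xB yB x y Ψ z α, UpperHop Q a0 xB yB x y Ψ z α →
      D x y (x + y + Ψ + 2 * α + a0 + c)) :
    ∀ x y, Q x y → Upper Q D a0 β₁ c x y := by
  refine S.induct hx fun x y hq rec => ⟨?_, ?_, ?_⟩
  · intro hx0 hy0 hs hya hsβ
    by_cases h0 : (0 : ℝ) = x ∧ (0 : ℝ) = y
    · obtain ⟨rfl, rfl⟩ := h0
      exact S.mono S.zero (by linarith)
    obtain ⟨x', y', hop, hw, st⟩ := S.step5 hq S.origin (by linarith) (by linarith) h0
    have ⟨hq', hy', hs', hT⟩ := hop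
    have hlt : hx x' y' < hx x y := by
      have := neg_x_le_hx x y
      apply hx_lt <;> linarith
    have m := rec x' y' hq' hlt
    rcases le_total y' 0 with h1 | h1
    · have ht : tx x' y' ≤ β₁ := by apply tx_le <;> linarith
      exact S.mono (st _ (ih x' y' hq' (by apply hx_lt <;> linarith))) (by linarith)
    · rcases le_total (x' + y') 0 with h2 | h2
      · exact S.mono (st _ (m.zF hw h1 h2 (by linarith) (by linarith))) (by linarith)
      · refine S.mono (st _ (m.zA (-x') hw h2 (by linarith) ?_ (by linarith))) (by linarith)
        intro u v huv a b c
        rcases hT u v huv (by linarith) (by linarith) with h | h <;> linarith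
  · intro α hx0 hs hα i5 hsα
    by_cases h0 : (0 : ℝ) = x ∧ (0 : ℝ) = y
    · obtain ⟨rfl, rfl⟩ := h0
      exact S.mono S.zero (by linarith)
    obtain ⟨x', y', hop, hw, st⟩ := S.step4 hq S.origin (by linarith) (by linarith) h0
    have ⟨hq', hx', hs', hT⟩ := hop
    have hlt : hx x' y' < hx x y := by
      have := y_le_hx x y
      apply hx_lt <;> linarith
    have m := rec x' y' hq' hlt
    rcases le_total (x' + y') 0 with h1 | h1
    · rcases E1 x' y' hq' (by linarith) (by linarith) with h | h
      · linarith
      · exact S.mono (st _ (m.zF (by linarith) hw h1 (by linarith) (by linarith))) (by linarith)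
    · rcases le_total x' 0 with h2 | h2
      · exact S.mono (st _ (m.zA α h2 h1 (by linarith) (i5.mono (by linarith)) (by linarith)))
          (by linarith)
      · have hxneg : x < 0 := lt_of_le_of_ne hx0 fun h => h0 (S.gp S.origin hq (Or.inl h.symm))
        refine S.mono (st _ (m.zB y' (x + y) α h2 hw le_rfl (by linarith) hsα (by linarith) ?_
          (i5.mono (by linarith)))) (by linarith)
        intro u v huv a b
        rcases hT u v huv (by linarith) (by linarith) with h | h <;> linarith
  · intro Ψ z α hx0 hy0 hΨ hz hα hα0 iH i5
    by_cases h0 : (0 : ℝ) = x ∧ (0 : ℝ) = y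
    · obtain ⟨rfl, rfl⟩ := h0
      exact S.mono S.zero (by linarith)
    obtain ⟨x', y', hop, hw, st⟩ := S.step3 hq S.origin (by linarith) (by linarith) h0
    have ⟨hq', hx', hy', hT⟩ := hop
    have hlt : hx x' y' < hx x y := by
      have := sum_le_hx x y
      apply hx_lt <;> linarith
    have m := rec x' y' hq' hlt
    rcases le_total y' 0 with h1 | h1
    · exact S.mono (st _ (hC x y x' y' Ψ z α ⟨hq, hop, hx0, hy0, h1, by linarith, hΨ, hz, hα, hα0,
        iH, i5⟩))
        (by linarith)
    · rcases le_total x' 0 with h2 | h2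
      · exact S.mono (st _ (m.zA α h2 (by linarith)
          (i5 x' y' hq' h2 (by linarith) (by linarith)) (i5.mono (by linarith)) (by linarith)))
          (by linarith)
      · exact S.mono (st _ (m.zB Ψ z α h2 h1 (by linarith) (by linarith) hα hα0 iH i5))
          (by linarith)

/-- A hypothetical minimal counterexample: start `(-a, -b)`, target the origin. -/
structure Counterexample (Q : ℝ → ℝ → Prop) (D : ℝ → ℝ → ℝ → Prop) (a b : ℝ) : Prop where
  S : Sys Q D
  q : Q (-a) (-b)
  hb : 0 < b
  hba : b ≤ a
  ih : ∀ x y, Q x y → hx x y < a + b → D x y (5 * tx x y)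
  ihp : ∀ x y x' y' c, Q x y → Q x' y' → hx (x' - x) (y' - y) < a + b → D x' y' c →
    D x y (5 * tx (x' - x) (y' - y) + c)
  bad : ¬ D (-a) (-b) (5 * a + 5 / 2 * b)

/-- Data on the first step, which ends at `(p - a, q - b)` with `p + q = a + b - β`. -/
structure FirstStep (Q : ℝ → ℝ → Prop) (a b β p : ℝ) : Prop where
  empty : ∀ u v, Q u v → -a ≤ u → -b ≤ v → u + v ≤ -(a + b) ∨ -β ≤ u + v
  β0 : 0 ≤ β
  p0 : 0 ≤ p
  hp : 10 * p + 7 * β ≤ 2 * a - 3 * b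

theorem Counterexample.kill {a b x y c : ℝ} (K : Counterexample Q D a b) (hq : Q x y) (hd : D x y c)
    (h : hx (x + a) (y + b) < a + b) (ht : tx (x + a) (y + b) ≤ (5 * a + 5 / 2 * b - c) / 5) :
    False := by
  refine K.bad (K.S.mono (K.ihp _ _ x y c K.q hq ?_ hd) ?_)
  · simpa only [sub_neg_eq_add] using h
  · simp only [sub_neg_eq_add]
    linarith

theorem Counterexample.reach {a b x y c : ℝ} (K : Counterexample Q D a b) (hq : Q x y)
    (h : hx x y < a + b) (ht : tx x y ≤ c / 5) : D x y c :=
  K.S.mono (K.ih x y hq h) (by linarith)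

theorem Counterexample.kill_steep {a b x y : ℝ} (K : Counterexample Q D a b) (hq : Q x y)
    (hx0 : x ≤ y) (hy0 : y ≤ 0)
    (hs : x + y < 0) (hs' : -(x + y) < a + b) (h1 : -x - 2 * y ≤ a + 2 * b)
    (h2 : -2 * x - y ≤ 2 * a + b) (h3 : -x ≤ a)
    (h4 : y - x ≤ a - b) : False := by
  have := K.hb
  have := K.hba
  refine K.kill (c := -5 * x - 5 / 2 * y) hq (K.reach hq ?_ ?_) ?_ ?_
  · apply hx_lt <;> linarith
  · apply tx_le <;> linarith
  · apply hx_lt <;> linarith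
  · apply tx_le <;> linarith

theorem Counterexample.reach_EF {a b x y x' y' : ℝ} (K : Counterexample Q D a b)
    (hop : Hop0 Q x y x' y')
    (hxa : -x ≤ a) (hy' : 0 ≤ y') (hs : x' + y' ≤ 0)
    (st : ∀ c, D x' y' c → D x y (c + (x' + y' - (x + y)))) : D x y (-6 * x - y) := by
  have := K.hb
  have ⟨hq', hx', _, _⟩ := hop
  refine K.S.mono (st (-5 * x - (x' + y')) (K.reach hq' ?_ ?_)) (by linarith)
  · apply hx_lt <;> linarith
  · apply tx_le <;> linarith

theorem Counterexample.no_EF {a b β p x y x' y' : ℝ} (K : Counterexample Q D a b)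
    (W : FirstStep Q a b β p) (hq : Q x y)
    (hx0 : x ≤ 0) (hy0 : y ≤ 0) (hL : -(a + 2 * b) / 2 ≤ x + y) (hLa : -a ≤ x + y)
    (hop : Hop0 Q x y x' y')
    (hy' : 0 ≤ y') (hs : x' + y' ≤ 0)
    (st : ∀ c, D x' y' c → D x y (c + (x' + y' - (x + y)))) : False := by
  have := K.hb
  have := K.hba
  have := W.hp
  have := W.p0
  have := W.β0
  have ⟨_, hx', hy'', _⟩ := hop
  rcases le_total x y with h | h
  · have h4 : y - x ≤ a - b := by
      rcases le_total (-b) y with hb' | hb'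
      · rcases W.empty x y hq (by linarith) hb' with h5 | h5 <;> linarith
      · linarith
    exact K.kill_steep hq h hy0 (by linarith) (by linarith) (by linarith) (by linarith)
      (by linarith) h4
  · refine K.kill hq (K.reach_EF hop (by linarith) hy' hs st) ?_ ?_
    · apply hx_lt <;> linarith
    · apply tx_le <;> linarith

theorem Counterexample.direct_FE {a b β p x y x' y' : ℝ} (K : Counterexample Q D a b)
    (W : FirstStep Q a b β p)
    (hs : x + y ≤ 0) (hδ : -(x + y) ≤ β) (hxa : β - 2 * x ≤ a)
    (hop : Hop5 Q x y x' y') (hy' : y' ≤ 0) (hx' : x' ≤ 0)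
    (st : ∀ c, D x' y' c → D x y (c + (x' - x))) : D x y (-x - 5 * (x + y)) := by
  have := K.hb
  have := K.hba
  have := W.hp
  have := W.p0
  have := W.β0
  have ⟨hq', h1, h2, _⟩ := hop
  refine K.S.mono (st (-5 * (x + y) - x') (K.reach hq' ?_ ?_)) (by linarith)
  · apply hx_lt <;> linarith
  · apply tx_le <;> linarith

theorem Counterexample.kill_flat {a b β p x y : ℝ} (K : Counterexample Q D a b)
    (W : FirstStep Q a b β p) (hq : Q x y)
    (hy0 : 0 ≤ y) (hs : x + y < 0) (hδ : -(x + y) ≤ β) (h : y ≤ -(x + y)) : False := by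
  have := K.hb
  have := K.hba
  have := W.hp
  have := W.p0
  refine K.kill (c := -5 * (x + y) + 5 / 2 * y) hq (K.reach hq ?_ ?_) ?_ ?_
  · apply hx_lt <;> linarith
  · apply tx_le <;> linarith
  · apply hx_lt <;> linarith
  · apply tx_le <;> linarith

theorem Counterexample.chargeFE_large {a b β p M φ : ℝ} (K : Counterexample Q D a b)
    (W : FirstStep Q a b β p)
    (hMa : β + 2 * M ≤ a) (hφ : M / 2 + 2 * β ≤ φ) : ChargeFE Q D φ M := by
  intro x y x' y' hq hx0 hy0 hs hxM hop hy' hx' st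
  have := K.hb
  have := K.hba
  have := W.hp
  have := W.p0
  have := W.β0
  have ⟨hq', h1, h2, _⟩ := hop
  have hδ : -(x + y) ≤ β := by
    rcases W.empty x y hq (by linarith) (by linarith) with h5 | h5 <;> linarith
  have dir := K.direct_FE W hs hδ (by linarith) hop hy' hx' st
  rcases le_total y (-(x + y)) with h | h
  · exact (K.kill_flat W hq hy0 (by linarith) hδ h).elim
  · rcases le_total (-5 * (x + y)) (3 * y) with h5 | h5
    · exact K.S.mono dir (by linarith)
    · exfalso
      refine K.kill hq dir ?_ ?_
      · apply hx_lt <;> linarith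
      · apply tx_le <;> linarith

theorem Counterexample.chargeFE_small {a b β p M φ : ℝ} (K : Counterexample Q D a b)
    (W : FirstStep Q a b β p)
    (hMa : β + 2 * M ≤ a) (hM : 7 * M ≤ 5 * (a - b)) : ChargeFE Q D φ M := by
  intro x y x' y' hq hx0 hy0 hs hxM hop hy' hx' st
  have := K.hb
  have := K.hba
  have := W.hp
  have := W.p0
  have := W.β0
  have ⟨hq', h1, h2, _⟩ := hop
  have hδ : -(x + y) ≤ β := by
    rcases W.empty x y hq (by linarith) (by linarith) with h5 | h5 <;> linarith
  exfalso
  rcases le_total y (-(x + y)) with h | h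
  · exact K.kill_flat W hq hy0 (by linarith) hδ h
  · refine K.kill hq (K.direct_FE W hs hδ (by linarith) hop hy' hx' st) ?_ ?_
    · apply hx_lt <;> linarith
    · apply tx_le <;> linarith

theorem Counterexample.ef {a b β p L φ : ℝ} (K : Counterexample Q D a b) (W : FirstStep Q a b β p)
    (hL : L ≤ (a + 2 * b) / 2) (hLa : L ≤ a) : ChargeEF Q D φ L := by
  intro x y x' y' hq hx0 hy0 hs hop hy' hs' st
  exact (K.no_EF W hq hx0 hy0 (by linarith) (by linarith) hop hy' hs' st).elim

theorem rightLE_neg {X h : ℝ} (h1 : h ≤ X) : RightLE Q X (-h) := by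
  intro u v _ _ _ _
  linarith

/-- If all points near the target in the lower sextants lie above depth `h`, the bound at points
below that depth improves by `x₅ - h - σ`. -/
theorem Sys.deep (S : Sys Q D) {φ L' a h x₅ σ β : ℝ} (hφ : 0 ≤ φ) (hFE : ChargeFE Q D φ L')
    (hEF : ChargeEF Q D φ β) (hh : 0 ≤ h) (hβ : 0 ≤ β) (hκ : h + σ ≤ x₅)
    (gE : ∀ u v, Q u v → u ≤ 0 → v ≤ 0 → -a ≤ u + v → -β ≤ u + v ∧ -h ≤ v)
    (gD : ∀ u v, Q u v → 0 ≤ u → v < -h → -a ≤ u + v → x₅ ≤ u) :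
    ∀ x y, Q x y → ∀ X n H M, 0 ≤ n → n ≤ σ → 0 ≤ H → 0 ≤ M → M ≤ L' → x ≤ X → 0 ≤ x →
      x + y ≤ 0 → y < -h → -a ≤ y → RiseLE Q n X → HeightLE Q H n → LeftLE Q M n H →
      D x y (-y + X - (x₅ - h - σ) + n + H + β + M + φ) := by
  refine S.induct hx fun x y hq ih => ?_
  intro X n H M hn hnσ hH hM hML hxX hx0 hs hyh hya i1 iH iA
  have hbase := S.base (L := β) hφ hEF hFE
  have h0 : ¬((0 : ℝ) = x ∧ (0 : ℝ) = y) := fun h => by linarith [h.2]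
  obtain ⟨x', y', hop, hw, st⟩ := S.step1 hq S.origin (by linarith) (by linarith) h0
  have ⟨hq', hx', hs', hT⟩ := hop
  have hxx := gD x y hq hx0 hyh (by linarith)
  have m := hbase x' y' hq'
  rcases le_total x' 0 with h1 | h1
  · obtain ⟨e1, e2⟩ := gE x' y' hq' h1 hw (by linarith)
    refine S.mono (st _ (m.zE h n H M hh hn hH hM h1 hw (by linarith)
      ?_ (i1.mono (by linarith)) iH iA hML)) (by linarith)
    exact (rightLE_neg le_rfl).mono e2
  · rcases le_total (x' + y') 0 with h2 | h2
    · rcases le_or_gt (-h) y' with h3 | h3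
      · refine S.mono (st _ (m.zD h n H β M h hn hH hβ hM h1 (by linarith) h2
          (i1.mono (by linarith))
          iH iA ?_ (rightLE_neg le_rfl) ?_ le_rfl hML)) (by linarith)
        · intro u v huv a b c e
          exact gE u v huv a b (by linarith)
        · intro u v huv a b c e k l hkl k1 k2 k3 k4
          exact (gE k l hkl k1 k2 (by linarith)).1
      · have hlt : hx x' y' < hx x y := by
          have := neg_y_le_hx x y
          apply hx_lt <;> linarith
        exact S.mono (st _ (ih x' y' hq' hlt X n H M hn hnσ hH hM hML (by linarith) h1 h2 h3
          (by linarith) i1 iH iA)) (by linarith)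
    · have hn' := i1 x y x' y' hq hop hx0 hxX hs hw h2
      have shallow : ∀ T, β + φ - y' ≤ T ∨
        (y' < -h ∧ h + β + φ ≤ T ∧ β + φ - y' - (x₅ - h - σ) ≤ T) →
          LandingLE Q D L' (-y') n T x' := by
        intro T hT' u v u' v' huv hop' a b c e f g n₂ H₂ M₂ j1 j2 j3 j4 j5 j6 j7 j8
        have ⟨g1, g2, g3, g4⟩ := hop'
        have hlt' : hx u' v' < hx x y := by
          have := neg_y_le_hx x y
          apply hx_lt <;> linarith
        have sh : D u' v' (-v' + u' + n₂ + H₂ + β + M₂ + φ) := by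
          refine (hbase u' v' g1).zD u' n₂ H₂ β M₂ (-v') j1 j3 hβ j4 f le_rfl g j6 j7 j8
            ?_ ?_ ?_ le_rfl j5
          · intro e1 f1 hef k1 k2 k3 k4
            exact ⟨(gE e1 f1 hef k1 k2 (by linarith)).1, by linarith⟩
          · rw [neg_neg]
            exact hop'.rightLE b
          · intro e1 f1 _ k1 k2 k3 k8 e2 f2 hef2 k4 k5 k6 k7
            exact (gE e2 f2 hef2 k4 k5 (by linarith)).1
        rcases hT' with h4 | ⟨h3, h4, h5⟩
        · exact S.mono sh (by linarith)
        · rcases le_or_gt (-h) v' with h6 | h6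
          · exact S.mono sh (by linarith)
          · exact S.mono (ih u' v' g1 hlt' u' n₂ H₂ M₂ j1 (by linarith) j3 j4 j5 le_rfl f g h6
              (by linarith) j6 j7 j8) (by linarith)
      rcases le_or_gt (-h) y' with h3 | h3
      · have t := S.turn hFE (d := -y') (N := n) (T := β + φ - y') (by linarith) (by linarith) x'
          y' hq'
        exact S.mono (st _ (t.zC n H M hH hM h1 hw h2 hn' le_rfl (i1.mono (by linarith)) iH
          (hop.dropLE h1 hs) (by linarith) (shallow _ (Or.inl le_rfl)) iA hML)) (by linarith)
      · have hx5 := gD x' y' hq' h1 h3 (by linarith)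
        have t := S.turn hFE (d := -y') (N := n) (T := β + φ - y' - (x₅ - h - σ))
          (by linarith) (by linarith) x' y' hq'
        exact S.mono (st _ (t.zC n H M hH hM h1 hw h2 hn' le_rfl (i1.mono (by linarith)) iH
          (hop.dropLE h1 hs) (by linarith) (shallow _ (Or.inr ⟨h3, by linarith, le_rfl⟩)) iA hML))
          (by linarith)

/-- A counterexample together with the landing `(χ₀, y₀)` of its path in the sextant `[300°, 360°]`
and the extremal points that govern the rest of the path; `n₀ = χ₀ + y₀`. -/
structure Cfg (Q : ℝ → ℝ → Prop) (D : ℝ → ℝ → ℝ → Prop)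
    (a b β p χ₀ n₀ ω σ Ψ M Ω Δ X Y xa xr yr : ℝ) : Prop where
  K : Counterexample Q D a b
  W : FirstStep Q a b β p
  χA : χ₀ + p + β + M + Ψ ≤ a
  M0 : 0 ≤ M
  MΨ : M ≤ Ψ
  fe : ChargeFE Q D 0 M
  X0 : 0 ≤ X
  Y0 : 0 ≤ Y
  hop : Hop3 Q X Y (σ + ω) (-ω)
  σ0 : 0 ≤ σ
  ω0 : 0 ≤ ω
  χ : σ + ω ≤ χ₀
  dropLE : DropLE Q ω χ₀
  heightLE : HeightLE Q Ψ χ₀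
  leftLE : ∀ n, LeftLE Q M n Ψ
  hD : ∀ u v, Q u v → 0 ≤ u → v ≤ 0 → u + v ≤ 0 → -ω ≤ v → -Ω ≤ v ∧ -Δ ≤ u + v
  qa : Q xa (-Ω)
  xa0 : 0 ≤ xa
  xaΩ : xa ≤ Ω
  qr : Q xr yr
  xr0 : 0 ≤ xr
  yr0 : yr ≤ 0
  yrω : -ω ≤ yr
  hr : xr + yr = -Δ
  Ωω : Ω ≤ ω
  Δ0 : 0 ≤ Δ
  ΔΩ : Δ ≤ Ω
  big : a - χ₀ + β + 3 / 2 * b < Ω + Δ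
  noC : ∀ T, 0 ≤ T → T ≤ a - χ₀ + M + 3 * β + 3 / 2 * b → ¬ LandingLE Q D M ω n₀ T χ₀

namespace Cfg

variable {a b β p χ₀ n₀ ω σ Ψ M Ω Δ X Y xa xr yr : ℝ}

theorem riseLE (F : Cfg Q D a b β p χ₀ n₀ ω σ Ψ M Ω Δ X Y xa xr yr) {X' : ℝ} (h : X' ≤ X) :
    RiseLE Q σ X' := by
  intro u v u' v' huv hop' h0 h1 h2 h3 h4
  have ⟨g1, g2, g3, g4⟩ := hop'
  have := F.Y0
  rcases F.hop.2.2.2 u' v' g1 (by linarith) (by linarith) with h5 | h5 <;> linarith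

theorem Ω_lt (F : Cfg Q D a b β p χ₀ n₀ ω σ Ψ M Ω Δ X Y xa xr yr) : b < Ω := by
  by_contra! h
  have := F.W.β0
  have := F.K.hb
  have := F.K.hba
  have := F.big
  have := F.χA
  have := F.W.p0
  have := F.M0
  have := F.MΨ
  have := F.ΔΩ
  have := F.hr
  have := F.xr0
  have := F.hD _ _ F.qr F.xr0 F.yr0 (by linarith [F.Δ0]) F.yrω
  rcases F.W.empty xr yr F.qr (by linarith) (by linarith) with h5 | h5 <;> linarith

theorem ω_lt (F : Cfg Q D a b β p χ₀ n₀ ω σ Ψ M Ω Δ X Y xa xr yr) : σ + ω < X := F.hop.2.1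

theorem landingLE (F : Cfg Q D a b β p χ₀ n₀ ω σ Ψ M Ω Δ X Y xa xr yr) {h : ℝ}
    (gE : ∀ u v, Q u v → u ≤ 0 → v ≤ 0 → -a ≤ u + v → -β ≤ u + v ∧ -h ≤ v) (N X' : ℝ) :
    LandingLE Q D M ω N (Ω + β) X' := by
  intro u v u' v' huv hop' a' b' c e f g n₂ H₂ M₂ j1 j2 j3 j4 j5 j6 j7 j8
  have ⟨g1, g2, g3, g4⟩ := hop'
  have := F.K.hb
  have := F.K.hba
  have := F.W.hp
  have := F.W.p0
  have := F.W.β0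
  have := F.χA
  have := F.M0
  have := F.MΨ
  have := F.σ0
  have := F.χ
  have hΩ := (F.hD u' v' g1 f (by linarith) g (by linarith)).1
  refine F.K.S.mono ((F.K.S.base (L := β) le_rfl (F.K.ef F.W (by linarith) (by linarith)) F.fe
    u' v' g1).zD u' n₂ H₂ β M₂ (-v') j1 j3 F.W.β0 j4 f le_rfl g j6 j7 j8 ?_ ?_ ?_ le_rfl j5)
    (by linarith)
  · intro e1 f1 hef k1 k2 k3 k4
    exact ⟨(gE e1 f1 hef k1 k2 (by linarith)).1, by linarith⟩
  · rw [neg_neg]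
    exact hop'.rightLE b'
  · intro e1 f1 _ k1 k2 k3 k8 e2 f2 hef2 k4 k5 k6 k7
    exact (gE e2 f2 hef2 k4 k5 (by linarith)).1

theorem reach_D (F : Cfg Q D a b β p χ₀ n₀ ω σ Ψ M Ω Δ X Y xa xr yr) {h x y : ℝ} (hq : Q x y)
    (hhb : h ≤ b) (hx0 : 0 ≤ x) (hxΩ : x ≤ Ω) (hs : x + y ≤ 0)
    (gE : ∀ u v, Q u v → u ≤ 0 → v ≤ 0 → -a ≤ u + v ∨ x + y ≤ u + v → -β ≤ u + v ∧ -h ≤ v) :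
    D x y (-y + max x h + σ + Ψ + β + M) := by
  have := F.K.hb
  have := F.K.hba
  have := F.W.hp
  have := F.W.p0
  have := F.W.β0
  have := F.χA
  have := F.M0
  have := F.MΨ
  have := F.σ0
  have := F.χ
  have := F.Ωω
  have := F.ω_lt
  have hX : max x h ≤ Ω := max_le hxΩ (by linarith [F.Ω_lt])
  refine F.K.S.mono ((F.K.S.base (L := β) le_rfl (F.K.ef F.W (by linarith) (by linarith)) F.fe
    x y hq).zD (max x h) σ Ψ β M h F.σ0 (by linarith) F.W.β0 F.M0 hx0 (le_max_left _ _) hs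
    (F.riseLE (by linarith)) (F.heightLE.mono (by linarith [F.ω0])) (F.leftLE σ) ?_
    (rightLE_neg (le_max_right _ _))
    ?_ le_rfl le_rfl) (by linarith)
  · intro e1 f1 hef k1 k2 k3 k4
    exact gE e1 f1 hef k1 k2 (Or.inr k3)
  · intro e1 f1 _ k1 k2 k3 k8 e2 f2 hef2 k4 k5 k6 k7
    exact (gE e2 f2 hef2 k4 k5 (Or.inl (by linarith))).1

theorem reach_C (F : Cfg Q D a b β p χ₀ n₀ ω σ Ψ M Ω Δ X Y xa xr yr) {h x y : ℝ} (hq : Q x y)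
    (hx0 : 0 ≤ x) (hxΩ : x ≤ Ω) (hy0 : y ≤ 0) (hs : 0 ≤ x + y)
    (gE : ∀ u v, Q u v → u ≤ 0 → v ≤ 0 → -a ≤ u + v → -β ≤ u + v ∧ -h ≤ v) :
    D x y (x + σ + Ψ + M + Ω + β) := by
  have := F.W.β0
  have := F.M0
  have := F.MΨ
  have := F.σ0
  have := F.χ
  have := F.Ωω
  have := F.ω_lt
  have := F.Y0
  have hσ : x + y ≤ σ := by
    rcases F.hop.2.2.2 x y hq (by linarith) (by linarith) with h5 | h5 <;> linarith
  exact F.K.S.mono ((F.K.S.turn F.fe (d := ω) (N := σ) (T := Ω + β) (by linarith) (by linarith)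
    x y hq).zC σ Ψ M (by linarith) F.M0 hx0 hy0 hs hσ le_rfl (F.riseLE (by linarith))
    (F.heightLE.mono (by linarith [F.ω0])) (F.dropLE.mono ((min_le_left _ _).trans (by linarith)))
    (by linarith) (F.landingLE gE σ x) (F.leftLE σ) le_rfl) (by linarith)

/-- The second step considered at the start, into the cone `[300°, 360°]`. -/
structure Side (Q : ℝ → ℝ → Prop) (D : ℝ → ℝ → ℝ → Prop) (a b Ω xw yw : ℝ) : Prop where
  q : Q xw yw
  xΩ : xw ≤ Ω
  y : yw < -b
  s : -(a + b) < xw + yw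
  st : ∀ c, D xw yw c → D (-a) (-b) (c + (xw + a))
  E : ∀ u v, Q u v → v ≤ -b → -(a + b) ≤ u + v → u ≤ -a ∨ xw ≤ u

theorem side (F : Cfg Q D a b β p χ₀ n₀ ω σ Ψ M Ω Δ X Y xa xr yr) :
    ∃ xw yw, Side Q D a b Ω xw yw := by
  have := F.K.hb
  have := F.W.p0
  have := F.W.β0
  have := F.χA
  have := F.M0
  have := F.MΨ
  have := F.σ0
  have := F.χ
  have := F.Ωω
  have := F.Ω_lt
  have := F.xa0
  have := F.xaΩ
  obtain ⟨xw, yw, hop, hw, st⟩ := F.K.S.step5 F.K.q F.qa (by linarith) (by linarith)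
    (fun h => by linarith [h.1, F.K.hba])
  have ⟨h1, h2, h3, h4⟩ := hop
  refine ⟨xw, yw, h1, by linarith, h2, by linarith, fun c hc => F.K.S.mono (st c hc) (by linarith),
    fun u v huv h5 h6 => h4 u v huv h5 (by linarith)⟩

theorem no_deep (F : Cfg Q D a b β p χ₀ n₀ ω σ Ψ M Ω Δ X Y xa xr yr) {xw yw : ℝ}
    (w : Side Q D a b Ω xw yw) (hw : 0 ≤ xw) {u v : ℝ} (hq : Q u v) (hu : u ≤ 0) (hv : v < -b)
    (hs : -(a + b) < u + v) : False := by
  have := F.K.hb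
  rcases w.E u v hq hv.le hs.le with h | h
  · linarith
  · have := F.K.S.gp F.K.S.origin hq (Or.inl (by linarith))
    linarith [this.2]

theorem false_of_simple (F : Cfg Q D a b β p χ₀ n₀ ω σ Ψ M Ω Δ X Y xa xr yr) {xw yw : ℝ}
    (w : Side Q D a b Ω xw yw) (hw : 0 ≤ xw)
    (hno : ∀ u v, Q u v → u < -a → -b ≤ v → v ≤ 0 → u + v < xw + yw) : False := by
  have := F.K.hb
  have := F.K.hba
  have := F.W.p0
  have := F.W.β0
  have := F.χA
  have := F.M0
  have := F.MΨ
  have := F.σ0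
  have := F.χ
  have := F.Ωω
  have := F.Ω_lt
  have := w.xΩ
  have := w.y
  have := w.s
  have gE : ∀ u v, Q u v → u ≤ 0 → v ≤ 0 → -a ≤ u + v ∨ xw + yw ≤ u + v →
      -β ≤ u + v ∧ -b ≤ v := by
    intro u v huv hu hv hs
    have hs' : -(a + b) < u + v := by rcases hs with h | h <;> linarith
    have hb : -b ≤ v := by
      by_contra! hlt
      exact F.no_deep w hw huv hu hlt hs'
    rcases lt_or_ge u (-a) with h | h
    · have := hno u v huv h hb hv
      rcases hs with h | h <;> linarith
    · rcases F.W.empty u v huv h hb with h5 | h5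
      · linarith
      · exact ⟨h5, hb⟩
  refine F.K.bad ?_
  rcases le_total (xw + yw) 0 with h | h
  · have hm : max xw b ≤ Ω := max_le w.xΩ F.Ω_lt.le
    exact F.K.S.mono (w.st _ (F.reach_D w.q le_rfl hw w.xΩ h gE)) (by linarith)
  · exact F.K.S.mono (w.st _ (F.reach_C w.q hw w.xΩ (by linarith) h
      fun u v huv hu hv hs => gE u v huv hu hv (Or.inl hs))) (by linarith)

end Cfg

theorem Sys.exists_max (S : Sys Q D) (f : ℝ → ℝ → ℝ) {R : ℝ → ℝ → Prop} {x y : ℝ} (hq : Q x y)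
    (hR : R x y) :
    ∃ u v, Q u v ∧ R u v ∧ ∀ u' v', Q u' v' → R u' v' → f u' v' ≤ f u v := by
  obtain ⟨⟨u, v⟩, ⟨h1, h2⟩, h3⟩ := Set.exists_max_image
    ({p : ℝ × ℝ | Q p.1 p.2} ∩ {p | R p.1 p.2}) (fun p => f p.1 p.2) (S.fin.inter_of_left _)
    ⟨(x, y), hq, hR⟩
  exact ⟨u, v, h1, h2, fun u' v' h h' => h3 (u', v') ⟨h, h'⟩⟩

namespace Cfg

variable {a b β p χ₀ n₀ ω σ Ψ M Ω Δ X Y xa xr yr : ℝ}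

/-- Climbing from the start to the point `(-a - g, -h)` of the sextant `[120°, 180°]`. -/
theorem climb (K : Counterexample Q D a b) {g h c : ℝ} (hq : Q (-a - g) (-h))
    (hh : 0 ≤ h) (hgh : g + h < b) (hc : D (-a - g) (-h) c)
    (hmax : ∀ u v, Q u v → u < -a → -b ≤ v → v ≤ 0 → u + v ≤ -a - g - h) :
    ∀ x y, Q x y → -b ≤ y → x ≤ -a → -a - g ≤ x → x + y ≤ -a - g - h → -(a + b) ≤ x + y →
      D x y (c + (-h - y) + 5 * (b - g - h)) := by
  have := K.hb
  have := K.hba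
  refine K.S.induct (fun _ y => -y) fun x y hxy rec hyb hxa hxg hs hs' => ?_
  by_cases h0 : -a - g = x ∧ -h = y
  · obtain ⟨rfl, rfl⟩ := h0
    exact K.S.mono hc (by linarith)
  obtain ⟨x', y', ⟨hq', hx', hs'', _⟩, hw, st⟩ := K.S.step1 hxy hq (by linarith) (by linarith) h0
  have hm := hmax x' y' hq' (by linarith) (by linarith) (by linarith)
  rcases le_total (-a - g) x' with h1 | h1
  · exact K.S.mono (st _ (rec x' y' hq' (by linarith) (by linarith) (by linarith) h1 hm
      (by linarith)))
      (by linarith)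
  · have ht : tx (-a - g - x') (-h - y') ≤ -a - g - h - (x' + y') := by apply tx_le <;> linarith
    exact K.S.mono (st _ (K.ihp x' y' _ _ c hq' hq (by apply hx_lt <;> linarith) hc))
      (by linarith)

theorem climb_start (K : Counterexample Q D a b) {g h c : ℝ} (hq : Q (-a - g) (-h)) (hg : 0 ≤ g)
    (hh : 0 ≤ h) (hgh : g + h < b) (hc : D (-a - g) (-h) c)
    (hmax : ∀ u v, Q u v → u < -a → -b ≤ v → v ≤ 0 → u + v ≤ -a - g - h) :
    D (-a) (-b) (c + (11 / 2 * b - 3 * h - 2 * g)) := by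
  have := K.hb
  have := K.hba
  rcases le_total (9 / 2 * g + h / 2) (3 * b) with h1 | h1
  · have ht : tx (-a - g - -a) (-h - -b) ≤ (11 / 2 * b - 3 * h - 2 * g) / 5 := by
      apply tx_le <;> linarith
    exact K.S.mono (K.ihp _ _ _ _ c K.q hq (by apply hx_lt <;> linarith) hc) (by linarith)
  · exact K.S.mono (climb K hq hh hgh hc hmax _ _ K.q le_rfl le_rfl (by linarith) (by linarith)
      (by linarith)) (by linarith)

theorem false_of_detour (F : Cfg Q D a b β p χ₀ n₀ ω σ Ψ M Ω Δ X Y xa xr yr) {xw yw : ℝ}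
    (w : Side Q D a b Ω xw yw) (hw : 0 ≤ xw)
    (hex : ∃ u v, Q u v ∧ u < -a ∧ -b ≤ v ∧ v ≤ 0 ∧ xw + yw ≤ u + v) : False := by
  have := F.K.hb
  have := F.K.hba
  have := F.W.p0
  have := F.W.β0
  have hp := F.W.hp
  have hχA := F.χA
  have := F.M0
  have := F.MΨ
  have := F.σ0
  have := F.χ
  have := F.Ωω
  have := F.Ω_lt
  have := F.xa0
  have := F.xaΩ
  have := w.s
  obtain ⟨u₀, v₀, hq₀, h₀a, h₀b, h₀0, h₀s⟩ := hex
  obtain ⟨xe, ye, hqe, ⟨hea, heb, he0⟩, hmax'⟩ := F.K.S.exists_max (fun u v => u + v)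
    (R := fun u v => u < -a ∧ -b ≤ v ∧ v ≤ 0) hq₀ ⟨h₀a, h₀b, h₀0⟩
  have hes : xw + yw ≤ xe + ye := h₀s.trans (hmax' u₀ v₀ hq₀ ⟨h₀a, h₀b, h₀0⟩)
  obtain ⟨g, rfl⟩ : ∃ g, xe = -a - g := ⟨-a - xe, by ring⟩
  obtain ⟨h, rfl⟩ : ∃ h, ye = -h := ⟨-ye, by ring⟩
  have hmax : ∀ u v, Q u v → u < -a → -b ≤ v → v ≤ 0 → u + v ≤ -a - g - h := by
    intro u v huv h1 h2 h3
    linarith [hmax' u v huv ⟨h1, h2, h3⟩]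
  obtain ⟨x₅, y₅, hop, hx5, st⟩ := F.K.S.step5 hqe F.qa (by linarith) (by linarith)
    (fun h => by linarith [h.1])
  have ⟨hq5, hy5, hs5, hE5⟩ := hop
  have start : ∀ c, D x₅ y₅ c → D (-a) (-b) (c + (x₅ + a + g) + (11 / 2 * b - 3 * h - 2 * g)) := by
    intro c hc
    exact F.K.S.mono (climb_start F.K hqe (by linarith) (by linarith) (by linarith) (st c hc) hmax)
      (by linarith)
  rcases le_or_gt x₅ 0 with h5 | h5
  · have hb5 : -b ≤ y₅ := by
      by_contra! hlt
      exact F.no_deep w hw hq5 h5 hlt (by linarith)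
    rcases lt_or_ge x₅ (-a) with h6 | h6
    · linarith [hmax x₅ y₅ hq5 h6 hb5 (by linarith)]
    · rcases F.W.empty x₅ y₅ hq5 h6 hb5 with h7 | h7
      · linarith
      · have ht : D x₅ y₅ (5 * β) := F.K.reach hq5 (by apply hx_lt <;> linarith)
          (by apply tx_le <;> linarith)
        exact F.K.bad (F.K.S.mono (start _ ht) (by linarith))
  have gE : ∀ u v, Q u v → u ≤ 0 → v ≤ 0 → -a ≤ u + v ∨ x₅ + y₅ ≤ u + v →
      -β ≤ u + v ∧ -h ≤ v := by
    intro u v huv hu hv hs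
    have hs' : -a - g - h < u + v := by rcases hs with h | h <;> linarith
    have hh : -h ≤ v := by
      by_contra! hlt
      rcases hE5 u v huv hlt.le (by linarith) with h6 | h6 <;> linarith
    rcases lt_or_ge u (-a) with h6 | h6
    · linarith [hmax u v huv h6 (by linarith) hv]
    · rcases F.W.empty u v huv h6 (by linarith) with h7 | h7
      · linarith
      · exact ⟨h7, hh⟩
  have gE' : ∀ u v, Q u v → u ≤ 0 → v ≤ 0 → -a ≤ u + v → -β ≤ u + v ∧ -h ≤ v :=
    fun u v huv hu hv hs => gE u v huv hu hv (Or.inl hs)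
  have run₁ : a - χ₀ + M + 2 * β + 3 / 2 * b < Ω := by
    by_contra! hle
    exact F.noC (Ω + β) (by linarith) (by linarith) (F.landingLE gE' n₀ χ₀)
  have exceed : D x₅ y₅ (5 * a + 5 / 2 * b - (x₅ + a + g) - (11 / 2 * b - 3 * h - 2 * g)) → False :=
    fun hd => F.K.bad (F.K.S.mono (start _ hd) (by linarith))
  have run₂ : h + σ ≤ x₅ → a - χ₀ + M + 2 * β + 3 / 2 * b < Ω - (x₅ - h - σ) := by
    intro hκ
    by_contra! hle
    have hW : max (Ω - (x₅ - h - σ)) h + β ≤ a - χ₀ + M + 3 * β + 3 / 2 * b := by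
      have : max (Ω - (x₅ - h - σ)) h ≤ a - χ₀ + M + 2 * β + 3 / 2 * b := max_le hle (by linarith)
      linarith
    have hW1 := le_max_left (Ω - (x₅ - h - σ)) h
    have hW2 := le_max_right (Ω - (x₅ - h - σ)) h
    refine F.noC _ (by linarith) hW ?_
    have hef : ChargeEF Q D 0 β := F.K.ef F.W (by linarith) (by linarith)
    intro u v u' v' huv hop' a' b' c e f k n₂ H₂ M₂ j1 j2 j3 j4 j5 j6 j7 j8
    have ⟨g1, g2, g3, g4⟩ := hop'
    have hΩ := (F.hD u' v' g1 f (by linarith) k (by linarith)).1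
    rcases le_or_gt (-h) v' with h6 | h6
    · refine F.K.S.mono ((F.K.S.base (L := β) le_rfl hef F.fe u' v' g1).zD u' n₂ H₂ β M₂ (-v')
        j1 j3 F.W.β0 j4 f le_rfl k j6 j7 j8 ?_ ?_ ?_ le_rfl j5) (by linarith)
      · intro e1 f1 hef k1 k2 k3 k4
        exact ⟨(gE' e1 f1 hef k1 k2 (by linarith)).1, by linarith⟩
      · rw [neg_neg]
        exact hop'.rightLE b'
      · intro e1 f1 _ k1 k2 k3 k8 e2 f2 hef2 k4 k5 k6 k7
        exact (gE' e2 f2 hef2 k4 k5 (by linarith)).1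
    · have hm1 := min_le_left n₂ σ
      have gD : ∀ u v, Q u v → 0 ≤ u → v < -h → -a ≤ u + v → x₅ ≤ u := by
        intro u v huv h7 h8 h9
        rcases hE5 u v huv h8.le (by linarith) with h10 | h10 <;> linarith
      have hi1 : RiseLE Q (min n₂ σ) u' := by
        intro e f e' f' hef hop'' q1 q2 q3 q4 q5
        exact le_min (j6 e f e' f' hef hop'' q1 q2 q3 q4 q5)
          (F.riseLE (by linarith [F.ω_lt]) e f e' f' hef hop'' q1 q2 q3 q4 q5)
      exact F.K.S.mono (F.K.S.deep le_rfl F.fe hef (by linarith) F.W.β0 hκ gE' gD u' v' g1 u'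
        (min n₂ σ) H₂ M₂ (le_min j1 F.σ0) (min_le_right _ _) j3 j4 j5 le_rfl f k h6 (by linarith)
        hi1 (j7.mono hm1) (j8.mono hm1 le_rfl)) (by linarith)
  refine exceed ?_
  rcases le_total (x₅ + y₅) 0 with h6 | h6
  · refine F.K.S.mono (F.reach_D hq5 (by linarith) h5.le (by linarith) h6 gE) ?_
    rcases le_total x₅ h with h7 | h7
    · rw [max_eq_right h7]
      linarith
    · rw [max_eq_left h7]
      rcases le_total (h + σ) x₅ with h8 | h8
      · linarith [run₂ h8]
      · linarith
  · refine F.K.S.mono (F.reach_C hq5 h5.le (by linarith) (by linarith) h6 gE') ?_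
    rcases le_total (h + σ) x₅ with h8 | h8
    · linarith [run₂ h8]
    · linarith

end Cfg

theorem ChargeFE.mono (S : Sys Q D) {φ φ' M : ℝ} (h : ChargeFE Q D φ M) (hφ : φ ≤ φ')  :
    ChargeFE Q D φ' M :=
  fun _ _ _ _ a b c d e f g i j => S.mono (h _ _ _ _ a b c d e f g i j) (by linarith)

/-- The case where the step from the start into the cone `[300°, 360°]` ends left of the target;
`(x₀, y₀)` is a deep point below the target. -/
structure Pit (Q : ℝ → ℝ → Prop) (D : ℝ → ℝ → ℝ → Prop)
    (a b β p χ₀ n₀ ω σ Ψ M Ω Δ X Y xa xr yr xw yw x₀ y₀ δ κ φ : ℝ) : Prop where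
  F : Cfg Q D a b β p χ₀ n₀ ω σ Ψ M Ω Δ X Y xa xr yr
  w : Cfg.Side Q D a b Ω xw yw
  hw : xw < 0
  hκ : κ = 4 * a + 5 / 2 * b + 3 * yw
  q₀ : Q x₀ y₀
  x₀0 : 0 ≤ x₀
  y₀b : y₀ < -b
  y₀Ω : -Ω ≤ y₀
  sum₀ : x₀ + y₀ = -δ
  δ0 : 0 ≤ δ
  δΔ : δ ≤ Δ
  hδ : Δ = δ ∨ Δ ≤ β
  neg_xw_lt : 7 * (-xw) < 2 * a + 5 * b
  φ0 : 0 ≤ φ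
  φw : φ ≤ 4 * (-xw)
  φκ : φ + σ + Ψ + M + Δ - δ ≤ κ
  ef : ChargeEF Q D φ Δ

/-- Points of the lower sextants to the right of `x₀` and above `y` are within `Δc`. -/
def Close (Q : ℝ → ℝ → Prop) (x₀ Δc y : ℝ) : Prop :=
  ∀ u v, Q u v → x₀ ≤ u → y ≤ v → u + v ≤ 0 → -Δc ≤ u + v

theorem Close.mono {x₀ Δc y y' : ℝ} (h : Close Q x₀ Δc y) (hy : y ≤ y') : Close Q x₀ Δc y' :=
  fun _ _ a b c => h _ _ a b (hy.trans c)

/-- The bounds available at `(x, y)` in a pit. -/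
structure PitBound (Q : ℝ → ℝ → Prop) (D : ℝ → ℝ → ℝ → Prop)
    (a b ω σ yw x₀ y₀ δ κ x y : ℝ) : Prop where
  bE : (x ≤ x₀ ∧ y ≤ y₀) ∨ (x ≤ 0 ∧ y ≤ 0) → -a < x → yw ≤ y → -(a + b) < x + y →
    D x y (-x - 3 * y + κ)
  bD : ∀ c, x₀ ≤ x → x + y ≤ 0 → -c ≤ x + y → δ ≤ c → x + c ≤ -yw → c < a + b →
    Close Q x₀ c y → D x y (x - y + 2 * c + κ)
  bC : ∀ c y₂, 0 ≤ x + y → x₀ ≤ x → x + c ≤ -yw → y₂ ≤ y → y ≤ y₀ → y₂ ≤ -ω →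
    x + y ≤ max σ (-yw - c - ω) → δ ≤ c → c < a + b → Close Q x₀ c y →
    D x y (x - y₂ + 2 * c + κ)

namespace Pit

variable {a b β p χ₀ n₀ ω σ Ψ M Ω Δ X Y xa xr yr xw yw x₀ y₀ δ κ φ : ℝ}

theorem base (P : Pit Q D a b β p χ₀ n₀ ω σ Ψ M Ω Δ X Y xa xr yr xw yw x₀ y₀ δ κ φ) :
    ∀ x y, Q x y → Base Q D φ Δ M x y :=
  P.F.K.S.base P.φ0 P.ef (P.F.fe.mono P.F.K.S P.φ0)

theorem shallow (P : Pit Q D a b β p χ₀ n₀ ω σ Ψ M Ω Δ X Y xa xr yr xw yw x₀ y₀ δ κ φ)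
    {x y Δ' : ℝ} (hq : Q x y) (hx0 : 0 ≤ x) (hs : x + y ≤ 0) (hy : y₀ ≤ y) (hΔ : -Δ' ≤ x + y)
    (hΔ' : Δ' ≤ Δ) (h : ∀ u v, Q u v → 0 ≤ u → u + v ≤ 0 → y ≤ v → -Δ' ≤ u + v) :
    D x y (-2 * y + Δ' + κ - Δ + δ) := by
  have := P.F.M0
  have := P.F.MΨ
  have := P.φκ
  have := P.y₀Ω
  have := P.F.Ωω
  have := P.F.ω_lt
  have := P.F.χ
  have := P.F.σ0
  have := P.F.ω0
  refine P.F.K.S.mono ((P.base x y hq).zD (-y) σ Ψ Δ' M (-y) P.F.σ0 (by linarith) (by linarith)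
    P.F.M0 hx0 (by linarith) hs (P.F.riseLE (by linarith)) (P.F.heightLE.mono (by linarith))
    (P.F.leftLE σ)
    ?_ (rightLE_neg le_rfl) ?_ hΔ' le_rfl) (by linarith)
  · intro e f _ _ _ h3 h4
    exact ⟨by linarith, by linarith⟩
  · intro u v huv h1 h2 h3 _ e f _ _ _ h6 _
    linarith [h u v huv h1 h2 h3]

theorem near (P : Pit Q D a b β p χ₀ n₀ ω σ Ψ M Ω Δ X Y xa xr yr xw yw x₀ y₀ δ κ φ)
    {u v : ℝ} (hq : Q u v) (h1 : 0 ≤ u) (h2 : u + v ≤ 0) (hv : -ω ≤ v) :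
    -Ω ≤ v ∧ -Δ ≤ u + v :=
  P.F.hD u v hq h1 (by linarith) h2 hv

theorem shallow' (P : Pit Q D a b β p χ₀ n₀ ω σ Ψ M Ω Δ X Y xa xr yr xw yw x₀ y₀ δ κ φ)
    {x y : ℝ} (hq : Q x y) (hx0 : 0 ≤ x) (hs : x + y ≤ 0) (hy : y₀ ≤ y) :
    D x y (-2 * y + κ + δ) := by
  have hω : -ω ≤ y := by linarith [P.y₀Ω, P.F.Ωω]
  exact P.F.K.S.mono (P.shallow hq hx0 hs hy (P.near hq hx0 hs hω).2 le_rfl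
    fun u v huv h1 h2 h3 => (P.near huv h1 h2 (by linarith)).2) (by linarith)

theorem landingLE (P : Pit Q D a b β p χ₀ n₀ ω σ Ψ M Ω Δ X Y xa xr yr xw yw x₀ y₀ δ κ φ)
    {d : ℝ} (hd : d ≤ ω) (N X' : ℝ) : LandingLE Q D M d N (d + Δ + φ) X' := by
  intro u v u' v' huv hop' a' b' c e f g n₂ H₂ M₂ j1 j2 j3 j4 j5 j6 j7 j8
  have ⟨g1, g2, g3, g4⟩ := hop'
  have hΔ := (P.near g1 f g (by linarith)).2
  refine P.F.K.S.mono ((P.base u' v' g1).zD u' n₂ H₂ Δ M₂ (-v') j1 j3 P.F.Δ0 j4 f le_rfl g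
    j6 j7 j8 ?_ ?_ ?_ le_rfl j5) (by linarith)
  · intro e1 f1 hef k1 k2 k3 k4
    exact ⟨by linarith, by linarith⟩
  · rw [neg_neg]
    exact hop'.rightLE b'
  · intro e1 f1 h1 k1 k2 k3 k8 e2 f2 hef2 k4 k5 k6 k7
    linarith [(P.near h1 k1 k2 (by linarith)).2]

theorem cross (P : Pit Q D a b β p χ₀ n₀ ω σ Ψ M Ω Δ X Y xa xr yr xw yw x₀ y₀ δ κ φ)
    {x y x' y' : ℝ} (hq : Q x y) (hx0 : x ≤ 0) (hy0 : y ≤ 0) (hxa : -a < x)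
    (hs : -(a + b) < x + y) (hop : Hop0 Q x y x' y') (hy' : 0 ≤ y') (hs' : x' + y' ≤ 0)
    (st : ∀ c, D x' y' c → D x y (c + (x' + y' - (x + y)))) : D x y (-x - 3 * y + κ) := by
  have := P.F.K.hb
  have := P.F.K.hba
  have := P.F.W.hp
  have := P.F.W.p0
  have := P.F.W.β0
  have := P.neg_xw_lt
  have := P.w.s
  have := P.hκ
  rcases lt_or_ge y (-b) with h | h
  · rcases P.w.E x y hq h.le hs.le with h1 | h1
    · linarith
    · exact P.F.K.S.mono (P.F.K.reach_EF hop (by linarith) hy' hs' st) (by linarith)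
  · rcases P.F.W.empty x y hq hxa.le h with h1 | h1
    · linarith
    · exact (P.F.K.no_EF P.F.W hq hx0 hy0 (by linarith) (by linarith) hop hy' hs' st).elim

theorem κ_nonneg (P : Pit Q D a b β p χ₀ n₀ ω σ Ψ M Ω Δ X Y xa xr yr xw yw x₀ y₀ δ κ φ)  :
    0 ≤ κ := by
  linarith [P.F.σ0, P.F.M0, P.F.MΨ, P.φ0, P.φκ, P.δΔ]

theorem bound_E (P : Pit Q D a b β p χ₀ n₀ ω σ Ψ M Ω Δ X Y xa xr yr xw yw x₀ y₀ δ κ φ)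
    {x y : ℝ} (hq : Q x y)
    (ih : ∀ u v, Q u v → -v < -y → PitBound Q D a b ω σ yw x₀ y₀ δ κ u v)
    (hxy : (x ≤ x₀ ∧ y ≤ y₀) ∨ (x ≤ 0 ∧ y ≤ 0)) (hxa : -a < x) (hyw : yw ≤ y)
    (hs : -(a + b) < x + y) : D x y (-x - 3 * y + κ) := by
  have := P.κ_nonneg
  have := P.x₀0
  have := P.sum₀
  have := P.δ0
  have := P.y₀Ω
  have := P.F.Ωω
  rcases le_or_gt y y₀ with hy | hy
  · have hx : x ≤ x₀ := by rcases hxy with h | h <;> linarith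
    by_cases h0 : x₀ = x ∧ y₀ = y
    · obtain ⟨rfl, rfl⟩ := h0
      exact P.F.K.S.mono (P.shallow' hq P.x₀0 (by linarith) le_rfl) (by linarith)
    obtain ⟨x', y', hop, hw, st⟩ := P.F.K.S.step0 hq P.q₀ hx hy h0
    have ⟨hq', hx', hy', hT⟩ := hop
    have m := ih x' y' hq' (by linarith)
    rcases le_or_gt y' y₀ with h1 | h1
    · rcases le_or_gt x' x₀ with h2 | h2
      · exact P.F.K.S.mono (st _ (m.bE (Or.inl ⟨h2, h1⟩) (by linarith) (by linarith) (by linarith)))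
          (by linarith)
      · refine P.F.K.S.mono (st _ (m.bD (-(x' + y')) h2.le (by linarith) (by linarith) (by linarith)
          (by linarith) (by linarith) ?_)) (by linarith)
        intro u v huv h3 h4 h5
        rcases hT u v huv (by linarith) (by linarith) with h | h <;> linarith
    · rcases le_or_gt 0 x' with h2 | h2
      · exact P.F.K.S.mono (st _ (P.shallow' hq' h2 (by linarith) h1.le)) (by linarith)
      · rcases le_or_gt y' 0 with h3 | h3
        · exact P.F.K.S.mono (st _ (m.bE (Or.inr ⟨h2.le, h3⟩) (by linarith) (by linarith)
            (by linarith))) (by linarith)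
        · exact P.cross hq (by linarith) (by linarith [P.y₀b, P.F.K.hb]) hxa hs hop h3.le
            (by linarith) st
  · have ⟨hx0, hy0⟩ : x ≤ 0 ∧ y ≤ 0 := by
      rcases hxy with h | h
      · linarith
      · exact h
    by_cases h0 : (0 : ℝ) = x ∧ (0 : ℝ) = y
    · obtain ⟨rfl, rfl⟩ := h0
      exact P.F.K.S.mono P.F.K.S.zero (by linarith)
    obtain ⟨x', y', hop, hw, st⟩ := P.F.K.S.step0 hq P.F.K.S.origin hx0 hy0 h0
    have ⟨hq', hx', hy', hT⟩ := hop
    have m := ih x' y' hq' (by linarith)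
    rcases le_or_gt y' 0 with h3 | h3
    · rcases le_or_gt x' 0 with h2 | h2
      · exact P.F.K.S.mono (st _ (m.bE (Or.inr ⟨h2, h3⟩) (by linarith) (by linarith)
            (by linarith))) (by linarith)
      · have hn := (P.near hq' h2.le (by linarith) (by linarith)).2
        refine P.F.K.S.mono (st _ (P.shallow (Δ' := -(x' + y')) hq' h2.le (by linarith)
          (by linarith) (by linarith) (by linarith) ?_)) (by linarith [P.δΔ])
        intro u v huv h4 h5 h6
        rcases hT u v huv (by linarith) (by linarith) with h | h <;> linarith
    · exact P.cross hq hx0 hy0 hxa hs hop h3.le (by linarith) st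

theorem land_C (P : Pit Q D a b β p χ₀ n₀ ω σ Ψ M Ω Δ X Y xa xr yr xw yw x₀ y₀ δ κ φ)
    {x y x' y' c : ℝ} (ih : ∀ u v, Q u v → -v < -y → PitBound Q D a b ω σ yw x₀ y₀ δ κ u v)
    (hs : x + y ≤ 0) (hc : δ ≤ c) (hxc : x + c ≤ -yw) (hcab : c < a + b)
    (hJ : Close Q x₀ c y) (hop : Hop1 Q x y x' y') (hyy : y < y') (hx0 : 0 ≤ x') (hy0 : y' ≤ 0)
    (hs' : 0 ≤ x' + y') : D x' y' (x - y' + 2 * c + κ) := by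
  have ⟨hq', hx', _, hT⟩ := hop
  have := P.F.M0
  have := P.F.MΨ
  have := P.φκ
  have := P.y₀Ω
  have := P.sum₀
  have := P.δ0
  have := P.φ0
  have := P.F.Ωω
  have := P.F.ω_lt
  have := P.F.χ
  have := P.F.σ0
  have := P.F.ω0
  have := P.F.Y0
  have key : x' ≤ X ∨ y' ≤ -ω := by
    by_contra! h
    rcases hT _ _ P.F.hop.1 (by linarith) (by linarith) with h1 | h1 <;> linarith
  have hσ : x' ≤ X → x' + y' ≤ σ := by
    intro h
    rcases P.F.hop.2.2.2 x' y' hq' h (by linarith) with h5 | h5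
    · have := (P.F.K.S.gp hq' P.F.K.S.origin (Or.inr (Or.inl (by linarith)))).1
      linarith
    · linarith
  rcases lt_or_ge (-ω) y' with h | h
  · have hxX : x' ≤ X := by rcases key with h | h <;> linarith
    exact P.F.K.S.mono ((P.F.K.S.turn (P.F.fe.mono P.F.K.S P.φ0) (d := -y') (N := σ)
      (T := -y' + Δ + φ) (by linarith [P.F.Δ0]) (by linarith [P.F.Δ0]) x' y' hq').zC σ Ψ M
      (by linarith) P.F.M0 hx0 hy0 hs' (hσ hxX) le_rfl (P.F.riseLE hxX)
      (P.F.heightLE.mono (by linarith))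
      (hop.dropLE hx0 hs) (by linarith) (P.landingLE (by linarith) σ x') (P.F.leftLE σ) le_rfl)
      (by linarith)
  · refine P.F.K.S.mono ((ih x' y' hq' (by linarith)).bC c y' hs' (by linarith) (by linarith)
      le_rfl (by linarith) h ?_ hc hcab (hJ.mono hyy.le)) (by linarith)
    rcases le_total x' X with h1 | h1
    · exact (hσ h1).trans (le_max_left _ _)
    · exact le_trans (by linarith) (le_max_right _ _)

theorem bound_D (P : Pit Q D a b β p χ₀ n₀ ω σ Ψ M Ω Δ X Y xa xr yr xw yw x₀ y₀ δ κ φ)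
    {x y : ℝ} (hq : Q x y)
    (ih : ∀ u v, Q u v → -v < -y → PitBound Q D a b ω σ yw x₀ y₀ δ κ u v)
    {c : ℝ} (hx : x₀ ≤ x) (hs : x + y ≤ 0) (hsc : -c ≤ x + y) (hc : δ ≤ c) (hxc : x + c ≤ -yw)
    (hcab : c < a + b) (hJ : Close Q x₀ c y) : D x y (x - y + 2 * c + κ) := by
  have := P.κ_nonneg
  have := P.x₀0
  have := P.sum₀
  have := P.δ0
  have := P.y₀b
  have := P.y₀Ω
  have := P.F.Ωω
  have := P.F.χA
  have := P.F.χ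
  have := P.F.σ0
  have := P.F.M0
  have := P.F.MΨ
  have := P.F.W.p0
  have := P.F.W.β0
  have := P.F.K.hb
  rcases le_or_gt (x + y) (x₀ + y₀) with hr | hr
  · by_cases h0 : x₀ = x ∧ y₀ = y
    · obtain ⟨rfl, rfl⟩ := h0
      exact P.F.K.S.mono (P.shallow' hq P.x₀0 (by linarith) le_rfl) (by linarith)
    obtain ⟨x', y', hop, hw, st⟩ := P.F.K.S.step1 hq P.q₀ hx hr h0
    have ⟨hq', hx', hs', hT⟩ := hop
    have m := ih x' y' hq' (by linarith)
    rcases le_or_gt x₀ x' with h1 | h1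
    · rcases le_or_gt (x' + y') 0 with h2 | h2
      · exact P.F.K.S.mono (st _ (m.bD c h1 h2 (by linarith) hc (by linarith) hcab
          (hJ.mono (by linarith)))) (by linarith)
      · exact P.F.K.S.mono (st _ (P.land_C ih hs hc hxc hcab hJ hop (by linarith) (by linarith)
          (by linarith) h2.le)) (by linarith)
    · exact P.F.K.S.mono (st _ (m.bE (Or.inl ⟨h1.le, hw⟩) (by linarith) (by linarith)
        (by linarith))) (by linarith)
  · by_cases h0 : (0 : ℝ) = x ∧ (0 : ℝ) = y
    · obtain ⟨rfl, rfl⟩ := h0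
      exact P.F.K.S.mono P.F.K.S.zero (by linarith)
    obtain ⟨x', y', hop, hw, st⟩ := P.F.K.S.step1 hq P.F.K.S.origin (by linarith) (by linarith) h0
    have ⟨hq', hx', hs', hT⟩ := hop
    have m := ih x' y' hq' (by linarith)
    rcases le_or_gt (x' + y') 0 with h2 | h2
    · rcases le_or_gt x₀ x' with h1 | h1
      · exact P.F.K.S.mono (st _ (m.bD c h1 h2 (by linarith) hc (by linarith) hcab
          (hJ.mono (by linarith)))) (by linarith)
      · rcases le_or_gt 0 x' with h3 | h3
        · exact P.F.K.S.mono (st _ (P.shallow' hq' h3 h2 (by linarith))) (by linarith)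
        · exact P.F.K.S.mono (st _ (m.bE (Or.inr ⟨h3.le, hw⟩) (by linarith [P.F.ω0]) (by linarith)
            (by linarith))) (by linarith)
    · exact P.F.K.S.mono (st _ (P.land_C ih hs hc hxc hcab hJ hop (by linarith) (by linarith)
        (by linarith) h2.le)) (by linarith)

theorem bound_C (P : Pit Q D a b β p χ₀ n₀ ω σ Ψ M Ω Δ X Y xa xr yr xw yw x₀ y₀ δ κ φ)
    {x y : ℝ} (hq : Q x y)
    (ih : ∀ u v, Q u v → -v < -y → PitBound Q D a b ω σ yw x₀ y₀ δ κ u v)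
    {c y₂ : ℝ} (hs : 0 ≤ x + y) (hx : x₀ ≤ x) (hxc : x + c ≤ -yw) (hy₂ : y₂ ≤ y) (hy : y ≤ y₀)
    (hω : y₂ ≤ -ω) (hn : x + y ≤ max σ (-yw - c - ω)) (hc : δ ≤ c) (hcab : c < a + b)
    (hJ : Close Q x₀ c y) : D x y (x - y₂ + 2 * c + κ) := by
  have := P.κ_nonneg
  have := P.hκ
  have := P.x₀0
  have := P.sum₀
  have := P.δ0
  have := P.y₀b
  have := P.y₀Ω
  have := P.F.Ωω
  have := P.F.χA
  have := P.F.big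
  have := P.F.χ
  have := P.F.σ0
  have := P.F.ω0
  have := P.F.Δ0
  have := P.F.M0
  have := P.F.MΨ
  have := P.F.W.p0
  have := P.F.W.β0
  have := P.F.K.hb
  have := P.w.s
  have := P.hw
  have := P.φ0
  have := P.φw
  have := P.φκ
  have := P.F.ω_lt
  have := P.F.Y0
  have h0 : ¬(x₀ = x ∧ y₀ = y) := by
    rintro ⟨rfl, rfl⟩
    have := P.F.K.S.gp P.F.K.S.origin hq (Or.inr (Or.inr (by linarith)))
    linarith [this.2]
  obtain ⟨x', y', hop, hw, st⟩ := P.F.K.S.step2 hq P.q₀ hy (by linarith) h0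
  have ⟨hq', hy', hs', hT⟩ := hop
  have m := ih x' y' hq' (by linarith)
  rcases le_or_gt y' y₀ with h1 | h1
  · rcases le_or_gt (x' + y') 0 with h2 | h2
    · exact P.F.K.S.mono (st _ (m.bD c hw h2 (hJ x' y' hq' hw hy'.le h2) hc (by linarith) hcab
        (hJ.mono hy'.le))) (by linarith)
    · exact P.F.K.S.mono (st _ (m.bC c y₂ h2.le hw (by linarith) (by linarith) h1 hω
        (by linarith) hc hcab (hJ.mono hy'.le))) (by linarith)
  rcases le_or_gt (x' + y') 0 with h2 | h2
  · have := hJ x' y' hq' hw hy'.le h2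
    exact P.F.K.S.mono (st _ (P.shallow' hq' (by linarith) h2 h1.le)) (by linarith)
  set n := max σ (-yw - c - ω) with hndef
  have hn1 : σ ≤ n := le_max_left _ _
  have hn2 : -yw - c - ω ≤ n := le_max_right _ _
  have hnχ : n ≤ χ₀ := max_le (by linarith) (by rcases P.hδ with h | h <;> linarith)
  have hcost : n + Ψ + M + (ω + Δ + φ) ≤ -y₂ + 2 * c + κ := by
    rcases max_choice σ (-yw - c - ω) with h | h
    · rw [hndef, h]
      linarith
    · rw [hndef, h]
      rcases P.hδ with h | h <;> linarith
  have t := P.F.K.S.turn (P.F.fe.mono P.F.K.S P.φ0) (d := ω) (N := n)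
      (T := ω + Δ + φ) (by linarith) (by linarith) x' y' hq'
  have hi1 : RiseLE Q n x' := by
    intro u v u' v' huv hop' q1 q2 q3 q4 q5
    have ⟨g1, g2, g3, g4⟩ := hop'
    rcases le_or_gt u' X with h3 | h3
    · rcases P.F.hop.2.2.2 u' v' g1 h3 (by linarith) with h5 | h5
      · have := (P.F.K.S.gp g1 P.F.K.S.origin (Or.inr (Or.inl (by linarith)))).1
        linarith
      · linarith
    · rcases g4 _ _ P.F.hop.1 (by linarith) (by linarith) with h5 | h5 <;> linarith
  rcases le_or_gt y' 0 with h3 | h3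
  · exact P.F.K.S.mono (st _ (t.zC n Ψ M (by linarith) P.F.M0 (by linarith) h3 h2.le (by linarith)
      le_rfl hi1 (P.F.heightLE.mono hnχ) (P.F.dropLE.mono ((min_le_right _ _).trans hnχ))
      (by linarith)
      (P.landingLE le_rfl n x') (P.F.leftLE n) le_rfl)) (by linarith)
  · refine P.F.K.S.mono (st _ (t.zB x' Ψ M P.F.M0 (by linarith) h3.le le_rfl
      (P.F.heightLE x' y' hq' (by linarith) (by linarith)) (by linarith) ?_
      (P.F.heightLE.mono (by linarith))
      (P.F.dropLE.mono (by linarith)) (P.landingLE le_rfl n x') (P.F.leftLE _) le_rfl))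
      (by linarith)
    intro u v huv a b
    rcases hT u v huv (by linarith) (by linarith) with h | h <;> linarith

theorem bound (P : Pit Q D a b β p χ₀ n₀ ω σ Ψ M Ω Δ X Y xa xr yr xw yw x₀ y₀ δ κ φ) :
    ∀ x y, Q x y → PitBound Q D a b ω σ yw x₀ y₀ δ κ x y :=
  P.F.K.S.induct (fun _ y => -y) fun _ _ hq ih =>
    ⟨P.bound_E hq ih, fun _ => P.bound_D hq ih, fun _ _ => P.bound_C hq ih⟩

theorem false (P : Pit Q D a b β p χ₀ n₀ ω σ Ψ M Ω Δ X Y xa xr yr xw yw x₀ y₀ δ κ φ) : False := by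
  have := P.w.y
  have := P.w.s
  have := P.hκ
  have := P.F.K.hb
  have h1 : -a < xw := by
    rcases P.w.E xw yw P.w.q (by linarith) (by linarith) with h | h <;> linarith
  exact P.F.K.bad (P.F.K.S.mono (P.w.st _ ((P.bound xw yw P.w.q).bE
    (Or.inr ⟨P.hw.le, by linarith⟩) h1 le_rfl P.w.s)) (by linarith))

end Pit

namespace Cfg

variable {a b β p χ₀ n₀ ω σ Ψ M Ω Δ X Y xa xr yr : ℝ}

theorem neg_xw_lt (F : Cfg Q D a b β p χ₀ n₀ ω σ Ψ M Ω Δ X Y xa xr yr) {xw yw : ℝ}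
    (w : Side Q D a b Ω xw yw) (_hw : xw < 0) (_hxa : -a < xw) : 7 * (-xw) < 2 * a + 5 * b := by
  by_contra! h
  have := F.K.hb
  have := F.K.hba
  have := w.y
  have := w.s
  refine F.K.bad (F.K.S.mono (w.st (4 * a + 5 / 2 * b - xw) (F.K.reach w.q ?_ ?_)) (by linarith))
  · apply hx_lt <;> linarith
  · apply tx_le <;> linarith

theorem false_of_left (F : Cfg Q D a b β p χ₀ n₀ ω σ Ψ M Ω Δ X Y xa xr yr) {xw yw : ℝ}
    (w : Side Q D a b Ω xw yw) (hw : xw < 0) : False := by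
  have := F.K.hb
  have := F.K.hba
  have := w.y
  have := w.s
  have := F.W.p0
  have := F.W.β0
  have := F.W.hp
  have := F.χA
  have := F.χ
  have := F.σ0
  have := F.M0
  have := F.MΨ
  have := F.Ωω
  have := F.ΔΩ
  have := F.Ω_lt
  have hxa : -a < xw := by linarith
  have wb := F.neg_xw_lt w hw hxa
  obtain ⟨x₀, y₀, δ, q₀, h1, h2, h3, h4, h5, h6, h7⟩ : ∃ x₀ y₀ δ, Q x₀ y₀ ∧ 0 ≤ x₀ ∧ y₀ < -b ∧
      -Ω ≤ y₀ ∧ x₀ + y₀ = -δ ∧ 0 ≤ δ ∧ δ ≤ Δ ∧ (Δ = δ ∨ Δ ≤ β) := by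
    rcases lt_or_ge yr (-b) with h | h
    · exact ⟨xr, yr, Δ, F.qr, F.xr0, h,
        (F.hD _ _ F.qr F.xr0 F.yr0 (by linarith [F.Δ0, F.hr]) F.yrω).1, F.hr, F.Δ0, le_rfl,
        Or.inl rfl⟩
    · have h1 := (F.hD _ _ F.qa F.xa0 (by linarith) (by linarith [F.xaΩ]) (by linarith)).2
      refine ⟨xa, -Ω, Ω - xa, F.qa, F.xa0, by linarith, le_rfl, by ring, by linarith [F.xaΩ],
        by linarith, Or.inr ?_⟩
      rcases F.W.empty xr yr F.qr (by linarith [F.xr0]) h with h5 | h5 <;> linarith [F.hr]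
  have hφ0 : 0 ≤ (4 * a + 5 / 2 * b + 3 * yw) - Δ + δ - σ - Ψ - M := by
    rcases h7 with h | h <;> linarith
  refine Pit.false (φ := min (4 * (-xw)) ((4 * a + 5 / 2 * b + 3 * yw) - Δ + δ - σ - Ψ - M))
    ⟨F, w, hw, rfl, q₀, h1, h2, h3, h4, h5, h6, h7, wb, le_min (by linarith) hφ0, min_le_left _ _,
      by linarith [min_le_right (4 * (-xw)) ((4 * a + 5 / 2 * b + 3 * yw) - Δ + δ - σ - Ψ - M)],
      ?_⟩
  intro x y x' y' hq hx0 hy0 hL hop hy' hs st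
  rcases le_or_gt (-b) y with hb' | hb'
  · rcases F.W.empty x y hq (by linarith) hb' with h | h
    · linarith
    · exact (F.K.no_EF F.W hq hx0 hy0 (by linarith) (by linarith) hop hy' hs st).elim
  · have hxw : xw ≤ x := by
      rcases w.E x y hq hb'.le (by linarith) with h | h <;> linarith
    rcases le_or_gt x y with h | h
    · exact (F.K.kill_steep hq h hy0 (by linarith) (by linarith) (by linarith) (by linarith)
        (by linarith) (by linarith)).elim
    · refine F.K.S.mono (F.K.reach_EF hop (by linarith) hy' hs st) ?_
      have : -5 * x + y ≤ min (4 * (-xw)) ((4 * a + 5 / 2 * b + 3 * yw) - Δ + δ - σ - Ψ - M) := by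
        refine le_min (by linarith) ?_
        rcases h7 with h | h <;> linarith
      linarith

theorem false (F : Cfg Q D a b β p χ₀ n₀ ω σ Ψ M Ω Δ X Y xa xr yr) : False := by
  obtain ⟨xw, yw, w⟩ := F.side
  rcases lt_or_ge xw 0 with hw | hw
  · exact F.false_of_left w hw
  by_cases hex : ∃ u v, Q u v ∧ u < -a ∧ -b ≤ v ∧ v ≤ 0 ∧ xw + yw ≤ u + v
  · exact F.false_of_detour w hw hex
  · refine F.false_of_simple w hw fun u v h1 h2 h3 h4 => ?_
    by_contra! h5
    exact hex ⟨u, v, h1, h2, h3, h4, h5⟩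

end Cfg

theorem Sys.landingLE (S : Sys Q D) {φ M ω Ω Δ : ℝ} (hφ : 0 ≤ φ) (fe : ChargeFE Q D φ M)
    (ef : ChargeEF Q D φ Δ)
    (hΔ : 0 ≤ Δ) (hD : ∀ u v, Q u v → 0 ≤ u → v ≤ 0 → u + v ≤ 0 → -ω ≤ v → -Ω ≤ v ∧ -Δ ≤ u + v)
    (N X : ℝ) : LandingLE Q D M ω N (Ω + Δ + φ) X := by
  intro u v u' v' huv hop a' b' c e f g n₂ H₂ M₂ j1 j2 j3 j4 j5 j6 j7 j8
  have ⟨g1, g2, g3, g4⟩ := hop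
  have ⟨h1, h2⟩ := hD u' v' g1 f (by linarith) g (by linarith)
  refine S.mono ((S.base (L := Δ) hφ ef fe u' v' g1).zD u' n₂ H₂ Δ M₂ (-v') j1 j3 hΔ j4 f le_rfl
    g j6 j7 j8 ?_ ?_ ?_ le_rfl j5) (by linarith)
  · intro e1 f1 hef k1 k2 k3 k4
    exact ⟨by linarith, by linarith⟩
  · rw [neg_neg]
    exact hop.rightLE b'
  · intro e1 f1 hef k1 k2 k3 k8 e2 f2 hef2 k4 k5 k6 k7
    linarith [(hD e1 f1 hef k1 (by linarith) k2 (by linarith)).2]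

theorem Counterexample.land {a b β p xB yB χ₀ y₀ Ψ z α : ℝ} (K : Counterexample Q D a b)
    (W : FirstStep Q a b β p)
    (C : UpperHop Q (a - p - β) xB yB χ₀ y₀ Ψ z α) :
    D χ₀ y₀ (χ₀ + y₀ + Ψ + 2 * α + (a - p - β) + (4 * β + 3 / 2 * b + p)) := by
  have ⟨hq₀, hxB, hyB, _⟩ := C.hop
  have := K.hb
  have := K.hba
  have := W.hp
  have := W.p0
  have := W.β0
  have := C.xB0
  have := C.yB0
  have := C.y0
  have := C.s0
  have := C.yΨ
  have := C.xz
  have := C.zα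
  have := C.α0
  obtain ⟨g₁, g₂, hg, ⟨hg0, hgs, hgχ, X, Y, hop, hX0, hY0⟩, hgmax⟩ :=
    K.S.exists_max (fun _ v => -v) (R := fun u v => v ≤ 0 ∧ 0 ≤ u + v ∧ u ≤ χ₀ ∧
      ∃ X Y, Hop3 Q X Y u v ∧ 0 ≤ X ∧ 0 ≤ Y) hq₀
      ⟨C.y0, C.s0, le_rfl, xB, yB, C.hop, C.xB0, C.yB0⟩
  have hω₀ := hgmax χ₀ y₀ hq₀ ⟨C.y0, C.s0, le_rfl, xB, yB, C.hop, C.xB0, C.yB0⟩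
  obtain ⟨ω, rfl⟩ : ∃ ω, g₂ = -ω := ⟨-g₂, (neg_neg _).symm⟩
  obtain ⟨σ, rfl⟩ : ∃ σ, g₁ = σ + ω := ⟨g₁ - ω, by ring⟩
  have i3 : DropLE Q ω χ₀ := by
    intro x y x' y' _ hop' h1 h2 h3 h4 h5
    have := hgmax x' y' hop'.1 ⟨h4, h5, by linarith [hop'.2.1], x, y, hop', h1, h2⟩
    linarith
  obtain ⟨xa, ya, qa, ⟨xa0, ya0, sa, yaω⟩, hamax⟩ :=
    K.S.exists_max (fun _ v => -v) (R := fun u v => 0 ≤ u ∧ v ≤ 0 ∧ u + v ≤ 0 ∧ -ω ≤ v)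
      K.S.origin ⟨le_rfl, le_rfl, by linarith, by linarith⟩
  obtain ⟨xr, yr, qr, ⟨xr0, yr0, sr, yrω⟩, hrmax⟩ :=
    K.S.exists_max (fun u v => -(u + v)) (R := fun u v => 0 ≤ u ∧ v ≤ 0 ∧ u + v ≤ 0 ∧ -ω ≤ v)
      K.S.origin ⟨le_rfl, le_rfl, by linarith, by linarith⟩
  obtain ⟨Ω, rfl⟩ : ∃ Ω, ya = -Ω := ⟨-ya, (neg_neg _).symm⟩
  obtain ⟨Δ, hr⟩ : ∃ Δ, xr + yr = -Δ := ⟨-(xr + yr), (neg_neg _).symm⟩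
  have hD : ∀ u v, Q u v → 0 ≤ u → v ≤ 0 → u + v ≤ 0 → -ω ≤ v → -Ω ≤ v ∧ -Δ ≤ u + v := by
    intro u v huv h1 h2 h3 h4
    have e1 := hamax u v huv ⟨h1, h2, h3, h4⟩
    have e2 := hrmax u v huv ⟨h1, h2, h3, h4⟩
    constructor <;> linarith
  have hrΩ := (hD xr yr qr xr0 yr0 sr yrω).1
  have hM0 : 0 ≤ min α Ψ := le_min (by linarith) (by linarith)
  have hMα : min α Ψ ≤ α := min_le_left _ _
  have hMΨ : min α Ψ ≤ Ψ := min_le_right _ _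
  have iA : ∀ n, LeftLE Q (min α Ψ) n Ψ := by
    intro n u v huv h1 h2 _ h4
    rw [neg_le]
    exact le_min (by linarith [C.westLE u v huv h1 h2 h4]) (by linarith)
  have run : ∀ φ T, ChargeFE Q D φ (min α Ψ) → φ ≤ T → 0 ≤ T →
      T ≤ a - χ₀ + 2 * α - min α Ψ + 3 * β + 3 / 2 * b →
      LandingLE Q D (min α Ψ) ω (χ₀ + y₀) T χ₀ →
      D χ₀ y₀ (χ₀ + y₀ + Ψ + 2 * α + (a - p - β) + (4 * β + 3 / 2 * b + p)) := by
    intro φ T fe hφT hT hTa i4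
    refine K.S.mono ((K.S.turn fe (d := ω) (N := χ₀ + y₀) (T := T) (by linarith) (by linarith)
      χ₀ y₀ hq₀).zC (χ₀ + y₀) Ψ (min α Ψ) (by linarith) hM0 (by linarith) C.y0 C.s0 le_rfl le_rfl
      ?_ (C.heightLE.mono (by linarith)) (i3.mono (min_le_left _ _)) (by linarith) i4 (iA _) le_rfl)
      (by linarith)
    intro x y x' y' _ hop' h1 h2 h3 h4 h5
    have := hop'.2.1
    rcases C.hop.2.2.2 x' y' hop'.1 (by linarith) (by linarith) with h | h <;> linarith
  rcases lt_or_ge (5 * (a - b)) (7 * min α Ψ) with hM | hM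
  · have hΔβ : Δ ≤ β := by
      rcases W.empty xr yr qr (by linarith) (by linarith) with h | h <;> linarith
    exact run _ _ (K.chargeFE_large W (by linarith) le_rfl) (by linarith) (by linarith)
      (by linarith)
      (K.S.landingLE (by linarith) (K.chargeFE_large W (by linarith) le_rfl)
        (K.ef W (by linarith) (by linarith)) (by linarith) hD _ _)
  have fe : ChargeFE Q D 0 (min α Ψ) := K.chargeFE_small W (by linarith) hM
  rcases le_or_gt (Ω + Δ) (a - χ₀ + β + 3 / 2 * b) with h | h
  · exact run 0 (Ω + Δ + 0) fe (by linarith) (by linarith) (by linarith)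
      (K.S.landingLE le_rfl fe (K.ef W (by linarith) (by linarith)) (by linarith) hD _ _)
  by_contra hn
  exact Cfg.false (n₀ := χ₀ + y₀) ⟨K, W, by linarith, hM0, hMΨ, fe, hX0, hY0, hop,
    hgs.trans_eq (by ring),
    by linarith, hgχ, i3, C.heightLE.mono (by linarith), iA, hD, qa, xa0, by linarith, qr, xr0,
    yr0, yrω,
    hr, by linarith, by linarith, by linarith, h,
    fun T hT hTa i4 => hn (run 0 T fe hT hT (by linarith) i4)⟩

theorem Sys.core (S : Sys Q D) {a b : ℝ} (q : Q (-a) (-b)) (hb : 0 < b) (hba : b ≤ a)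
    (ih : ∀ x y, Q x y → hx x y < a + b → D x y (5 * tx x y))
    (ihp : ∀ x y x' y' c, Q x y → Q x' y' → hx (x' - x) (y' - y) < a + b → D x' y' c →
      D x y (5 * tx (x' - x) (y' - y) + c)) : D (-a) (-b) (5 * a + 5 / 2 * b) := by
  by_contra bad
  have K : Counterexample Q D a b := ⟨S, q, hb, hba, ih, ihp, bad⟩
  obtain ⟨v₁, v₂, hop, hw, st⟩ := S.step0 q S.origin (by linarith) (by linarith)
    (fun h => by linarith [h.2])
  have ⟨hq, h1, h2, hT⟩ := hop
  have hp : 10 * (v₁ + a) + 7 * (-(v₁ + v₂)) ≤ 2 * a - 3 * b := by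
    by_contra! hlt
    refine bad (S.mono (st (4 * a + 3 / 2 * b - (v₁ + v₂)) (K.reach hq ?_ ?_)) (by linarith))
    · apply hx_lt <;> linarith
    · apply tx_le <;> linarith
  have W : FirstStep Q a b (-(v₁ + v₂)) (v₁ + a) :=
    ⟨fun u v huv h3 h4 => by rcases hT u v huv h3 h4 with h | h <;> [left; right] <;> linarith,
      by linarith, by linarith, hp⟩
  exact bad (S.mono (st _ ((S.upper ih W.empty hb W.β0 (a0 := a - (v₁ + a) - (-(v₁ + v₂)))
    (c := 4 * (-(v₁ + v₂)) + 3 / 2 * b + (v₁ + a)) (by linarith) (by linarith) (by linarith)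
    (fun _ _ _ _ _ _ _ C => K.land W C) v₁ v₂ hq).zF (by linarith) (by linarith) (by linarith)
    (by linarith) (by linarith))) (by linarith))

theorem hx_swap (x y : ℝ) : hx y x = hx x y := by
  simp only [hx, add_comm y x]
  exact max_left_comm _ _ _

theorem hx_rot (x y : ℝ) : hx (-y) (x + y) = hx x y := by
  simp only [hx, abs_neg, neg_add_cancel_comm_assoc, max_comm |x + y|, max_left_comm |y|]

theorem tx_swap (x y : ℝ) : tx y x = tx x y := by
  simp only [tx, abs_sub_comm y x, abs_div, add_comm y, add_comm (y / 2)]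
  exact max_left_comm _ _ _

theorem tx_rot (x y : ℝ) : tx (-y) (x + y) = tx x y := by
  have h1 : |-y + (x + y) / 2| = |(x - y) / 2| := by ring_nf
  have h2 : |-y / 2 + (x + y)| = |x + y / 2| := by ring_nf
  have h3 : |(-y - (x + y)) / 2| = |x / 2 + y| := by
    rw [← abs_neg]
    ring_nf
  simp only [tx, h1, h2, h3]
  rw [max_left_comm, max_comm |(x - y) / 2|]

theorem Sys.swap (S : Sys Q D) : Sys (fun x y => Q y x) (fun x y c => D y x c) where
  fin := (S.fin.preimage (Prod.swap_injective.injOn)).subset fun _ h => h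
  mono := S.mono
  zero := S.zero
  origin := S.origin
  gp := fun h1 h2 h => (S.gp h1 h2 (by
    rcases h with h | h | h
    · exact Or.inr (Or.inl h)
    · exact Or.inl h
    · exact Or.inr (Or.inr (by linarith)))).symm
  step0 := fun {x y u v} h1 h2 h3 h4 h0 => by
    obtain ⟨x', y', ⟨g1, g2, g3, g4⟩, hw, st⟩ := S.step0 h1 h2 h4 h3 (fun h => h0 h.symm)
    refine ⟨y', x', ⟨g1, g3, g2, fun u v a b c => ?_⟩, by linarith, fun c hc =>
      S.mono (st c hc) (by linarith)⟩
    rcases g4 _ _ a c b with h | h <;> [left; right] <;> linarith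
  step1 := fun {x y u v} h1 h2 h3 h4 h0 => by
    obtain ⟨x', y', ⟨g1, g2, g3, g4⟩, hw, st⟩ := S.step5 h1 h2 h3 (by linarith) (fun h => h0 h.symm)
    refine ⟨y', x', ⟨g1, g2, by linarith, fun u v a b c => g4 _ _ a b (by linarith)⟩, hw, st⟩
  step2 := fun {x y u v} h1 h2 h3 h4 h0 => by
    obtain ⟨x', y', ⟨g1, g2, g3, g4⟩, hw, st⟩ := S.step4 h1 h2 h3 (by linarith) (fun h => h0 h.symm)
    refine ⟨y', x', ⟨g1, g2, by linarith, fun u v a b c => g4 _ _ a b (by linarith)⟩, hw, st⟩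
  step3 := fun {x y u v} h1 h2 h3 h4 h0 => by
    obtain ⟨x', y', ⟨g1, g2, g3, g4⟩, hw, st⟩ := S.step3 h1 h2 h4 h3 (fun h => h0 h.symm)
    refine ⟨y', x', ⟨g1, g3, g2, fun u v a b c => ?_⟩, by linarith, fun c hc =>
      S.mono (st c hc) (by linarith)⟩
    rcases g4 _ _ a c b with h | h <;> [left; right] <;> linarith
  step4 := fun {x y u v} h1 h2 h3 h4 h0 => by
    obtain ⟨x', y', ⟨g1, g2, g3, g4⟩, hw, st⟩ := S.step2 h1 h2 h3 (by linarith) (fun h => h0 h.symm)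
    refine ⟨y', x', ⟨g1, g2, by linarith, fun u v a b c => g4 _ _ a b (by linarith)⟩, hw, st⟩
  step5 := fun {x y u v} h1 h2 h3 h4 h0 => by
    obtain ⟨x', y', ⟨g1, g2, g3, g4⟩, hw, st⟩ := S.step1 h1 h2 h3 (by linarith) (fun h => h0 h.symm)
    refine ⟨y', x', ⟨g1, g2, by linarith, fun u v a b c => g4 _ _ a b (by linarith)⟩, hw, st⟩

theorem Sys.rotate (S : Sys Q D) :
    Sys (fun x y => Q (x + y) (-x)) (fun x y c => D (x + y) (-x) c) := by
  have back : ∀ {x y}, Q x y → Q (-y + (x + y)) (- -y) := fun {x y} h => by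
    simpa only [neg_add_cancel_comm_assoc, neg_neg] using h
  have backD : ∀ {x y c}, D (-y + (x + y)) (- -y) c → D x y c := fun {x y c} h => by
    simpa only [neg_add_cancel_comm_assoc, neg_neg] using h
  have ne : ∀ {x y u v : ℝ}, ¬(u = x ∧ v = y) → ¬(u + v = x + y ∧ -u = -x) := by
    rintro x y u v h ⟨h1, h2⟩
    exact h ⟨by linarith, by linarith⟩
  constructor
  · refine (S.fin.preimage (f := fun p : ℝ × ℝ => (p.1 + p.2, -p.1)) ?_).subset fun _ h => h
    intro p _ q _ h
    simp only [Prod.mk.injEq, neg_inj] at h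
    exact Prod.ext h.2 (by linarith)
  · exact S.mono
  · simpa only [add_zero, neg_zero] using S.zero
  · simpa only [add_zero, neg_zero] using S.origin
  · intro x y u v h1 h2 h
    have := S.gp h1 h2 (by
      rcases h with h | h | h
      · exact Or.inr (Or.inl (by linarith))
      · exact Or.inr (Or.inr (by linarith))
      · exact Or.inl h)
    constructor <;> linarith
  · intro x y u v h1 h2 h3 h4 h0
    obtain ⟨x', y', ⟨g1, g2, g3, g4⟩, hw, st⟩ := S.step5 h1 h2 (by linarith) (by linarith) (ne h0)
    refine ⟨-y', x' + y', ⟨back g1, by linarith, by linarith, fun u v a b c => ?_⟩, by linarith,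
      fun c hc => S.mono (st c (backD hc)) (by linarith)⟩
    rcases g4 _ _ a (by linarith) (by linarith) with h | h <;> [left; right] <;> linarith
  · intro x y u v h1 h2 h3 h4 h0
    obtain ⟨x', y', ⟨g1, g2, g3, g4⟩, hw, st⟩ := S.step0 h1 h2 (by linarith) (by linarith) (ne h0)
    refine ⟨-y', x' + y', ⟨back g1, by linarith, by linarith, fun u v a b c => ?_⟩, by linarith,
      fun c hc => S.mono (st c (backD hc)) (by linarith)⟩
    rcases g4 _ _ a (by linarith) (by linarith) with h | h <;> [left; right] <;> linarith
  · intro x y u v h1 h2 h3 h4 h0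
    obtain ⟨x', y', ⟨g1, g2, g3, g4⟩, hw, st⟩ := S.step1 h1 h2 (by linarith) (by linarith) (ne h0)
    refine ⟨-y', x' + y', ⟨back g1, by linarith, by linarith, fun u v a b c => ?_⟩, by linarith,
      fun c hc => S.mono (st c (backD hc)) (by linarith)⟩
    rcases g4 _ _ a (by linarith) (by linarith) with h | h <;> [left; right] <;> linarith
  · intro x y u v h1 h2 h3 h4 h0
    obtain ⟨x', y', ⟨g1, g2, g3, g4⟩, hw, st⟩ := S.step2 h1 h2 (by linarith) (by linarith) (ne h0)
    refine ⟨-y', x' + y', ⟨back g1, by linarith, by linarith, fun u v a b c => ?_⟩, by linarith,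
      fun c hc => S.mono (st c (backD hc)) (by linarith)⟩
    rcases g4 _ _ a (by linarith) (by linarith) with h | h <;> [left; right] <;> linarith
  · intro x y u v h1 h2 h3 h4 h0
    obtain ⟨x', y', ⟨g1, g2, g3, g4⟩, hw, st⟩ := S.step3 h1 h2 (by linarith) (by linarith) (ne h0)
    refine ⟨-y', x' + y', ⟨back g1, by linarith, by linarith, fun u v a b c => ?_⟩, by linarith,
      fun c hc => S.mono (st c (backD hc)) (by linarith)⟩
    rcases g4 _ _ a (by linarith) (by linarith) with h | h <;> [left; right] <;> linarith
  · intro x y u v h1 h2 h3 h4 h0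
    obtain ⟨x', y', ⟨g1, g2, g3, g4⟩, hw, st⟩ := S.step4 h1 h2 (by linarith) (by linarith) (ne h0)
    refine ⟨-y', x' + y', ⟨back g1, by linarith, by linarith, fun u v a b c => ?_⟩, by linarith,
      fun c hc => S.mono (st c (backD hc)) (by linarith)⟩
    rcases g4 _ _ a (by linarith) (by linarith) with h | h <;> [left; right] <;> linarith

/-- The bound holds for all pairs of points at distance less than `r`. -/
structure Ind (Q : ℝ → ℝ → Prop) (D : ℝ → ℝ → ℝ → Prop) (r : ℝ) : Prop where
  S : Sys Q D
  ih : ∀ x y, Q x y → hx x y < r → D x y (5 * tx x y)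
  ihp : ∀ x y x' y' c, Q x y → Q x' y' → hx (x' - x) (y' - y) < r → D x' y' c →
    D x y (5 * tx (x' - x) (y' - y) + c)

theorem Ind.swap {r : ℝ} (I : Ind Q D r) : Ind (fun x y => Q y x) (fun x y c => D y x c) r where
  S := I.S.swap
  ih := fun x y h h' => by
    rw [← hx_swap] at h'
    rw [← tx_swap]
    exact I.ih y x h h'
  ihp := fun x y x' y' c h1 h2 h3 h4 => by
    rw [← hx_swap] at h3
    rw [← tx_swap]
    exact I.ihp _ _ _ _ c h1 h2 h3 h4

theorem Ind.rotate {r : ℝ} (I : Ind Q D r) :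
    Ind (fun x y => Q (x + y) (-x)) (fun x y c => D (x + y) (-x) c) r := by
  have hxr (x y : ℝ) : hx (x + y) (-x) = hx x y := by
    rw [← hx_rot, neg_neg, add_neg_cancel_comm]
  have txr (x y : ℝ) : tx (x + y) (-x) = tx x y := by
    rw [← tx_rot, neg_neg, add_neg_cancel_comm]
  refine ⟨I.S.rotate, fun x y h h' => ?_, fun x y x' y' c h1 h2 h3 h4 => ?_⟩
  · rw [← txr]
    exact I.ih _ _ h (by rwa [hxr])
  · have e1 : x' + y' - (x + y) = (x' - x) + (y' - y) := by ring
    have e2 : -x' - -x = -(x' - x) := by ring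
    have := I.ihp _ _ _ _ c h1 h2 (by rwa [e1, e2, hxr]) h4
    rwa [e1, e2, txr] at this

theorem Ind.of_le {x y : ℝ} (I : Ind Q D (hx x y)) (hq : Q x y) (hxy : x ≤ y) (hy : y ≤ 0) :
    D x y (5 * tx x y) := by
  by_cases h0 : y = 0
  · obtain ⟨rfl, rfl⟩ := I.S.gp hq I.S.origin (Or.inr (Or.inl h0))
    exact I.S.mono I.S.zero (by simp [tx])
  have hh : hx x y ≤ -x + -y := by
    refine max_le ?_ (max_le ?_ ?_) <;> rw [abs_of_nonpos (by linarith)] <;> linarith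
  have hh' := neg_sum_le_hx x y
  have e : hx x y = -x + -y := by linarith
  have ht : -x - y / 2 ≤ tx x y := by
    refine le_trans ?_ (le_max_left _ _)
    rw [← abs_neg]
    exact le_trans (by linarith) (le_abs_self _)
  refine I.S.mono (by
    simpa only [neg_neg] using I.S.core (a := -x) (b := -y) (by simpa only [neg_neg] using hq)
      (neg_pos.2 (lt_of_le_of_ne hy h0)) (by linarith) (fun u v h h' => I.ih u v h (by linarith))
      (fun u v u' v' c h h' h'' => I.ihp u v u' v' c h h' (by linarith))) (by linarith)

theorem Ind.of_nonpos {x y : ℝ} (I : Ind Q D (hx x y)) (hq : Q x y) (hx0 : x ≤ 0) (hy0 : y ≤ 0) :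
    D x y (5 * tx x y) := by
  rcases le_total x y with h | h
  · exact I.of_le hq h hy0
  · have := Ind.of_le (x := y) (y := x) (by rw [hx_swap]; exact I.swap) hq h hx0
    rwa [tx_swap] at this

theorem Ind.of_iterate (n : ℕ) : ∀ {Q : ℝ → ℝ → Prop} {D : ℝ → ℝ → ℝ → Prop} {x y : ℝ},
    Ind Q D (hx x y) → Q x y →
    ((fun p : ℝ × ℝ => (-p.2, p.1 + p.2))^[n] (x, y)).1 ≤ 0 →
    ((fun p : ℝ × ℝ => (-p.2, p.1 + p.2))^[n] (x, y)).2 ≤ 0 → D x y (5 * tx x y) := by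
  induction n with
  | zero => exact fun I hq h1 h2 => I.of_nonpos hq h1 h2
  | succ n ih =>
    intro Q D x y I hq h1 h2
    rw [Function.iterate_succ_apply] at h1 h2
    have e : -y + (x + y) = x := by ring
    have := ih (Q := fun x y => Q (x + y) (-x)) (D := fun x y c => D (x + y) (-x) c) (x := -y)
      (y := x + y) (by rw [hx_rot]; exact I.rotate) (by rwa [e, neg_neg]) h1 h2
    rwa [e, neg_neg, tx_rot] at this

theorem Ind.bound {x y : ℝ} (I : Ind Q D (hx x y)) (hq : Q x y) : D x y (5 * tx x y) := by
  rcases le_total x 0 with h1 | h1 <;> rcases le_total y 0 with h2 | h2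
  · exact I.of_nonpos hq h1 h2
  · rcases le_total (x + y) 0 with h3 | h3
    · exact I.of_iterate 1 hq (by simpa using h2) (by simpa using h3)
    · exact I.of_iterate 2 hq (by simpa using by linarith) (by simpa using by linarith)
  · rcases le_total (x + y) 0 with h3 | h3
    · exact I.of_iterate 5 hq (by simpa using by linarith) (by simpa using by linarith)
    · exact I.of_iterate 4 hq (by simpa using by linarith) (by simpa using by linarith)
  · exact I.of_iterate 3 hq (by simpa using by linarith) (by simpa using by linarith)

end

/-- The point with oblique coordinates `(x, y)` relative to `t`. -/
noncomputable def obl (t : ℝ × ℝ) (x y : ℝ) : ℝ × ℝ := (t.1 + (x + y / 2), t.2 + √3 / 2 * y)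

theorem obl_zero (t : ℝ × ℝ) : obl t 0 0 = t := by simp [obl]

theorem sqrt_three_mul (x : ℝ) : √3 * (√3 * x) = 3 * x := by
  rw [← mul_assoc, Real.mul_self_sqrt (by norm_num)]

theorem exists_obl (t p : ℝ × ℝ) : ∃ x y, obl t x y = p :=
  ⟨p.1 - t.1 - (p.2 - t.2) / √3, 2 * (p.2 - t.2) / √3, by
    have : √3 ≠ 0 := by positivity
    ext <;> simp only [obl] <;> field_simp <;> ring⟩

theorem obl_sub (t : ℝ × ℝ) (x y u v : ℝ) : obl t u v - obl t x y = obl 0 (u - x) (v - y) := by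
  ext <;> simp only [obl, Prod.fst_sub, Prod.snd_sub, Prod.fst_zero, Prod.snd_zero] <;> ring

theorem obl_injective (t : ℝ × ℝ) : Function.Injective fun p : ℝ × ℝ => obl t p.1 p.2 := by
  intro p q h
  have h3 : √3 / 2 ≠ 0 := by positivity
  have h1 := congrArg Prod.fst h
  have h2 := congrArg Prod.snd h
  simp only [obl, add_right_inj, mul_right_inj' h3] at h1 h2
  exact Prod.ext (by linarith) h2

theorem hexNorm_obl (x y : ℝ) : hexNorm (obl 0 x y) = hx x y := by
  have h3 : √3 ≠ 0 := by positivity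
  have e1 : 2 * |√3 / 2 * y| / √3 = |y| := by
    rw [abs_mul, abs_of_pos (by positivity : (0 : ℝ) < √3 / 2)]
    field_simp
  have e2 : x + y / 2 + √3 / 2 * y / √3 = x + y := by
    field_simp
    ring
  have e3 : x + y / 2 - √3 / 2 * y / √3 = x := by
    field_simp
    ring
  simp only [hexNorm, obl, Prod.fst_zero, Prod.snd_zero, zero_add, e1, e2, e3, hx]
  rw [max_comm |x + y|, max_left_comm]

theorem thexNorm_obl (x y : ℝ) : thexNorm (obl 0 x y) = tx x y := by
  have e : √3 * (√3 / 2 * y) = 3 / 2 * y := by linear_combination sqrt_three_mul y / 2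
  simp only [thexNorm, obl, Prod.fst_zero, Prod.snd_zero, zero_add, e, tx,
    abs_div, abs_of_pos (two_pos : (0 : ℝ) < 2)]
  rw [← abs_of_pos (two_pos : (0 : ℝ) < 2)]
  simp only [← abs_div]
  congr 3 <;> ring_nf

theorem eucNorm_obl (x y : ℝ) : eucNorm (obl 0 x y) = √(x ^ 2 + x * y + y ^ 2) := by
  simp only [eucNorm, obl, Prod.fst_zero, Prod.snd_zero, zero_add]
  congr 1
  linear_combination y / 4 * sqrt_three_mul y

theorem eucNorm_obl_le (x y : ℝ) : eucNorm (obl 0 x y) ≤ hx x y := by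
  rw [eucNorm_obl]
  refine Real.sqrt_le_iff.2 ⟨(abs_nonneg x).trans (le_max_left _ _), ?_⟩
  have h1 : x ^ 2 ≤ hx x y ^ 2 := sq_le_sq' (by linarith [neg_x_le_hx x y]) (x_le_hx x y)
  have h2 : y ^ 2 ≤ hx x y ^ 2 := sq_le_sq' (by linarith [neg_y_le_hx x y]) (y_le_hx x y)
  have h3 : (x + y) ^ 2 ≤ hx x y ^ 2 :=
    sq_le_sq' (by linarith [neg_sum_le_hx x y]) (sum_le_hx x y)
  rcases le_total 0 x with hx0 | hx0 <;> rcases le_total 0 y with hy0 | hy0 <;>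
    rcases le_total 0 (x + y) with hs | hs <;> nlinarith

theorem thexNorm_le_eucNorm (v : ℝ × ℝ) : thexNorm v ≤ eucNorm v := by
  have h3 := sqrt_three_mul 1
  refine max_le (Real.abs_le_sqrt (by nlinarith [sq_nonneg v.2])) (max_le ?_ ?_)
  · rw [← abs_of_pos (two_pos : (0 : ℝ) < 2), ← abs_div]
    exact Real.abs_le_sqrt (by nlinarith [sq_nonneg (√3 * v.1 - v.2)])
  · rw [← abs_of_pos (two_pos : (0 : ℝ) < 2), ← abs_div]
    exact Real.abs_le_sqrt (by nlinarith [sq_nonneg (√3 * v.1 + v.2)])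

theorem genPos.obl {P : Finset (ℝ × ℝ)} (hP : genPos P) {t : ℝ × ℝ} {x y u v : ℝ}
    (h₁ : obl t x y ∈ P) (h₂ : obl t u v ∈ P) (h : x = u ∨ y = v ∨ x + y = u + v) :
    x = u ∧ y = v := by
  by_contra hne
  have ⟨n1, n2, n3⟩ := hP _ h₁ _ h₂ fun e => hne (Prod.ext_iff.1 (@obl_injective t (x, y) (u, v) e))
  simp only [_root_.obl] at n1 n2 n3
  rcases h with rfl | rfl | h
  · exact n2 (by ring)
  · exact n1 rfl
  · obtain rfl : x = u + v - y := by linarith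
    exact n3 (by ring)

theorem rot_neg_pi_div_three (x y : ℝ) :
    rot (-(π / 3)) (obl 0 x y) = obl 0 (x + y) (-x) := by
  ext <;> simp only [rot, obl, Real.cos_neg, Real.sin_neg, Real.cos_pi_div_three,
    Real.sin_pi_div_three, Prod.fst_zero, Prod.snd_zero]
  · linear_combination sqrt_three_mul y / 4
  · ring

theorem rot_add (θ η : ℝ) (v : ℝ × ℝ) : rot (θ + η) v = rot θ (rot η v) := by
  ext <;> simp only [rot, Real.cos_add, Real.sin_add] <;> ring

theorem rot_mul_pi_div_three (k : ℕ) (x y : ℝ) :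
    rot (-(k * (π / 3))) (obl 0 x y) =
      (fun p : ℝ × ℝ => obl 0 p.1 p.2) ((fun p : ℝ × ℝ => (p.1 + p.2, -p.1))^[k] (x, y)) := by
  induction k with
  | zero => simp [rot]
  | succ k ih =>
    have e : -(((k + 1 : ℕ) : ℝ) * (π / 3)) = -(π / 3) + -(k * (π / 3)) := by
      push_cast
      ring
    rw [e, rot_add, ih, Function.iterate_succ_apply']
    exact rot_neg_pi_div_three _ _

theorem obl_mem_cone0 (x y : ℝ) : obl 0 x y ∈ cone0 ↔ 0 ≤ x ∧ x + y ≤ 0 := by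
  have h3 : (0 : ℝ) < √3 := by positivity
  simp only [cone0, Set.mem_ofPred_eq, obl, Prod.fst_zero, Prod.snd_zero, zero_add]
  have e : -(√3 / 2 * y) = √3 * (-y / 2) := by ring
  rw [e, mul_le_mul_iff_right₀ h3, abs_le]
  constructor
  · rintro ⟨-, h1, h2⟩
    constructor <;> linarith
  · rintro ⟨h1, h2⟩
    exact ⟨mul_nonpos_of_nonneg_of_nonpos (by positivity) (by linarith), by linarith, by linarith⟩

theorem obl_mem_cone (t : ℝ × ℝ) (x y u v : ℝ) (i : ZMod 6) :
    obl t u v ∈ cone (obl t x y) i ↔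
      0 ≤ ((fun p : ℝ × ℝ => (p.1 + p.2, -p.1))^[i.val] (u - x, v - y)).1 ∧
      ((fun p : ℝ × ℝ => (p.1 + p.2, -p.1))^[i.val] (u - x, v - y)).1 +
        ((fun p : ℝ × ℝ => (p.1 + p.2, -p.1))^[i.val] (u - x, v - y)).2 ≤ 0 := by
  rw [cone, Set.mem_ofPred_eq, localCoord, obl_sub, rot_mul_pi_div_three, obl_mem_cone0]

theorem rot_eq_zero {θ : ℝ} {v : ℝ × ℝ} (h : rot θ v = 0) : v = 0 := by
  have h1 := congrArg Prod.fst h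
  have h2 := congrArg Prod.snd h
  simp only [rot, Prod.fst_zero, Prod.snd_zero] at h1 h2
  have h3 := Real.sin_sq_add_cos_sq θ
  ext
  · simp only [Prod.fst_zero]
    linear_combination cos θ * h1 + sin θ * h2 - v.1 * h3
  · simp only [Prod.snd_zero]
    linear_combination cos θ * h2 - sin θ * h1 - v.2 * h3

theorem rot_smul (θ c : ℝ) (v : ℝ × ℝ) : rot θ (c • v) = c • rot θ v := by
  ext <;> simp only [rot, Prod.smul_fst, Prod.smul_snd, smul_eq_mul] <;> ring

theorem cone0_pointed {v : ℝ × ℝ} {c : ℝ} (hc : 0 < c) (h : v ∈ cone0) (h' : -(c • v) ∈ cone0) :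
    v = 0 := by
  have h3 : (0 : ℝ) < √3 := by positivity
  simp only [cone0, Set.mem_ofPred_eq, Prod.fst_neg, Prod.snd_neg, Prod.smul_fst, Prod.smul_snd,
    smul_eq_mul] at h h'
  have h2 : v.2 = 0 := le_antisymm h.1 (by nlinarith)
  have h1 : |v.1| ≤ 0 := by
    have := h.2
    rw [h2] at this
    nlinarith
  exact Prod.ext (abs_nonpos_iff.1 h1) h2

theorem hexNorm_smul {c : ℝ} (hc : 0 ≤ c) (v : ℝ × ℝ) : hexNorm (c • v) = c * hexNorm v := by
  simp only [hexNorm, Prod.smul_fst, Prod.smul_snd, smul_eq_mul]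
  rw [mul_max_of_nonneg _ _ hc, mul_max_of_nonneg _ _ hc]
  congr 1
  · rw [abs_mul, abs_of_nonneg hc]
    ring
  · rw [mul_div_assoc, ← mul_add, ← mul_sub, abs_mul, abs_mul, abs_of_nonneg hc]

theorem hexNorm_pos {v : ℝ × ℝ} (h : v ≠ 0) : 0 < hexNorm v := by
  by_contra! hle
  have h3 : (0 : ℝ) < √3 := by positivity
  have h1 : 2 * |v.2| / √3 ≤ 0 := (le_max_left _ _).trans hle
  have h2 : |v.1 + v.2 / √3| ≤ 0 := (le_max_left _ _).trans ((le_max_right _ _).trans hle)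
  have e2 : v.2 = 0 := by
    rw [div_le_iff₀ h3] at h1
    exact abs_nonpos_iff.1 (by linarith)
  rw [e2, zero_div, add_zero] at h2
  exact h (Prod.ext (abs_nonpos_iff.1 h2) e2)

/-- A nearest point in a cone is joined by an edge. -/
theorem isEdge_of_nearest {P : Finset (ℝ × ℝ)} {p q : ℝ × ℝ} (i : ZMod 6) (hp : p ∈ P)
    (hq : q ∈ P) (hpq : q ≠ p) (hi : q ∈ cone p i)
    (hmin : ∀ r ∈ P, r ≠ p → r ∈ cone p i → hexNorm (q - p) ≤ hexNorm (r - p)) :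
    isEdge P p q := by
  refine ⟨hp, hq, hpq.symm, fun r hr hint => ?_⟩
  have key : ∀ d : ℝ × ℝ, ∃ c : ℝ, 0 < c ∧ r + c • d ∈ nabla p q := by
    intro d
    have hc : Filter.Tendsto (fun c : ℝ => r + c • d) (nhdsWithin 0 (Set.Ioi 0)) (nhds r) := by
      have : Continuous fun c : ℝ => r + c • d := by fun_prop
      simpa using (this.tendsto 0).mono_left nhdsWithin_le_nhds
    obtain ⟨c, h1, h2⟩ := ((hc.eventually (mem_interior_iff_mem_nhds.1 hint)).and
      self_mem_nhdsWithin).exists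
    exact ⟨c, h2, h1⟩
  by_cases hrp : r = p
  · obtain ⟨c, hc, -, h⟩ := key (-(q - p))
    have := h i hi
    rw [hrp, cone, Set.mem_ofPred_eq, localCoord, smul_neg, add_sub_cancel_left, ← neg_smul,
      rot_smul, neg_smul] at this
    exact hpq (sub_eq_zero.1 (rot_eq_zero (cone0_pointed hc hi this)))
  · obtain ⟨c, hc, h, -⟩ := key (r - p)
    have e : r + c • (r - p) - p = (1 + c) • (r - p) := by
      rw [add_smul, one_smul]
      abel
    rw [e, hexNorm_smul (by linarith)] at h
    have h1 := hmin r hr hrp ((interior_subset hint).2 i hi)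
    have h2 := hexNorm_pos (sub_ne_zero.2 hrp)
    nlinarith

/-- `Walk P t s c`: there is a directed path from `s` to `t` of length at most `c`. -/
inductive Walk (P : Finset (ℝ × ℝ)) (t : ℝ × ℝ) : ℝ × ℝ → ℝ → Prop
  | refl {c : ℝ} : 0 ≤ c → Walk P t t c
  | cons {u v : ℝ × ℝ} {c c' : ℝ} :
    isEdge P u v → Walk P t v c → c + eucNorm (v - u) ≤ c' → Walk P t u c'

theorem Walk.mono {P : Finset (ℝ × ℝ)} {s t : ℝ × ℝ} {c c' : ℝ} (h : Walk P t s c)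
    (hc : c ≤ c') : Walk P t s c' := by
  cases h with
  | refl h => exact .refl (h.trans hc)
  | cons h1 h2 h3 => exact .cons h1 h2 (h3.trans hc)

theorem Walk.trans {P : Finset (ℝ × ℝ)} {r s t : ℝ × ℝ} {c c' : ℝ} (h : Walk P r s c)
    (h' : Walk P t r c') : Walk P t s (c + c') := by
  induction h with
  | refl h => exact h'.mono (by linarith)
  | cons h1 _ h3 ih => exact .cons h1 ih (by linarith)

theorem Walk.exists_isPath {P : Finset (ℝ × ℝ)} {s t : ℝ × ℝ} {c : ℝ} (h : Walk P t s c) :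
    ∃ ℓ, isPath P ℓ s t ∧ pathLen ℓ ≤ c := by
  induction h with
  | refl h => exact ⟨[t], ⟨by simp, by simp, by simp, List.isChain_singleton _⟩,
      by simpa [pathLen] using h⟩
  | @cons u v c c' h1 _ h3 ih =>
    obtain ⟨ℓ, ⟨-, h5, h6, h7⟩, h8⟩ := ih
    cases ℓ with
    | nil => simp at h5
    | cons w ℓ =>
      obtain rfl : w = v := by simpa using h5
      refine ⟨u :: w :: ℓ, ⟨by simp, by simp, by simpa using h6, h7.cons_cons h1⟩, ?_⟩
      simp only [pathLen, List.tail_cons, List.zip_cons_cons, List.map_cons, List.sum_cons] at h8 ⊢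
      linarith

theorem exists_step {P : Finset (ℝ × ℝ)} {t : ℝ × ℝ} {x y u v : ℝ} (i : ZMod 6)
    (h₁ : obl t x y ∈ P) (h₂ : obl t u v ∈ P) (hi : obl t u v ∈ cone (obl t x y) i)
    (hne : ¬(u = x ∧ v = y)) :
    ∃ x' y', obl t x' y' ∈ P ∧ obl t x' y' ∈ cone (obl t x y) i ∧ ¬(x' = x ∧ y' = y) ∧
      (∀ u v, obl t u v ∈ P → obl t u v ∈ cone (obl t x y) i → ¬(u = x ∧ v = y) →
        hx (x' - x) (y' - y) ≤ hx (u - x) (v - y)) ∧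
      ∀ c, Walk P t (obl t x' y') c → Walk P t (obl t x y) (c + hx (x' - x) (y' - y)) := by
  classical
  have hinj : ∀ {u v : ℝ}, obl t u v ≠ obl t x y ↔ ¬(u = x ∧ v = y) := fun {u v} => by
    rw [Ne, not_iff_not, ← Prod.mk.injEq]
    exact (obl_injective t).eq_iff (a := (u, v)) (b := (x, y))
  obtain ⟨q, hq, hmin⟩ := Finset.exists_min_image
    (P.filter fun r => r ≠ obl t x y ∧ r ∈ cone (obl t x y) i) (fun r => hexNorm (r - obl t x y))
    ⟨obl t u v, Finset.mem_filter.2 ⟨h₂, hinj.2 hne, hi⟩⟩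
  obtain ⟨x', y', rfl⟩ := exists_obl t q
  have ⟨hqP, hq0, hqi⟩ := Finset.mem_filter.1 hq
  refine ⟨x', y', hqP, hqi, hinj.1 hq0, fun u v g1 g2 g3 => ?_, fun c hc => ?_⟩
  · simpa only [obl_sub, hexNorm_obl] using
      hmin _ (Finset.mem_filter.2 ⟨g1, hinj.2 g3, g2⟩)
  · refine .cons (isEdge_of_nearest i h₁ hqP hq0 hqi fun r hr hr0 hri =>
      hmin r (Finset.mem_filter.2 ⟨hr, hr0, hri⟩)) hc ?_
    rw [obl_sub]
    have := eucNorm_obl_le (x' - x) (y' - y)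
    linarith

/-- The points of `P` form a system, in oblique coordinates centred at `t`. -/
theorem sys_obl {P : Finset (ℝ × ℝ)} (hP : genPos P) {t : ℝ × ℝ} (ht : t ∈ P) :
    Sys (fun x y => obl t x y ∈ P) fun x y c => Walk P t (obl t x y) c := by
  have v2 : (2 : ZMod 6).val = 2 := rfl
  have v3 : (3 : ZMod 6).val = 3 := rfl
  have v4 : (4 : ZMod 6).val = 4 := rfl
  have v5 : (5 : ZMod 6).val = 5 := rfl
  have m0 (x y u v : ℝ) : obl t u v ∈ cone (obl t x y) 0 ↔ x ≤ u ∧ u + v ≤ x + y := by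
    rw [obl_mem_cone]
    simp only [ZMod.val_zero, Function.iterate_zero, id]
    constructor <;> rintro ⟨h1, h2⟩ <;> constructor <;> linarith
  have m1 (x y u v : ℝ) : obl t u v ∈ cone (obl t x y) 1 ↔ v ≤ y ∧ x + y ≤ u + v := by
    rw [obl_mem_cone, show (1 : ZMod 6).val = 1 from rfl]
    simp only [Function.iterate_succ, Function.iterate_zero, Function.comp, id]
    constructor <;> rintro ⟨h1, h2⟩ <;> constructor <;> linarith
  have m2 (x y u v : ℝ) : obl t u v ∈ cone (obl t x y) 2 ↔ x ≤ u ∧ y ≤ v := by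
    rw [obl_mem_cone, v2]
    simp only [Function.iterate_succ, Function.iterate_zero, Function.comp, id]
    constructor <;> rintro ⟨h1, h2⟩ <;> constructor <;> linarith
  have m3 (x y u v : ℝ) : obl t u v ∈ cone (obl t x y) 3 ↔ u ≤ x ∧ x + y ≤ u + v := by
    rw [obl_mem_cone, v3]
    simp only [Function.iterate_succ, Function.iterate_zero, Function.comp, id]
    constructor <;> rintro ⟨h1, h2⟩ <;> constructor <;> linarith
  have m4 (x y u v : ℝ) : obl t u v ∈ cone (obl t x y) 4 ↔ y ≤ v ∧ u + v ≤ x + y := by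
    rw [obl_mem_cone, v4]
    simp only [Function.iterate_succ, Function.iterate_zero, Function.comp, id]
    constructor <;> rintro ⟨h1, h2⟩ <;> constructor <;> linarith
  have m5 (x y u v : ℝ) : obl t u v ∈ cone (obl t x y) 5 ↔ u ≤ x ∧ v ≤ y := by
    rw [obl_mem_cone, v5]
    simp only [Function.iterate_succ, Function.iterate_zero, Function.comp, id]
    constructor <;> rintro ⟨h1, h2⟩ <;> constructor <;> linarith
  have hxe {x y B : ℝ} (h : B = x ∨ B = -x ∨ B = y ∨ B = -y ∨ B = x + y ∨ B = -(x + y))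
      (h1 : x ≤ B) (h2 : -x ≤ B) (h3 : y ≤ B) (h4 : -y ≤ B) (h5 : x + y ≤ B)
      (h6 : -(x + y) ≤ B) : hx x y = B := by
    refine le_antisymm (max_le (abs_le.2 ⟨by linarith, h1⟩)
      (max_le (abs_le.2 ⟨by linarith, h3⟩) (abs_le.2 ⟨by linarith, h5⟩))) ?_
    rcases h with rfl | rfl | rfl | rfl | rfl | rfl
    exacts [x_le_hx _ _, neg_x_le_hx _ _, y_le_hx _ _, neg_y_le_hx _ _, sum_le_hx _ _,
      neg_sum_le_hx _ _]
  have sgn {x y u v : ℝ} (h₁ : obl t x y ∈ P) (h₂ : obl t u v ∈ P) (h : ¬(u = x ∧ v = y)) :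
      u ≠ x ∧ v ≠ y ∧ u + v ≠ x + y :=
    ⟨fun e => h (hP.obl h₂ h₁ (.inl e)), fun e => h (hP.obl h₂ h₁ (.inr (.inl e))),
      fun e => h (hP.obl h₂ h₁ (.inr (.inr e)))⟩
  constructor
  · exact P.finite_toSet.preimage (obl_injective t).injOn
  · exact fun h hc => h.mono hc
  · rw [obl_zero]
    exact .refl le_rfl
  · rwa [obl_zero]
  · exact fun h₁ h₂ h => hP.obl h₁ h₂ h
  · intro x y u v h₁ h₂ h3 h4 hne
    obtain ⟨x', y', g1, g2, g3, g4, g5⟩ := exists_step 2 h₁ h₂ ((m2 ..).2 ⟨h3, h4⟩) hne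
    rw [m2] at g2
    have e {u v : ℝ} (h : x ≤ u ∧ y ≤ v) : hx (u - x) (v - y) = u + v - (x + y) := by
      obtain ⟨h, h'⟩ := h
      refine hxe (by ring_nf; simp) ?_ ?_ ?_ ?_ ?_ ?_ <;> linarith
    obtain ⟨n1, n2, n3⟩ := sgn h₁ g1 g3
    rw [e g2] at g4 g5
    have g4 (u v : ℝ) (a : obl t u v ∈ P) (b : x ≤ u ∧ y ≤ v) (hne : ¬(u = x ∧ v = y)) :
        x' + y' ≤ u + v := by linarith [g4 u v a ((m2 ..).2 b) hne, e b]
    refine ⟨x', y', ⟨g1, g2.1.lt_of_ne' n1, g2.2.lt_of_ne' n2, fun u v a b b' => ?_⟩,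
      g4 u v h₂ ⟨h3, h4⟩ hne, g5⟩
    by_cases h : u = x ∧ v = y
    · left; linarith
    · exact .inr (g4 u v a ⟨b, b'⟩ h)
  · intro x y u v h₁ h₂ h3 h4 hne
    obtain ⟨x', y', g1, g2, g3, g4, g5⟩ := exists_step 3 h₁ h₂ ((m3 ..).2 ⟨h3, h4⟩) hne
    rw [m3] at g2
    have e {u v : ℝ} (h : u ≤ x ∧ x + y ≤ u + v) : hx (u - x) (v - y) = v - y := by
      obtain ⟨h, h'⟩ := h
      refine hxe (by simp) ?_ ?_ ?_ ?_ ?_ ?_ <;> linarith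
    obtain ⟨n1, n2, n3⟩ := sgn h₁ g1 g3
    rw [e g2] at g4 g5
    have g4 (u v : ℝ) (a : obl t u v ∈ P) (b : u ≤ x ∧ x + y ≤ u + v) (hne : ¬(u = x ∧ v = y)) :
        y' ≤ v := by linarith [g4 u v a ((m3 ..).2 b) hne, e b]
    refine ⟨x', y', ⟨g1, g2.1.lt_of_ne n1, g2.2.lt_of_ne' n3, fun u v a b b' => ?_⟩,
      g4 u v h₂ ⟨h3, h4⟩ hne, g5⟩
    by_cases h : u = x ∧ v = y
    · left; linarith
    · exact .inr (g4 u v a ⟨b, b'⟩ h)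
  · intro x y u v h₁ h₂ h3 h4 hne
    obtain ⟨x', y', g1, g2, g3, g4, g5⟩ := exists_step 4 h₁ h₂ ((m4 ..).2 ⟨h3, h4⟩) hne
    rw [m4] at g2
    have e {u v : ℝ} (h : y ≤ v ∧ u + v ≤ x + y) : hx (u - x) (v - y) = x - u := by
      obtain ⟨h, h'⟩ := h
      refine hxe (by simp) ?_ ?_ ?_ ?_ ?_ ?_ <;> linarith
    obtain ⟨n1, n2, n3⟩ := sgn h₁ g1 g3
    rw [e g2] at g4 g5
    have g4 (u v : ℝ) (a : obl t u v ∈ P) (b : y ≤ v ∧ u + v ≤ x + y) (hne : ¬(u = x ∧ v = y)) :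
        u ≤ x' := by linarith [g4 u v a ((m4 ..).2 b) hne, e b]
    refine ⟨x', y', ⟨g1, g2.1.lt_of_ne' n2, g2.2.lt_of_ne n3, fun u v a b b' => ?_⟩,
      g4 u v h₂ ⟨h3, h4⟩ hne, g5⟩
    by_cases h : u = x ∧ v = y
    · left; linarith
    · exact .inr (g4 u v a ⟨b, b'⟩ h)
  · intro x y u v h₁ h₂ h3 h4 hne
    obtain ⟨x', y', g1, g2, g3, g4, g5⟩ := exists_step 5 h₁ h₂ ((m5 ..).2 ⟨h3, h4⟩) hne
    rw [m5] at g2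
    have e {u v : ℝ} (h : u ≤ x ∧ v ≤ y) : hx (u - x) (v - y) = x + y - (u + v) := by
      obtain ⟨h, h'⟩ := h
      refine hxe (by ring_nf; simp) ?_ ?_ ?_ ?_ ?_ ?_ <;> linarith
    obtain ⟨n1, n2, n3⟩ := sgn h₁ g1 g3
    rw [e g2] at g4 g5
    have g4 (u v : ℝ) (a : obl t u v ∈ P) (b : u ≤ x ∧ v ≤ y) (hne : ¬(u = x ∧ v = y)) :
        u + v ≤ x' + y' := by linarith [g4 u v a ((m5 ..).2 b) hne, e b]
    refine ⟨x', y', ⟨g1, g2.1.lt_of_ne n1, g2.2.lt_of_ne n2, fun u v a b b' => ?_⟩,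
      g4 u v h₂ ⟨h3, h4⟩ hne, g5⟩
    by_cases h : u = x ∧ v = y
    · left; linarith
    · exact .inr (g4 u v a ⟨b, b'⟩ h)
  · intro x y u v h₁ h₂ h3 h4 hne
    obtain ⟨x', y', g1, g2, g3, g4, g5⟩ := exists_step 0 h₁ h₂ ((m0 ..).2 ⟨h3, h4⟩) hne
    rw [m0] at g2
    have e {u v : ℝ} (h : x ≤ u ∧ u + v ≤ x + y) : hx (u - x) (v - y) = y - v := by
      obtain ⟨h, h'⟩ := h
      refine hxe (by simp) ?_ ?_ ?_ ?_ ?_ ?_ <;> linarith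
    obtain ⟨n1, n2, n3⟩ := sgn h₁ g1 g3
    rw [e g2] at g4 g5
    have g4 (u v : ℝ) (a : obl t u v ∈ P) (b : x ≤ u ∧ u + v ≤ x + y) (hne : ¬(u = x ∧ v = y)) :
        v ≤ y' := by linarith [g4 u v a ((m0 ..).2 b) hne, e b]
    refine ⟨x', y', ⟨g1, g2.1.lt_of_ne' n1, g2.2.lt_of_ne n3, fun u v a b b' => ?_⟩,
      g4 u v h₂ ⟨h3, h4⟩ hne, g5⟩
    by_cases h : u = x ∧ v = y
    · left; linarith
    · exact .inr (g4 u v a ⟨b, b'⟩ h)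
  · intro x y u v h₁ h₂ h3 h4 hne
    obtain ⟨x', y', g1, g2, g3, g4, g5⟩ := exists_step 1 h₁ h₂ ((m1 ..).2 ⟨h3, h4⟩) hne
    rw [m1] at g2
    have e {u v : ℝ} (h : v ≤ y ∧ x + y ≤ u + v) : hx (u - x) (v - y) = u - x := by
      obtain ⟨h, h'⟩ := h
      refine hxe (by simp) ?_ ?_ ?_ ?_ ?_ ?_ <;> linarith
    obtain ⟨n1, n2, n3⟩ := sgn h₁ g1 g3
    rw [e g2] at g4 g5
    have g4 (u v : ℝ) (a : obl t u v ∈ P) (b : v ≤ y ∧ x + y ≤ u + v) (hne : ¬(u = x ∧ v = y)) :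
        x' ≤ u := by linarith [g4 u v a ((m1 ..).2 b) hne, e b]
    refine ⟨x', y', ⟨g1, g2.1.lt_of_ne n2, g2.2.lt_of_ne' n3, fun u v a b b' => ?_⟩,
      g4 u v h₂ ⟨h3, h4⟩ hne, g5⟩
    by_cases h : u = x ∧ v = y
    · left; linarith
    · exact .inr (g4 u v a ⟨b, b'⟩ h)

theorem hx_neg (x y : ℝ) : hx (-x) (-y) = hx x y := by
  simp only [hx, ← neg_add, abs_neg]

theorem tx_neg (x y : ℝ) : tx (-x) (-y) = tx x y := by
  simp only [tx, ← neg_sub', neg_div, ← neg_add, abs_neg]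

theorem exists_walk {P : Finset (ℝ × ℝ)} (hP : genPos P) :
    ∀ s ∈ P, ∀ t ∈ P, Walk P t s (5 * thexNorm (t - s)) := by
  classical
  have hwf : (↑(P ×ˢ P) : Set ((ℝ × ℝ) × ℝ × ℝ)).WellFoundedOn
      (Function.onFun (· < ·) fun p => hexNorm (p.2 - p.1)) :=
    Set.wellFoundedOn_image.1 ((P ×ˢ P).finite_toSet.image _).wellFoundedOn
  have key : ∀ p ∈ (↑(P ×ˢ P) : Set ((ℝ × ℝ) × ℝ × ℝ)),
      Walk P p.2 p.1 (5 * thexNorm (p.2 - p.1)) := by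
    refine fun p hp => hwf.induction (P := fun p => Walk P p.2 p.1 (5 * thexNorm (p.2 - p.1))) hp
      fun p hp ih => ?_
    obtain ⟨s, t⟩ := p
    obtain ⟨hs, ht⟩ : s ∈ P ∧ t ∈ P := by simpa using hp
    obtain ⟨x, y, rfl⟩ := exists_obl t s
    have hsub (u v : ℝ) : t - obl t u v = obl 0 (-u) (-v) := by
      have := obl_sub t u v 0 0
      rwa [obl_zero, zero_sub, zero_sub] at this
    have I : Ind (fun x y => obl t x y ∈ P) (fun x y c => Walk P t (obl t x y) c) (hx x y) := by
      refine ⟨sys_obl hP ht, fun u v h h' => ?_, fun u v u' v' c h1 h2 h3 h4 => ?_⟩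
      · have := ih (obl t u v, t) (by simp [h, ht])
        simp only [Function.onFun, hsub, hexNorm_obl, thexNorm_obl, hx_neg, tx_neg] at this
        exact this h'
      · have := ih (obl t u v, obl t u' v') (by simp [h1, h2])
        simp only [Function.onFun, hsub, obl_sub, hexNorm_obl, thexNorm_obl, hx_neg] at this
        exact (this h3).trans h4
    simpa only [hsub, thexNorm_obl, tx_neg] using I.bound hs
  exact fun s hs t ht => key (s, t) (by simp [hs, ht])

theorem stmt13 (P : Finset (ℝ × ℝ)) (hP : genPos P) (s t : ℝ × ℝ)
    (hs : s ∈ P) (ht : t ∈ P) :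
    ∃ ℓ : List (ℝ × ℝ), isPath P ℓ s t ∧
      pathLen ℓ ≤ 5 * thexNorm (t - s) ∧ pathLen ℓ ≤ 5 * eucNorm (t - s) := by
  obtain ⟨ℓ, h, hle⟩ := (exists_walk hP s hs t ht).exists_isPath
  exact ⟨ℓ, h, hle, hle.trans (by linarith [thexNorm_le_eucNorm (t - s)])⟩
end
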